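/- Let X ⊆ ℤ_p be a subanalytic set and f : X → ℚ_p a subanalytic function. Then there exists a finite partition of X into cells such that for each cell A of the partition, with center γ ∈ ℚ_p and coset μP_n, there exist δ ∈ ℚ_p and an integer a with |f(t)| = |δ| · |(t−γ)^a μ^{−a}|^{1/n} for each t ∈ A (with the conventions a = 0 and 0^0 = 1 when μ = 0). -/

import Mathlib

open Filter MeasureTheory
open scoped ENNReal

namespace PadicSub

variable (p : ℕ) [Fact p.Prime]

/-- The coefficients (indexed by multi-indices) of a restricted power series:
they tend to `0` along the cofinite filter. -/
def IsRestrictedCoeffs {m : ℕ} (a : (Fin m → ℕ) → ℚ_[p]) : Prop :=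
  Filter.Tendsto a Filter.cofinite (nhds 0)

/-- The restricted analytic function associated to a family of coefficients:
the sum of the power series on `ℤ_p^m`, and `0` outside `ℤ_p^m`. -/
noncomputable def ranalFn {m : ℕ} (a : (Fin m → ℕ) → ℚ_[p]) (x : Fin m → ℚ_[p]) : ℚ_[p] :=
  if ∀ j, ‖x j‖ ≤ 1 then ∑' i : (Fin m → ℕ), a i * ∏ j, x j ^ i j else 0

/-- `D`-functions: the functions obtained from restricted analytic functions, polynomial
maps, and the inverse function (with the convention `0⁻¹ = 0`) by repeated composition. -/
inductive IsDFunction : {m : ℕ} → ((Fin m → ℚ_[p]) → ℚ_[p]) → Prop where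
  | ranal {m : ℕ} (a : (Fin m → ℕ) → ℚ_[p]) (ha : IsRestrictedCoeffs p a) :
      IsDFunction (ranalFn p a)
  | poly {m : ℕ} (q : MvPolynomial (Fin m) ℚ_[p]) :
      IsDFunction (fun x => MvPolynomial.eval x q)
  | inv : IsDFunction (fun x : Fin 1 → ℚ_[p] => (x 0)⁻¹)
  | comp {m n : ℕ} (f : (Fin n → ℚ_[p]) → ℚ_[p]) (g : Fin n → (Fin m → ℚ_[p]) → ℚ_[p]) :
      IsDFunction f → (∀ i, IsDFunction (g i)) →
      IsDFunction (fun x => f (fun i => g i x))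

/-- `P_n`: the set of nonzero `n`-th powers in `ℚ_p`. -/
def Pset (n : ℕ) : Set ℚ_[p] := {x | ∃ y : ℚ_[p], y ≠ 0 ∧ y ^ n = x}

/-- The coset `μ P_n`. -/
def cosetP (μ : ℚ_[p]) (n : ℕ) : Set ℚ_[p] := {x | ∃ y ∈ Pset p n, x = μ * y}

/-- A (globally) subanalytic subset of `ℚ_p^m`: a finite union of finite intersections of
sets of the form `{x | f x = 0}` and `{x | f x ∈ P_n}`, `f` a `D`-function, `n > 0`. -/
def IsSubanalytic {m : ℕ} (X : Set (Fin m → ℚ_[p])) : Prop :=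
  ∃ (r s : ℕ) (F : Fin r → Fin s → Set (Fin m → ℚ_[p])),
    (∀ i j, (∃ f, IsDFunction p f ∧ F i j = {x | f x = 0}) ∨
            (∃ f n, IsDFunction p f ∧ 0 < n ∧ F i j = {x | f x ∈ Pset p n})) ∧
    X = ⋃ i, ⋂ j, F i j

/-- A semialgebraic subset of `ℚ_p^m`: a finite union of finite intersections of
sets of the form `{x | f x = 0}` and `{x | f x ∈ P_n}`, `f` a polynomial, `n > 0`. -/
def IsSemialgebraic {m : ℕ} (X : Set (Fin m → ℚ_[p])) : Prop :=
  ∃ (r s : ℕ) (F : Fin r → Fin s → Set (Fin m → ℚ_[p])),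
    (∀ i j, (∃ f : MvPolynomial (Fin m) ℚ_[p], F i j = {x | MvPolynomial.eval x f = 0}) ∨
            (∃ (f : MvPolynomial (Fin m) ℚ_[p]) (n : ℕ), 0 < n ∧
              F i j = {x | MvPolynomial.eval x f ∈ Pset p n})) ∧
    X = ⋃ i, ⋂ j, F i j

/-- The graph of the restriction to `X` of a map `ℚ_p^m → ℚ_p^n`, inside `ℚ_p^(m+n)`. -/
def graphMap {m n : ℕ} (X : Set (Fin m → ℚ_[p])) (F : (Fin m → ℚ_[p]) → (Fin n → ℚ_[p])) :
    Set (Fin (m + n) → ℚ_[p]) :=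
  {z | (fun i => z (Fin.castAdd n i)) ∈ X ∧
    F (fun i => z (Fin.castAdd n i)) = fun j => z (Fin.natAdd m j)}

/-- The graph of the restriction to `X` of a function `ℚ_p^m → ℚ_p`, inside `ℚ_p^(m+1)`. -/
def graphFun {m : ℕ} (X : Set (Fin m → ℚ_[p])) (f : (Fin m → ℚ_[p]) → ℚ_[p]) :
    Set (Fin (m + 1) → ℚ_[p]) :=
  {z | (fun i : Fin m => z i.castSucc) ∈ X ∧ f (fun i : Fin m => z i.castSucc) = z (Fin.last m)}

/-- A function `ℚ_p^m → ℚ_p` is subanalytic on `X` if its graph over `X` is subanalytic. -/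
def IsSubanalyticFnOn {m : ℕ} (X : Set (Fin m → ℚ_[p])) (f : (Fin m → ℚ_[p]) → ℚ_[p]) : Prop :=
  IsSubanalytic p (graphFun p X f)

/-- A (totally defined) subanalytic function `ℚ_p^m → ℚ_p`. -/
def IsSubanalyticFn {m : ℕ} (f : (Fin m → ℚ_[p]) → ℚ_[p]) : Prop :=
  IsSubanalyticFnOn p Set.univ f

/-- A function `ℚ_p^m → ℚ_p` is semialgebraic on `X` if its graph over `X` is
semialgebraic. -/
def IsSemialgebraicFnOn {m : ℕ} (X : Set (Fin m → ℚ_[p])) (f : (Fin m → ℚ_[p]) → ℚ_[p]) :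
    Prop :=
  IsSemialgebraic p (graphFun p X f)

/-- A subanalytic subset of `ℚ_p` (one-variable version). -/
def IsSubanalytic1 (X : Set ℚ_[p]) : Prop :=
  IsSubanalytic p {z : Fin 1 → ℚ_[p] | z 0 ∈ X}

/-- A semialgebraic subset of `ℚ_p` (one-variable version). -/
def IsSemialgebraic1 (X : Set ℚ_[p]) : Prop :=
  IsSemialgebraic p {z : Fin 1 → ℚ_[p] | z 0 ∈ X}

/-- A function `ℚ_p → ℚ_p` subanalytic on `X ⊆ ℚ_p`: its graph over `X` is a subanalytic
subset of `ℚ_p²`. -/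
def IsSubanalyticFnOn1 (X : Set ℚ_[p]) (f : ℚ_[p] → ℚ_[p]) : Prop :=
  IsSubanalytic p {z : Fin 2 → ℚ_[p] | z 0 ∈ X ∧ f (z 0) = z 1}

/-- A function `ℚ_p → ℚ_p` semialgebraic on `X ⊆ ℚ_p`: its graph over `X` is a
semialgebraic subset of `ℚ_p²`. -/
def IsSemialgebraicFnOn1 (X : Set ℚ_[p]) (f : ℚ_[p] → ℚ_[p]) : Prop :=
  IsSemialgebraic p {z : Fin 2 → ℚ_[p] | z 0 ∈ X ∧ f (z 0) = z 1}

/-- Interpretation of the symbols `□ᵢ` in the definition of cells: `true` means `<` and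
`false` means "no condition". -/
def sqRel (b : Bool) (x y : ℝ) : Prop := b = true → x < y

/-- A cell in `ℚ_p`, presented with its center `γ` and coset data `μ`, `n`. -/
def IsCell1 (A : Set ℚ_[p]) (γ μ : ℚ_[p]) (n : ℕ) : Prop :=
  0 < n ∧ A.Nonempty ∧
  ∃ (α β : ℚ_[p]) (b₁ b₂ : Bool), α ≠ 0 ∧ β ≠ 0 ∧
    A = {t | sqRel b₁ ‖α‖ ‖t - γ‖ ∧ sqRel b₂ ‖t - γ‖ ‖β‖ ∧ t - γ ∈ cosetP p μ n}

/-- Subanalytic cells in `ℚ_p^(m+1)`, defined inductively, presented with their center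
`γ : ℚ_p^m → ℚ_p` and coset data `μ`, `n`.  The projection of the cell onto the first `m`
coordinates is required to be a cell. -/
inductive IsCell : {m : ℕ} → Set (Fin (m + 1) → ℚ_[p]) →
    ((Fin m → ℚ_[p]) → ℚ_[p]) → ℚ_[p] → ℕ → Prop where
  | base (n : ℕ) (hn : 0 < n) (μ γ0 α β : ℚ_[p]) (hα : α ≠ 0) (hβ : β ≠ 0)
      (b₁ b₂ : Bool) (A : Set (Fin 1 → ℚ_[p])) (hne : A.Nonempty)
      (hA : A = {z | sqRel b₁ ‖α‖ ‖z 0 - γ0‖ ∧ sqRel b₂ ‖z 0 - γ0‖ ‖β‖ ∧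
        z 0 - γ0 ∈ cosetP p μ n}) :
      IsCell A (fun _ => γ0) μ n
  | succ {m : ℕ} {D : Set (Fin (m + 1) → ℚ_[p])} {γD : (Fin m → ℚ_[p]) → ℚ_[p]}
      {μD : ℚ_[p]} {nD : ℕ} (hD : IsCell D γD μD nD)
      (n : ℕ) (hn : 0 < n) (μ : ℚ_[p]) (α β γ : (Fin (m + 1) → ℚ_[p]) → ℚ_[p])
      (hα : IsSubanalyticFn p α) (hβ : IsSubanalyticFn p β) (hγ : IsSubanalyticFn p γ)
      (hα0 : ∀ x, α x ≠ 0) (hβ0 : ∀ x, β x ≠ 0)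
      (b₁ b₂ : Bool) (A : Set (Fin (m + 2) → ℚ_[p]))
      (hA : A = {z | (fun i : Fin (m + 1) => z i.castSucc) ∈ D ∧
          sqRel b₁ ‖α (fun i : Fin (m + 1) => z i.castSucc)‖
            ‖z (Fin.last (m + 1)) - γ (fun i : Fin (m + 1) => z i.castSucc)‖ ∧
          sqRel b₂ ‖z (Fin.last (m + 1)) - γ (fun i : Fin (m + 1) => z i.castSucc)‖
            ‖β (fun i : Fin (m + 1) => z i.castSucc)‖ ∧
          z (Fin.last (m + 1)) - γ (fun i : Fin (m + 1) => z i.castSucc) ∈ cosetP p μ n})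
      (hproj : (fun (z : Fin (m + 2) → ℚ_[p]) (i : Fin (m + 1)) => z i.castSucc) '' A = D) :
      IsCell A γ μ n

/-- Analytic cells in `ℚ_p^(m+1)`: as subanalytic cells, but at each stage of the inductive
definition the functions `α`, `β`, `γ` are moreover analytic on the projection of the cell. -/
inductive IsAnalyticCell : {m : ℕ} → Set (Fin (m + 1) → ℚ_[p]) →
    ((Fin m → ℚ_[p]) → ℚ_[p]) → ℚ_[p] → ℕ → Prop where
  | base (n : ℕ) (hn : 0 < n) (μ γ0 α β : ℚ_[p]) (hα : α ≠ 0) (hβ : β ≠ 0)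
      (b₁ b₂ : Bool) (A : Set (Fin 1 → ℚ_[p])) (hne : A.Nonempty)
      (hA : A = {z | sqRel b₁ ‖α‖ ‖z 0 - γ0‖ ∧ sqRel b₂ ‖z 0 - γ0‖ ‖β‖ ∧
        z 0 - γ0 ∈ cosetP p μ n}) :
      IsAnalyticCell A (fun _ => γ0) μ n
  | succ {m : ℕ} {D : Set (Fin (m + 1) → ℚ_[p])} {γD : (Fin m → ℚ_[p]) → ℚ_[p]}
      {μD : ℚ_[p]} {nD : ℕ} (hD : IsAnalyticCell D γD μD nD)
      (n : ℕ) (hn : 0 < n) (μ : ℚ_[p]) (α β γ : (Fin (m + 1) → ℚ_[p]) → ℚ_[p])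
      (hα : IsSubanalyticFn p α) (hβ : IsSubanalyticFn p β) (hγ : IsSubanalyticFn p γ)
      (hαan : AnalyticOn ℚ_[p] α D) (hβan : AnalyticOn ℚ_[p] β D)
      (hγan : AnalyticOn ℚ_[p] γ D)
      (hα0 : ∀ x, α x ≠ 0) (hβ0 : ∀ x, β x ≠ 0)
      (b₁ b₂ : Bool) (A : Set (Fin (m + 2) → ℚ_[p]))
      (hA : A = {z | (fun i : Fin (m + 1) => z i.castSucc) ∈ D ∧
          sqRel b₁ ‖α (fun i : Fin (m + 1) => z i.castSucc)‖
            ‖z (Fin.last (m + 1)) - γ (fun i : Fin (m + 1) => z i.castSucc)‖ ∧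
          sqRel b₂ ‖z (Fin.last (m + 1)) - γ (fun i : Fin (m + 1) => z i.castSucc)‖
            ‖β (fun i : Fin (m + 1) => z i.castSucc)‖ ∧
          z (Fin.last (m + 1)) - γ (fun i : Fin (m + 1) => z i.castSucc) ∈ cosetP p μ n})
      (hproj : (fun (z : Fin (m + 2) → ℚ_[p]) (i : Fin (m + 1)) => z i.castSucc) '' A = D) :
      IsAnalyticCell A γ μ n

/-- Generators of the algebra of subanalytic constructible functions on `ℚ_p^m`:
`ℤ`-valued valuations of nonvanishing subanalytic functions, and (`ℚ`-valued) norms of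
subanalytic functions. -/
def constructibleGens (m : ℕ) : Set ((Fin m → ℚ_[p]) → ℚ) :=
  {g | ∃ h : (Fin m → ℚ_[p]) → ℚ_[p], IsSubanalyticFn p h ∧ (∀ x, h x ≠ 0) ∧
        g = fun x => ((h x).valuation : ℚ)} ∪
  {g | ∃ h : (Fin m → ℚ_[p]) → ℚ_[p], IsSubanalyticFn p h ∧
        g = fun x => (padicNormE (h x) : ℚ)}

/-- The `ℚ`-algebra `C(ℚ_p^m)` of subanalytic constructible functions on `ℚ_p^m`. -/
noncomputable def ConstructibleAlg (m : ℕ) : Subalgebra ℚ ((Fin m → ℚ_[p]) → ℚ) :=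
  Algebra.adjoin ℚ (constructibleGens p m)

/-- `ℤ_p^m` as a subset of `ℚ_p^m`. -/
def ZpSet (m : ℕ) : Set (Fin m → ℚ_[p]) := {x | ∀ j, ‖x j‖ ≤ 1}

/-- A simple subset of `ℤ^n × ℚ_p^m`. -/
def IsSimpleSet (n m : ℕ) (A : Set ((Fin n → ℤ) × (Fin m → ℚ_[p]))) : Prop :=
  IsSubanalytic p {z : Fin (n + m) → ℚ_[p] |
    (∀ i : Fin n, z (Fin.castAdd m i) ≠ 0) ∧
    ((fun i : Fin n => (z (Fin.castAdd m i)).valuation),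
      fun j : Fin m => z (Fin.natAdd n j)) ∈ A}

/-- A simple function `ℤ^n × ℚ_p^m → ℤ`: one whose graph is a simple set. -/
def IsSimpleFn (n m : ℕ) (h : (Fin n → ℤ) × (Fin m → ℚ_[p]) → ℤ) : Prop :=
  IsSimpleSet p (n + 1) m
    {w | w.1 (Fin.last n) = h (fun i : Fin n => w.1 i.castSucc, w.2)}

/-- Generators of `C_simple(ℤ^n × ℚ_p^m)`: simple functions, and `p^h` for `h` simple. -/
def simpleGens (n m : ℕ) : Set ((Fin n → ℤ) × (Fin m → ℚ_[p]) → ℚ) :=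
  {g | ∃ h, IsSimpleFn p n m h ∧ g = fun w => (h w : ℚ)} ∪
  {g | ∃ h, IsSimpleFn p n m h ∧ g = fun w => (p : ℚ) ^ (h w)}

/-- The `ℚ`-algebra `C_simple(ℤ^n × ℚ_p^m)`. -/
noncomputable def SimpleAlg (n m : ℕ) : Subalgebra ℚ ((Fin n → ℤ) × (Fin m → ℚ_[p]) → ℚ) :=
  Algebra.adjoin ℚ (simpleGens p n m)

noncomputable instance : MeasurableSpace ℚ_[p] := borel _
instance : BorelSpace ℚ_[p] := ⟨rfl⟩

end PadicSub

open Filter Topology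
namespace CellProof
section series
set_option linter.unusedSectionVars false
variable {𝕜 : Type*} [NontriviallyNormedField 𝕜] [CompleteSpace 𝕜] [IsUltrametricDist 𝕜]

theorem tendsto_sum_cofinite (m : ℕ) :
    Tendsto (fun j : Fin m → ℕ => ∑ l, j l) cofinite atTop := by
  rw [← Nat.cofinite_eq_atTop]
  refine Filter.Tendsto.cofinite_of_finite_preimage_singleton ?_
  intro n
  refine (Finset.finite_toSet (Finset.piAntidiag Finset.univ n)).subset ?_
  intro j hj
  simpa using hj

theorem exists_list {m : ℕ} (j : Fin m → ℕ) : ∃ L : List (Fin m), L.length = ∑ l, j l ∧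
    ∀ x : Fin m → 𝕜, (L.map x).prod = ∏ l, x l ^ j l := by
  refine ⟨(List.finRange m).flatMap (fun l => List.replicate (j l) l), ?_, ?_⟩
  · simp [List.length_flatMap, Fin.sum_univ_def]
  · intro x
    rw [List.map_flatMap, List.flatMap_def, List.prod_flatten, Fin.prod_univ_def, List.map_map]
    simp [Function.comp_def]

theorem exists_mono {m : ℕ} (j : Fin m → ℕ) (n : ℕ) (hn : ∑ l, j l = n) :
    ∃ M : ContinuousMultilinearMap 𝕜 (fun _ : Fin n => (Fin m → 𝕜)) 𝕜,
      (∀ x, M (fun _ => x) = ∏ l, x l ^ j l) ∧ ∀ x, ‖M x‖ ≤ ∏ i, ‖x i‖ := by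
  obtain ⟨L, hL, hp⟩ := exists_list (𝕜 := 𝕜) j
  subst hn
  refine ⟨(ContinuousMultilinearMap.mkPiAlgebra 𝕜 (Fin (∑ l, j l)) 𝕜).compContinuousLinearMap
    (fun i => ContinuousLinearMap.proj (L.get (i.cast hL.symm))), ?_, ?_⟩
  · intro x
    rw [← hp]
    simp only [ContinuousMultilinearMap.compContinuousLinearMap_apply,
      ContinuousMultilinearMap.mkPiAlgebra_apply, ContinuousLinearMap.proj_apply]
    conv_rhs => rw [← List.ofFn_get L, List.map_ofFn, List.prod_ofFn]
    exact Fintype.prod_equiv (finCongr hL.symm) _ _ (fun i => rfl)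
  · intro x
    simp only [ContinuousMultilinearMap.compContinuousLinearMap_apply,
      ContinuousMultilinearMap.mkPiAlgebra_apply, ContinuousLinearMap.proj_apply]
    rw [norm_prod]
    exact Finset.prod_le_prod (fun _ _ => norm_nonneg _) (fun i _ => norm_le_pi_norm (x i) _)

theorem term_bound {m : ℕ} {b : (Fin m → ℕ) → 𝕜} {C R : ℝ}
    (hb : ∀ j, ‖b j‖ ≤ C * R ^ (∑ l, j l)) (h : Fin m → 𝕜) (j : Fin m → ℕ) :
    ‖b j * ∏ l, h l ^ j l‖ ≤ C * (R * ‖h‖) ^ (∑ l, j l) := by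
  rw [norm_mul, norm_prod, mul_pow, ← mul_assoc, ← Finset.prod_pow_eq_pow_sum Finset.univ j ‖h‖]
  refine mul_le_mul (hb j) ?_ (by positivity) ((norm_nonneg _).trans (hb j))
  refine Finset.prod_le_prod (fun _ _ => norm_nonneg _) (fun i _ => ?_)
  rw [norm_pow]
  exact pow_le_pow_left₀ (norm_nonneg _) (norm_le_pi_norm h i) _

theorem summable_series {m : ℕ} {b : (Fin m → ℕ) → 𝕜} {C R : ℝ} (hR : 0 < R)
    (hb : ∀ j, ‖b j‖ ≤ C * R ^ (∑ l, j l)) (h : Fin m → 𝕜) (hh : R * ‖h‖ < 1) :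
    Summable (fun j => b j * ∏ l, h l ^ j l) := by
  have : NonarchimedeanAddGroup 𝕜 := IsUltrametricDist.nonarchimedeanAddGroup
  apply NonarchimedeanAddGroup.summable_of_tendsto_cofinite_zero
  rw [tendsto_zero_iff_norm_tendsto_zero]
  refine squeeze_zero (fun _ => norm_nonneg _) (term_bound hb h) ?_
  rw [← mul_zero C]
  refine Tendsto.const_mul _ ?_
  exact (tendsto_pow_atTop_nhds_zero_of_lt_one (by positivity) hh).comp (tendsto_sum_cofinite m)

theorem fiber_tsum {m : ℕ} (g : (Fin m → ℕ) → 𝕜) (n : ℕ) :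
    ∑' j : ((fun j : Fin m → ℕ => ∑ l, j l) ⁻¹' {n}), g j =
      ∑ j ∈ Finset.piAntidiag Finset.univ n, g j := by
  have hset : ((fun j : Fin m → ℕ => ∑ l, j l) ⁻¹' {n}) =
      ((Finset.piAntidiag Finset.univ n : Finset (Fin m → ℕ)) : Set (Fin m → ℕ)) := by
    ext j; simp
  rw [hset, Finset.tsum_subtype' (Finset.piAntidiag Finset.univ n) g]

theorem analyticAt_series {m : ℕ} {b : (Fin m → ℕ) → 𝕜} {C R : ℝ} (hR : 0 < R)
    (hb : ∀ j, ‖b j‖ ≤ C * R ^ (∑ l, j l)) :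
    AnalyticAt 𝕜 (fun h : Fin m → 𝕜 => ∑' j, b j * ∏ l, h l ^ j l) 0 := by
  have hC : 0 ≤ C := by
    have := (norm_nonneg _).trans (hb 0)
    simpa using this
  choose M hM hM' using exists_mono (𝕜 := 𝕜) (m := m)
  let q : ∀ n, (Fin m → ℕ) → ContinuousMultilinearMap 𝕜 (fun _ : Fin n => (Fin m → 𝕜)) 𝕜 :=
    fun n j => if hn : ∑ l, j l = n then b j • M j n hn else 0
  let P : FormalMultilinearSeries 𝕜 (Fin m → 𝕜) 𝕜 :=
    fun n => ∑ j ∈ Finset.piAntidiag Finset.univ n, q n j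
  have hPn : ∀ n, ‖P n‖ ≤ C * R ^ n := by
    intro n
    refine ContinuousMultilinearMap.opNorm_le_bound (by positivity) (fun x => ?_)
    simp only [P, _root_.sum_apply]
    refine IsUltrametricDist.norm_sum_le_of_forall_le_of_nonneg (by positivity) (fun j hj => ?_)
    have hn : ∑ l, j l = n := by simpa using hj
    simp only [q, dif_pos hn, _root_.smul_apply, norm_smul]
    refine mul_le_mul ?_ (hM' j n hn x) (norm_nonneg _) (by positivity)
    rw [← hn]; exact hb j
  have hrad : (Real.toNNReal R⁻¹ : ENNReal) ≤ P.radius := by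
    refine P.le_radius_of_bound C (fun n => ?_)
    rw [Real.coe_toNNReal _ (by positivity)]
    calc ‖P n‖ * R⁻¹ ^ n ≤ C * R ^ n * R⁻¹ ^ n := by gcongr; exact hPn n
      _ = C := by rw [mul_assoc, ← mul_pow, mul_inv_cancel₀ hR.ne']; simp
  refine ⟨P, (Real.toNNReal R⁻¹ : ENNReal), hrad, by simpa using hR, ?_⟩
  intro y hy
  have hy' : R * ‖y‖ < 1 := by
    have : ‖y‖ < R⁻¹ := by
      have h2 : ‖y‖ < R⁻¹ ∨ ‖y‖ < 0 := by simpa using hy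
      exact h2.resolve_right (not_lt.2 (norm_nonneg _))
    calc R * ‖y‖ < R * R⁻¹ := by gcongr
      _ = 1 := mul_inv_cancel₀ hR.ne'
  have hs := (summable_series hR hb y hy').hasSum
  have h2 := hs.tsum_fiberwise (fun j : Fin m → ℕ => ∑ l, j l)
  rw [zero_add]
  convert h2 using 2 with n
  rw [fiber_tsum (fun j => b j * ∏ l, y l ^ j l)]
  simp only [P, _root_.sum_apply]
  refine Finset.sum_congr rfl (fun j hj => ?_)
  have hn : ∑ l, j l = n := by simpa using hj
  simp only [q, dif_pos hn, _root_.smul_apply, hM, smul_eq_mul]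

/-- The multi-index counting a word. -/
def cnt {m n : ℕ} (r : Fin n → Fin m) : Fin m → ℕ :=
  fun l => (Finset.univ.filter (fun i => r i = l)).card

theorem sum_cnt {m n : ℕ} (r : Fin n → Fin m) : ∑ l, cnt r l = n := by
  have := Finset.card_eq_sum_card_fiberwise (f := r) (s := Finset.univ) (t := Finset.univ)
    (fun _ _ => by simp)
  simpa [cnt] using this.symm

theorem prod_cnt {m n : ℕ} (r : Fin n → Fin m) (h : Fin m → 𝕜) :
    ∏ i, h (r i) = ∏ l, h l ^ cnt r l := by
  rw [← Finset.prod_fiberwise_of_maps_to (s := Finset.univ) (t := Finset.univ) (g := r)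
    (fun _ _ => by simp)]
  refine Finset.prod_congr rfl (fun l _ => ?_)
  rw [cnt, ← Finset.prod_const]
  refine Finset.prod_congr rfl (fun i hi => ?_)
  rw [(Finset.mem_filter.1 hi).2]

theorem series_of_analyticAt {m : ℕ} {A : (Fin m → 𝕜) → 𝕜} (hA : AnalyticAt 𝕜 A 0) :
    ∃ (c : (Fin m → ℕ) → 𝕜) (C R : ℝ), 0 < R ∧ (∀ j, ‖c j‖ ≤ C * R ^ (∑ l, j l)) ∧
      ∀ᶠ h in 𝓝 0, HasSum (fun j => c j * ∏ l, h l ^ j l) (A h) := by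
  obtain ⟨P, hP⟩ := hA
  obtain ⟨ρ, hρ⟩ := hP
  obtain ⟨r', hr0, hr'⟩ := ENNReal.lt_iff_exists_nnreal_btwn.1 hρ.r_pos
  have hr0' : (0 : ℝ) < r' := by exact_mod_cast hr0
  obtain ⟨C, hC0, hC⟩ := P.norm_mul_pow_le_of_lt_radius (hr'.trans_le hρ.r_le)
  let e : Fin m → (Fin m → 𝕜) := fun l => Pi.single l 1
  let c : (Fin m → ℕ) → 𝕜 := fun j =>
    ∑ r : Fin (∑ l, j l) → Fin m with cnt r = j, P (∑ l, j l) (fun i => e (r i))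
  have hPn : ∀ n, ‖P n‖ ≤ C * (r' : ℝ)⁻¹ ^ n := by
    intro n
    have := hC n
    rw [inv_pow, ← div_eq_mul_inv, le_div_iff₀ (by positivity)]
    exact this
  have hcb : ∀ j, ‖c j‖ ≤ C * (r' : ℝ)⁻¹ ^ (∑ l, j l) := by
    intro j
    refine IsUltrametricDist.norm_sum_le_of_forall_le_of_nonneg (by positivity) (fun r _ => ?_)
    refine ((P _).le_opNorm _).trans ?_
    have : ∏ i, ‖e (r i)‖ = 1 := Finset.prod_eq_one (fun i _ => by simp [e, Pi.norm_single])
    rw [this, mul_one]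
    exact hPn _
  refine ⟨c, C, (r' : ℝ)⁻¹, by positivity, hcb, ?_⟩
  have hball : Metric.ball (0 : Fin m → 𝕜) r' ∈ 𝓝 0 := Metric.ball_mem_nhds _ hr0'
  filter_upwards [hball, hρ.eventually_hasSum] with h hh hsum
  have hh' : (r' : ℝ)⁻¹ * ‖h‖ < 1 := by
    have : ‖h‖ < r' := by simpa using hh
    rw [inv_mul_lt_iff₀ hr0']; simpa using this
  have hs := (summable_series (by positivity) hcb h hh').hasSum
  have h2 := hs.tsum_fiberwise (fun j : Fin m → ℕ => ∑ l, j l)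
  simp only [fiber_tsum (fun j => c j * ∏ l, h l ^ j l)] at h2
  have h3 : ∀ n, ∑ j ∈ Finset.piAntidiag Finset.univ n, c j * ∏ l, h l ^ j l
      = P n (fun _ => h) := by
    intro n
    have hh3 : (fun _ : Fin n => h) = fun _ : Fin n => ∑ l, h l • e l := by
      funext _; funext l
      simp [e, Finset.sum_apply, Pi.single_apply]
    rw [hh3, ContinuousMultilinearMap.map_sum]
    simp only [ContinuousMultilinearMap.map_smul_univ, smul_eq_mul, prod_cnt]
    rw [← Finset.sum_fiberwise_of_maps_to (s := Finset.univ)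
      (t := Finset.piAntidiag Finset.univ n) (g := fun r : Fin n → Fin m => cnt r)
      (fun r _ => by simp [sum_cnt])]
    refine Finset.sum_congr rfl (fun j hj => ?_)
    have hn : ∑ l, j l = n := by simpa using hj
    subst hn
    rw [Finset.sum_mul]
    refine Finset.sum_congr rfl (fun r hr => ?_)
    rw [(Finset.mem_filter.1 hr).2, mul_comm]
  simp only [h3] at h2
  rw [zero_add] at hsum
  rwa [hsum.unique h2]

end series
end CellProof

open Filter Topology
namespace CellProof
section restricted
set_option linter.unusedSectionVars false
variable {𝕜 : Type*} [NontriviallyNormedField 𝕜] [CompleteSpace 𝕜] [IsUltrametricDist 𝕜]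

theorem norm_prod_le_one {m : ℕ} (g : Fin m → 𝕜) (hg : ∀ l, ‖g l‖ ≤ 1) : ‖∏ l, g l‖ ≤ 1 := by
  rw [norm_prod]
  exact Finset.prod_le_one (fun _ _ => norm_nonneg _) (fun i _ => hg i)

theorem analyticAt_restricted {m : ℕ} (a : (Fin m → ℕ) → 𝕜) (ha : Tendsto a cofinite (𝓝 0))
    (x0 : Fin m → 𝕜) (hx0 : ∀ l, ‖x0 l‖ ≤ 1) :
    AnalyticAt 𝕜 (fun x : Fin m → 𝕜 => ∑' i, a i * ∏ l, x l ^ i l) x0 := by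
  have : NonarchimedeanAddGroup 𝕜 := IsUltrametricDist.nonarchimedeanAddGroup
  -- boundedness
  obtain ⟨C, hC0, hC⟩ : ∃ C : ℝ, 0 ≤ C ∧ ∀ i, ‖a i‖ ≤ C := by
    have hev : ∀ᶠ i in cofinite, ‖a i‖ < 1 := by
      have := (tendsto_zero_iff_norm_tendsto_zero.1 ha).eventually (gt_mem_nhds one_pos)
      exact this
    have hfin : {i | ¬ ‖a i‖ < 1}.Finite := hev
    obtain ⟨C, hC⟩ := (hfin.image (fun i => ‖a i‖)).bddAbove
    refine ⟨max C 1, by positivity, fun i => ?_⟩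
    by_cases h : ‖a i‖ < 1
    · exact h.le.trans (le_max_right _ _)
    · exact (hC ⟨i, h, rfl⟩).trans (le_max_left _ _)
  let T : (Fin m → 𝕜) → (Fin m → ℕ) → (Fin m → ℕ) → 𝕜 := fun h i j =>
    a i * ∏ l, (((i l).choose (j l) : 𝕜) * x0 l ^ (i l - j l) * h l ^ j l)
  let b : (Fin m → ℕ) → 𝕜 := fun j =>
    ∑' i, a i * ∏ l, (((i l).choose (j l) : 𝕜) * x0 l ^ (i l - j l))
  have hb : ∀ j, ‖b j‖ ≤ C * 1 ^ (∑ l, j l) := by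
    intro j
    rw [one_pow, mul_one]
    refine IsUltrametricDist.norm_tsum_le_of_forall_le_of_nonneg hC0 (fun i => ?_)
    rw [norm_mul]
    refine (mul_le_of_le_one_right (norm_nonneg _) (norm_prod_le_one _ (fun l => ?_))).trans (hC i)
    rw [norm_mul, norm_pow]
    exact mul_le_one₀ (IsUltrametricDist.norm_natCast_le_one 𝕜 _) (by positivity)
      (pow_le_one₀ (norm_nonneg _) (hx0 l))
  have hG := analyticAt_series one_pos hb
  have hTn : ∀ h : Fin m → 𝕜, ‖h‖ < 1 → ∀ i j, ‖T h i j‖ ≤ ‖a i‖ := by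
    intro h hh i j
    simp only [T]
    rw [norm_mul]
    refine mul_le_of_le_one_right (norm_nonneg _) (norm_prod_le_one _ (fun l => ?_))
    rw [norm_mul, norm_mul, norm_pow, norm_pow]
    exact mul_le_one₀ (mul_le_one₀ (IsUltrametricDist.norm_natCast_le_one 𝕜 _) (by positivity)
      (pow_le_one₀ (norm_nonneg _) (hx0 l))) (by positivity)
      (pow_le_one₀ (norm_nonneg _) ((norm_le_pi_norm h l).trans hh.le))
  have hT0 : ∀ h i j, j ∉ Fintype.piFinset (fun l => Finset.range (i l + 1)) → T h i j = 0 := by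
    intro h i j hj
    simp only [Fintype.mem_piFinset, Finset.mem_range, not_forall, not_lt] at hj
    obtain ⟨l, hl⟩ := hj
    simp only [T]
    rw [Finset.prod_eq_zero (Finset.mem_univ l), mul_zero]
    rw [Nat.choose_eq_zero_of_lt (by omega)]; simp
  have hTs : ∀ h i, ∑' j, T h i j = a i * ∏ l, (x0 l + h l) ^ i l := by
    intro h i
    rw [tsum_eq_sum (s := Fintype.piFinset (fun l => Finset.range (i l + 1))) (hT0 h i)]
    simp only [T]
    rw [← Finset.mul_sum]
    congr 1
    simp only [add_comm (x0 _) (h _), add_pow]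
    rw [Finset.prod_univ_sum]
    refine Finset.sum_congr rfl (fun j _ => Finset.prod_congr rfl (fun l _ => by ring))
  have hTb : ∀ h j, ∑' i, T h i j = b j * ∏ l, h l ^ j l := by
    intro h j
    simp only [b]
    rw [← tsum_mul_right]
    refine tsum_congr (fun i => ?_)
    simp only [T]
    rw [Finset.prod_mul_distrib, mul_assoc]
  have hsum : ∀ h : Fin m → 𝕜, ‖h‖ < 1 → Summable (Function.uncurry (T h)) := by
    intro h hh
    apply NonarchimedeanAddGroup.summable_of_tendsto_cofinite_zero
    rw [Metric.tendsto_nhds]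
    intro ε hε
    have hfin : {i | ¬ dist (a i) 0 < ε}.Finite := Metric.tendsto_nhds.1 ha ε hε
    refine Set.Finite.subset (s := ⋃ i ∈ {i | ¬ dist (a i) 0 < ε},
      ((fun j => (i, j)) '' (Fintype.piFinset (fun l => Finset.range (i l + 1)) : Set (Fin m → ℕ))))
      ?_ ?_
    · exact hfin.biUnion (fun i _ => (Finset.finite_toSet _).image _)
    · rintro ⟨i, j⟩ hij
      have hij' : ¬ ‖T h i j‖ < ε := by simpa [Function.uncurry] using hij
      simp only [Set.mem_iUnion]
      refine ⟨i, ?_, j, ?_, rfl⟩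
      · simp only [Set.mem_setOf_eq, dist_zero_right]
        intro h2
        exact hij' ((hTn h hh i j).trans_lt h2)
      · by_contra h2
        apply hij'
        rw [hT0 h i j (by simpa using h2)]
        simpa using hε
  have hev : (fun x : Fin m → 𝕜 => ∑' i, a i * ∏ l, x l ^ i l) =ᶠ[𝓝 x0]
      (fun h : Fin m → 𝕜 => ∑' j, b j * ∏ l, h l ^ j l) ∘ (fun x => x - x0) := by
    filter_upwards [Metric.ball_mem_nhds x0 one_pos] with x hx
    have hx' : ‖x - x0‖ < 1 := by rwa [← dist_eq_norm]
    have hcomm := (hsum _ hx').tsum_comm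
    simp only [hTs, hTb] at hcomm
    simp only [Function.comp]
    rw [hcomm]
    refine tsum_congr (fun i => ?_)
    simp
  refine AnalyticAt.congr ?_ hev.symm
  refine AnalyticAt.comp ?_ (by fun_prop)
  simpa using hG

end restricted
end CellProof

open Filter Topology

namespace CellProof
section
variable {𝕜 : Type*} [NontriviallyNormedField 𝕜] [CompleteSpace 𝕜] [IsUltrametricDist 𝕜]
set_option linter.unusedSectionVars false

theorem div_snd {A : 𝕜 × 𝕜 → 𝕜} (hA : AnalyticAt 𝕜 A 0) :
    ∃ B : 𝕜 × 𝕜 → 𝕜, AnalyticAt 𝕜 B 0 ∧ ∀ᶠ w in 𝓝 (0 : 𝕜 × 𝕜), A w = A (w.1, 0) + w.2 * B w := by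
  let L : (Fin 2 → 𝕜) →L[𝕜] 𝕜 × 𝕜 :=
    (ContinuousLinearMap.proj 0).prod (ContinuousLinearMap.proj 1)
  have hA' : AnalyticAt 𝕜 (fun h : Fin 2 → 𝕜 => A (L h)) 0 := by
    apply AnalyticAt.fun_comp (g := A)
    · simpa using hA
    · exact L.analyticAt _
  obtain ⟨c, C, R, hR, hc, hs⟩ := series_of_analyticAt hA'
  obtain ⟨e, he0, he1⟩ : ∃ e : Fin 2 → ℕ, e 0 = 0 ∧ e 1 = 1 := ⟨![0, 1], rfl, rfl⟩
  have hb : ∀ j : Fin 2 → ℕ, ‖c (j + e)‖ ≤ (C * R) * R ^ (∑ l, j l) := by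
    intro j
    refine (hc _).trans (le_of_eq ?_)
    simp [Fin.sum_univ_two, he0, he1, pow_add]; ring
  have hB := analyticAt_series hR hb
  let M : 𝕜 × 𝕜 → (Fin 2 → 𝕜) := fun w => ![w.1, w.2]
  have hM : AnalyticAt 𝕜 M 0 := by
    refine AnalyticAt.pi ?_
    intro i
    fin_cases i
    · exact analyticAt_fst
    · exact analyticAt_snd
  have hM0 : M 0 = 0 := by ext i; fin_cases i <;> rfl
  refine ⟨fun w => ∑' j : Fin 2 → ℕ, c (j + e) * ∏ l, M w l ^ j l, ?_, ?_⟩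
  · refine AnalyticAt.fun_comp (g := fun h : Fin 2 → 𝕜 => ∑' j : Fin 2 → ℕ, c (j + e) * ∏ l, h l ^ j l) ?_ hM
    rw [hM0]; exact hB
  · have t1 : Tendsto M (𝓝 0) (𝓝 0) := by
      have := hM.continuousAt.tendsto
      rwa [hM0] at this
    have t2 : Tendsto (fun w : 𝕜 × 𝕜 => M (w.1, 0)) (𝓝 0) (𝓝 0) := by
      have : Tendsto (fun w : 𝕜 × 𝕜 => (w.1, (0:𝕜))) (𝓝 0) (𝓝 0) := by
        have : Continuous (fun w : 𝕜 × 𝕜 => (w.1, (0:𝕜))) := by fun_prop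
        exact this.tendsto' 0 0 rfl
      exact t1.comp this
    have hsm : ∀ᶠ w : 𝕜 × 𝕜 in 𝓝 0, R * ‖M w‖ < 1 := by
      have : ContinuousAt (fun w => R * ‖M w‖) 0 := by
        have := hM.continuousAt
        fun_prop
      have h0 : R * ‖M 0‖ < 1 := by rw [hM0]; simp
      exact this.eventually_lt_const h0
    filter_upwards [t1.eventually hs, t2.eventually hs, hsm] with w h1 h2 h3
    have h4 := h1.sub h2
    have key : HasSum (fun j : Fin 2 → ℕ => c (j + e) * ∏ l, M w l ^ (j + e) l)
        (A (L (M w)) - A (L (M (w.1, 0)))) := by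
      have hinj : Function.Injective (fun j : Fin 2 → ℕ => j + e) := add_left_injective e
      have := (hinj.hasSum_iff (f := fun j => c j * ∏ l, M w l ^ j l - c j * ∏ l, M (w.1, 0) l ^ j l)
        (a := (A (L (M w)) - A (L (M (w.1, 0))))) ?_).mpr h4
      · refine this.congr_fun ?_
        intro j
        simp [Fin.prod_univ_two, M, he0, he1]
      · intro j hj
        have : j 1 = 0 := by
          by_contra h
          apply hj
          refine ⟨j - e, ?_⟩
          ext i; fin_cases i
          · simp [he0]
          · simp [he1]; omega
        simp [Fin.prod_univ_two, M, this]
    have hB2 := (summable_series hR hb (M w) h3).hasSum.mul_left (w.2)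
    have : A (L (M w)) - A (L (M (w.1, 0))) = w.2 * ∑' j : Fin 2 → ℕ, c (j + e) * ∏ l, M w l ^ j l := by
      refine key.unique (hB2.congr_fun ?_)
      intro j
      simp [Fin.prod_univ_two, M, he0, he1, pow_succ]; ring
    have e1 : L (M w) = w := by simp [L, M]
    have e2 : L (M (w.1, 0)) = (w.1, 0) := by simp [L, M]
    rw [e1, e2] at this
    rw [← this]; ring

theorem analyticAt_swap {A : 𝕜 × 𝕜 → 𝕜} (hA : AnalyticAt 𝕜 A 0) :
    AnalyticAt 𝕜 (fun w : 𝕜 × 𝕜 => A (w.2, w.1)) 0 := by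
  apply AnalyticAt.fun_comp (g := A)
  · exact hA
  · exact AnalyticAt.prod analyticAt_snd analyticAt_fst

theorem tendsto_swap0 : Tendsto (fun w : 𝕜 × 𝕜 => (w.2, w.1)) (𝓝 0) (𝓝 0) := by
  have : Continuous (fun w : 𝕜 × 𝕜 => (w.2, w.1)) := by fun_prop
  exact this.tendsto' 0 0 rfl

theorem div_fst {A : 𝕜 × 𝕜 → 𝕜} (hA : AnalyticAt 𝕜 A 0) :
    ∃ B : 𝕜 × 𝕜 → 𝕜, AnalyticAt 𝕜 B 0 ∧ ∀ᶠ w in 𝓝 (0 : 𝕜 × 𝕜), A w = A (0, w.2) + w.1 * B w := by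
  obtain ⟨B, hB, h⟩ := div_snd (analyticAt_swap hA)
  exact ⟨_, analyticAt_swap hB, tendsto_swap0.eventually h⟩

theorem nonzero_factor {A : 𝕜 × 𝕜 → 𝕜} (hA : AnalyticAt 𝕜 A 0)
    (hne : ¬ ∀ᶠ w in 𝓝 (0 : 𝕜 × 𝕜), A w = 0) :
    ∃ (k : ℕ) (A' : 𝕜 × 𝕜 → 𝕜), AnalyticAt 𝕜 A' 0 ∧
      (∀ᶠ w in 𝓝 (0 : 𝕜 × 𝕜), A w = w.1 ^ k * A' w) ∧ ¬ ∀ᶠ v in 𝓝 (0 : 𝕜), A' (0, v) = 0 := by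
  by_contra! hcon
  have hall : ∀ k : ℕ, ∃ A' : 𝕜 × 𝕜 → 𝕜, AnalyticAt 𝕜 A' 0 ∧
      (∀ᶠ w in 𝓝 (0 : 𝕜 × 𝕜), A w = w.1 ^ k * A' w) := by
    intro k
    induction k with
    | zero => exact ⟨A, hA, by simp⟩
    | succ k ih =>
      obtain ⟨A', h1, h2⟩ := ih
      have h3 := hcon k A' h1 h2
      obtain ⟨B, hB, h4⟩ := div_fst h1
      refine ⟨B, hB, ?_⟩
      have h5 : ∀ᶠ w : 𝕜 × 𝕜 in 𝓝 0, A' (0, w.2) = 0 :=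
        (continuous_snd.tendsto (0 : 𝕜 × 𝕜)).eventually h3
      filter_upwards [h2, h4, h5] with w a b c
      rw [a, b, c]; ring
  obtain ⟨P, r, hP⟩ := hA
  have : ∃ w ∈ Metric.eball (0 : 𝕜 × 𝕜) r, A w ≠ 0 := by
    by_contra! h
    apply hne
    filter_upwards [Metric.eball_mem_nhds 0 hP.r_pos] with w hw using h w hw
  obtain ⟨w, hw, hAw⟩ := this
  let u : 𝕜 →L[𝕜] 𝕜 × 𝕜 := ContinuousLinearMap.toSpanSingleton 𝕜 w
  have hg : HasFPowerSeriesAt (A ∘ u) (P.compContinuousLinearMap u) 0 := by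
    apply HasFPowerSeriesAt.compContinuousLinearMap
    simpa using hP.hasFPowerSeriesAt
  have hgn : ¬ ∀ᶠ t in 𝓝 (0:𝕜), (A ∘ u) t = 0 := by
    intro h
    have h0 := (hg.congr h).eq_zero
    have h1 := hP.hasSum hw
    simp only [zero_add] at h1
    apply hAw
    refine h1.unique ?_
    have : ∀ n, P n (fun _ => w) = 0 := by
      intro n
      have := congrArg (fun Q => Q n (fun _ => (1:𝕜))) h0
      simpa [FormalMultilinearSeries.compContinuousLinearMap, u, Function.comp_def] using this
    simp [this, hasSum_zero]
  have hga : AnalyticAt 𝕜 (A ∘ u) 0 := ⟨_, hg⟩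
  obtain ⟨n, g, hg1, hg2, hg3⟩ := hga.exists_eventuallyEq_pow_smul_nonzero_iff.mpr hgn
  obtain ⟨A', h1, h2⟩ := hall (n + 1)
  have tu : Tendsto u (𝓝 0) (𝓝 0) := by simpa using u.continuous.tendsto 0
  have h3 := tu.eventually h2
  have h4 : ∀ᶠ t in 𝓝[≠] (0:𝕜), g t = t * (w.1 ^ (n+1) * A' (u t)) := by
    filter_upwards [h3.filter_mono nhdsWithin_le_nhds, hg3.filter_mono nhdsWithin_le_nhds,
      self_mem_nhdsWithin] with t a b c
    have c' : t ≠ 0 := c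
    simp only [Function.comp_apply, sub_zero, smul_eq_mul] at b
    rw [a] at b
    have : (u t).1 = t * w.1 := by simp [u]
    rw [this] at b
    have h5 : t ^ n ≠ 0 := pow_ne_zero _ c'
    apply mul_left_cancel₀ h5
    rw [← b]; ring
  have l1 : Tendsto g (𝓝[≠] 0) (𝓝 (g 0)) := hg1.continuousAt.tendsto.mono_left nhdsWithin_le_nhds
  have l2 : Tendsto (fun t => t * (w.1 ^ (n+1) * A' (u t))) (𝓝[≠] (0:𝕜)) (𝓝 (0 * (w.1 ^ (n+1) * A' (u 0)))) := by
    have : ContinuousAt (fun t => t * (w.1 ^ (n+1) * A' (u t))) 0 := by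
      have h6 : ContinuousAt (fun t => A' (u t)) 0 := by
        apply ContinuousAt.comp (g := A')
        · simpa using h1.continuousAt
        · exact u.continuous.continuousAt
      exact continuousAt_id.mul (continuousAt_const.mul h6)
    exact this.tendsto.mono_left nhdsWithin_le_nhds
  have := tendsto_nhds_unique (l1.congr' h4) l2
  simp at this
  exact hg2 this

end
end CellProof

open Filter Topology

namespace CellProof
section
variable {𝕜 : Type*} [NontriviallyNormedField 𝕜] [CompleteSpace 𝕜] [IsUltrametricDist 𝕜]
set_option linter.unusedSectionVars false

/-- order `d` in the second variable -/
def Ord (d : ℕ) (A : 𝕜 × 𝕜 → 𝕜) : Prop :=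
  ∃ g : 𝕜 → 𝕜, AnalyticAt 𝕜 g 0 ∧ g 0 ≠ 0 ∧ ∀ᶠ v in 𝓝 (0 : 𝕜), A (0, v) = v ^ d * g v

/-- expansion in powers of the second variable -/
def Expn (d : ℕ) (a : ℕ → 𝕜 → 𝕜) (B A : 𝕜 × 𝕜 → 𝕜) : Prop :=
  (∀ i, AnalyticAt 𝕜 (a i) 0) ∧ AnalyticAt 𝕜 B 0 ∧
    ∀ᶠ w in 𝓝 (0 : 𝕜 × 𝕜), A w = ∑ i ∈ Finset.range d, a i w.1 * w.2 ^ i + w.2 ^ d * B w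

theorem an_fst {a : 𝕜 → 𝕜} (ha : AnalyticAt 𝕜 a 0) :
    AnalyticAt 𝕜 (fun w : 𝕜 × 𝕜 => a w.1) 0 :=
  AnalyticAt.fun_comp (g := a) (f := fun w : 𝕜 × 𝕜 => w.1) ha analyticAt_fst

theorem an_0v {A : 𝕜 × 𝕜 → 𝕜} (hA : AnalyticAt 𝕜 A 0) :
    AnalyticAt 𝕜 (fun v : 𝕜 => A (0, v)) 0 :=
  AnalyticAt.fun_comp (g := A) (f := fun v : 𝕜 => ((0:𝕜), v)) hA
    (AnalyticAt.prod analyticAt_const analyticAt_id)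

theorem an_u0 {A : 𝕜 × 𝕜 → 𝕜} (hA : AnalyticAt 𝕜 A 0) :
    AnalyticAt 𝕜 (fun u : 𝕜 => A (u, 0)) 0 :=
  AnalyticAt.fun_comp (g := A) (f := fun v : 𝕜 => (v, (0:𝕜))) hA
    (AnalyticAt.prod analyticAt_id analyticAt_const)

theorem eq_of_punct {f g : 𝕜 → 𝕜} (hf : ContinuousAt f 0) (hg : ContinuousAt g 0)
    (h : ∀ᶠ v in 𝓝[≠] (0:𝕜), f v = g v) : ∀ᶠ v in 𝓝 (0:𝕜), f v = g v :=
  (ContinuousAt.eventuallyEq_nhds_iff_eventuallyEq_nhdsNE hf hg).mp h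

theorem eq_of_mul_pow {f g : 𝕜 → 𝕜} (hf : ContinuousAt f 0) (hg : ContinuousAt g 0) (n : ℕ)
    (h : ∀ᶠ v in 𝓝 (0:𝕜), v ^ n * f v = v ^ n * g v) : ∀ᶠ v in 𝓝 (0:𝕜), f v = g v := by
  apply eq_of_punct hf hg
  filter_upwards [h.filter_mono nhdsWithin_le_nhds, self_mem_nhdsWithin] with v h1 h2
  exact mul_left_cancel₀ (pow_ne_zero n h2) h1

theorem tendsto_0v : Tendsto (fun v : 𝕜 => ((0:𝕜), v)) (𝓝 0) (𝓝 0) :=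
  (by fun_prop : Continuous (fun v : 𝕜 => ((0:𝕜), v))).tendsto' 0 0 rfl

theorem tendsto_u0 : Tendsto (fun v : 𝕜 => (v, (0:𝕜))) (𝓝 0) (𝓝 0) :=
  (by fun_prop : Continuous (fun v : 𝕜 => (v, (0:𝕜)))).tendsto' 0 0 rfl

theorem reg_of_ord (d : ℕ) : ∀ {A : 𝕜 × 𝕜 → 𝕜}, AnalyticAt 𝕜 A 0 → Ord d A →
    ∃ a B, Expn d a B A ∧ (∀ i, a i 0 = 0) ∧ B 0 ≠ 0 := by
  induction d with
  | zero =>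
    intro A hA ⟨g, hg, hg0, h⟩
    refine ⟨fun _ _ => 0, A, ⟨fun _ => analyticAt_const, hA, by simp⟩, by simp, ?_⟩
    have := h.self_of_nhds
    simp at this
    change A (0, 0) ≠ 0
    rwa [this]
  | succ d ih =>
    intro A hA ⟨g, hg, hg0, h⟩
    obtain ⟨B1, hB1, hE⟩ := div_snd hA
    have hA0 : A (0, 0) = 0 := by
      have := h.self_of_nhds
      simpa using this
    have hO : Ord d B1 := by
      refine ⟨g, hg, hg0, ?_⟩
      apply eq_of_mul_pow (an_0v hB1).continuousAt
        ((by fun_prop : AnalyticAt 𝕜 (fun v : 𝕜 => v ^ d * g v) 0).continuousAt) 1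
      filter_upwards [h, tendsto_0v.eventually hE] with v h1 h2
      simp only [hA0, zero_add] at h2
      rw [pow_one, ← h2, h1]; ring
    obtain ⟨a, B, ⟨ha, hB, hex⟩, ha0, hB0⟩ := ih hB1 hO
    refine ⟨fun i => match i with | 0 => fun u => A (u, 0) | i+1 => a i, B, ⟨?_, hB, ?_⟩, ?_, hB0⟩
    · intro i
      cases i with
      | zero => exact an_u0 hA
      | succ i => exact ha i
    · filter_upwards [hE, hex] with w h1 h2
      rw [h1, h2, Finset.sum_range_succ', mul_add, Finset.mul_sum]
      have : ∀ i, w.2 * (a i w.1 * w.2 ^ i) = a i w.1 * w.2 ^ (i+1) := by intro i; ring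
      simp only [this]
      ring
    · intro i
      cases i with
      | zero => exact hA0
      | succ i => exact ha0 i

/-- derivative in the second variable -/
noncomputable def D (F : 𝕜 × 𝕜 → 𝕜) (w : 𝕜 × 𝕜) : 𝕜 := fderiv 𝕜 F w (0, 1)

theorem an_D {F : 𝕜 × 𝕜 → 𝕜} {w} (hF : AnalyticAt 𝕜 F w) : AnalyticAt 𝕜 (D F) w := by
  unfold D
  have h1 := hF.fderiv
  exact AnalyticAt.fun_comp (g := fun T : 𝕜 × 𝕜 →L[𝕜] 𝕜 => T (0, 1))
    (ContinuousLinearMap.analyticAt (ContinuousLinearMap.apply 𝕜 𝕜 ((0:𝕜), (1:𝕜))) _) h1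

theorem D_congr {F G : 𝕜 × 𝕜 → 𝕜} {w} (h : F =ᶠ[𝓝 w] G) : D F =ᶠ[𝓝 w] D G := by
  filter_upwards [h.fderiv (𝕜 := 𝕜)] with z hz
  simp [D, hz]

theorem D_expn {d : ℕ} {a : ℕ → 𝕜 → 𝕜} {B F : 𝕜 × 𝕜 → 𝕜} (h : Expn (d+1) a B F) :
    ∃ B', B' 0 = (d+1) * B 0 ∧ Expn d (fun i u => (i+1) * a (i+1) u) B' (D F) := by
  obtain ⟨ha, hB, hE⟩ := h
  refine ⟨fun w => (d+1) * B w + w.2 * D B w, by simp, fun i => analyticAt_const.mul (ha _), ?_, ?_⟩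
  · have := an_D hB
    exact (analyticAt_const.mul hB).add (analyticAt_snd.mul this)
  · have h2 := D_congr (w := 0) hE
    have ha' : ∀ᶠ w : 𝕜 × 𝕜 in 𝓝 0, ∀ i ∈ Finset.range (d+1), AnalyticAt 𝕜 (a i) w.1 := by
      rw [Filter.eventually_all_finset]
      intro i _
      exact (continuous_fst.tendsto (0:𝕜×𝕜)).eventually (ha i).eventually_analyticAt
    filter_upwards [h2, ha', hB.eventually_analyticAt] with w e1 e2 e3
    rw [e1]
    have key : ∀ i ∈ Finset.range (d+1), HasFDerivAt (fun w : 𝕜 × 𝕜 => a i w.1 * w.2 ^ i)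
        (a i w.1 • ((i * w.2 ^ (i-1)) • ContinuousLinearMap.snd 𝕜 𝕜 𝕜)
          + w.2 ^ i • (fderiv 𝕜 (a i) w.1).comp (ContinuousLinearMap.fst 𝕜 𝕜 𝕜)) w := by
      intro i hi
      have h3 : HasFDerivAt (fun w : 𝕜 × 𝕜 => a i w.1)
          ((fderiv 𝕜 (a i) w.1).comp (ContinuousLinearMap.fst 𝕜 𝕜 𝕜)) w :=
        HasFDerivAt.comp (g := a i) w (e2 i hi).differentiableAt.hasFDerivAt hasFDerivAt_fst
      have h4 : HasFDerivAt (fun w : 𝕜 × 𝕜 => w.2 ^ i)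
          ((i * w.2 ^ (i-1)) • ContinuousLinearMap.snd 𝕜 𝕜 𝕜) w := by
        have := (hasFDerivAt_snd (𝕜 := 𝕜) (p := w)).pow (n := i)
        convert! this using 1
        simp
      exact h3.mul h4
    have kB : HasFDerivAt (fun w : 𝕜 × 𝕜 => w.2 ^ (d+1) * B w)
        (w.2 ^ (d+1) • fderiv 𝕜 B w + B w • (((d+1 : ℕ) * w.2 ^ d) • ContinuousLinearMap.snd 𝕜 𝕜 𝕜)) w := by
      have h4 : HasFDerivAt (fun w : 𝕜 × 𝕜 => w.2 ^ (d+1))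
          (((d+1 : ℕ) * w.2 ^ d) • ContinuousLinearMap.snd 𝕜 𝕜 𝕜) w := by
        have := (hasFDerivAt_snd (𝕜 := 𝕜) (p := w)).pow (n := d+1)
        convert! this using 1
        simp
      exact h4.mul e3.differentiableAt.hasFDerivAt
    have hs := (HasFDerivAt.fun_sum key).add kB
    have hs' : fderiv 𝕜 (fun w => ∑ i ∈ Finset.range (d+1), a i w.1 * w.2 ^ i + w.2 ^ (d+1) * B w) w = _ :=
      HasFDerivAt.fderiv hs
    simp only [D]
    rw [hs', Finset.sum_range_succ']
    simp
    rw [add_mul, Finset.sum_congr rfl (fun i _ => by ring : ∀ i ∈ Finset.range d, a (i+1) w.1 * ((i+1) * w.2 ^ i) = (i+1) * a (i+1) w.1 * w.2^i)]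
    ring

theorem D_iter_expn (n : ℕ) : ∀ {a : ℕ → 𝕜 → 𝕜} {B F : 𝕜 × 𝕜 → 𝕜}, Expn (n+1) a B F →
    ∃ B', AnalyticAt 𝕜 B' 0 ∧ B' 0 = (n+1).factorial * B 0 ∧
      ∀ᶠ w in 𝓝 (0:𝕜×𝕜), (D^[n] F) w = n.factorial * a n w.1 + w.2 * B' w := by
  induction n with
  | zero =>
    intro a B F h
    exact ⟨B, h.2.1, by simp, by simpa using h.2.2⟩
  | succ n ih =>
    intro a B F h
    obtain ⟨B', h0, h1⟩ := D_expn h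
    obtain ⟨B'', h2, h3, h4⟩ := ih h1
    refine ⟨B'', h2, ?_, ?_⟩
    · rw [h3, h0, Nat.factorial_succ (n+1)]; push_cast; ring
    · filter_upwards [h4] with w hw
      rw [Function.iterate_succ_apply, hw, Nat.factorial_succ n]; push_cast; ring

theorem D_iter_an {F : 𝕜 × 𝕜 → 𝕜} {w} (hF : AnalyticAt 𝕜 F w) (n : ℕ) : AnalyticAt 𝕜 (D^[n] F) w := by
  induction n with
  | zero => exact hF
  | succ n ih => rw [Function.iterate_succ_apply']; exact an_D ih

/-- the shear -/
def shear (β : 𝕜 → 𝕜) (w : 𝕜 × 𝕜) : 𝕜 × 𝕜 := (w.1, w.2 + β w.1)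

theorem an_shear {β : 𝕜 → 𝕜} {w : 𝕜 × 𝕜} (hβ : AnalyticAt 𝕜 β w.1) : AnalyticAt 𝕜 (shear β) w := by
  unfold shear
  refine AnalyticAt.prod analyticAt_fst (analyticAt_snd.add ?_)
  exact AnalyticAt.fun_comp (g := β) hβ analyticAt_fst

theorem D_shear {F : 𝕜 × 𝕜 → 𝕜} {β : 𝕜 → 𝕜} {w : 𝕜 × 𝕜} (hβ : AnalyticAt 𝕜 β w.1)
    (hF : AnalyticAt 𝕜 F (shear β w)) : D (F ∘ shear β) w = D F (shear β w) := by
  unfold D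
  rw [fderiv_comp _ hF.differentiableAt (an_shear hβ).differentiableAt]
  have h3 : HasFDerivAt (fun w : 𝕜 × 𝕜 => β w.1)
      ((fderiv 𝕜 β w.1).comp (ContinuousLinearMap.fst 𝕜 𝕜 𝕜)) w :=
    HasFDerivAt.comp (g := β) w hβ.differentiableAt.hasFDerivAt hasFDerivAt_fst
  have : HasFDerivAt (shear β) _ w := HasFDerivAt.prodMk (hasFDerivAt_fst) ((hasFDerivAt_snd).add h3)
  rw [this.fderiv]
  simp

theorem D_iter_shear {F : 𝕜 × 𝕜 → 𝕜} {β : 𝕜 → 𝕜} (hF : AnalyticAt 𝕜 F 0)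
    (hβ : AnalyticAt 𝕜 β 0) (hβ0 : β 0 = 0) (n : ℕ) :
    D^[n] (F ∘ shear β) =ᶠ[𝓝 0] (D^[n] F) ∘ shear β := by
  have ts : Tendsto (shear β) (𝓝 0) (𝓝 0) := by
    have := (an_shear (w := 0) hβ).continuousAt.tendsto
    have h0 : shear β 0 = 0 := by simp [shear, hβ0]
    rwa [h0] at this
  induction n with
  | zero => rfl
  | succ n ih =>
    simp only [Function.iterate_succ_apply']
    refine (D_congr ih).trans ?_
    filter_upwards [ts.eventually (D_iter_an hF n).eventually_analyticAt,
      (continuous_fst.tendsto (0:𝕜×𝕜)).eventually hβ.eventually_analyticAt] with w h1 h2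
    exact D_shear h2 h1

theorem ift {E : 𝕜 × 𝕜 → 𝕜} (hE : AnalyticAt 𝕜 E 0) (h0 : E 0 = 0) (hD : D E 0 ≠ 0) :
    ∃ β : 𝕜 → 𝕜, AnalyticAt 𝕜 β 0 ∧ β 0 = 0 ∧ ∀ᶠ u in 𝓝 (0:𝕜), E (u, β u) = 0 := by
  let Ψ : 𝕜 × 𝕜 → 𝕜 × 𝕜 := fun w => (w.1, E w)
  have hΨ : AnalyticAt 𝕜 Ψ 0 := AnalyticAt.prod analyticAt_fst hE
  have hΨ0 : Ψ 0 = 0 := by simp [Ψ, h0]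
  let E' := fderiv 𝕜 E 0
  let f' : 𝕜 × 𝕜 →L[𝕜] 𝕜 × 𝕜 := (ContinuousLinearMap.fst 𝕜 𝕜 𝕜).prod E'
  let g' : 𝕜 × 𝕜 →L[𝕜] 𝕜 × 𝕜 := (ContinuousLinearMap.fst 𝕜 𝕜 𝕜).prod
    ((E' (0,1))⁻¹ • (ContinuousLinearMap.snd 𝕜 𝕜 𝕜 - E' (1,0) • ContinuousLinearMap.fst 𝕜 𝕜 𝕜))
  have hE' : ∀ w : 𝕜 × 𝕜, E' w = w.1 * E' (1,0) + w.2 * E' (0,1) := by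
    intro w
    have : w = w.1 • ((1:𝕜),(0:𝕜)) + w.2 • ((0:𝕜),(1:𝕜)) := by ext <;> simp
    conv_lhs => rw [this, map_add, map_smul, map_smul]
    simp
  have hD' : E' (0,1) ≠ 0 := hD
  let e : (𝕜 × 𝕜) ≃L[𝕜] 𝕜 × 𝕜 := ContinuousLinearEquiv.equivOfInverse f' g'
    (by
      intro w
      simp only [f', g', ContinuousLinearMap.prod_apply]
      ext
      · simp
      · simp [hE' w]; field_simp; ring)
    (by
      intro w
      simp only [f', g', ContinuousLinearMap.prod_apply]
      ext
      · simp
      · change E' _ = w.2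
        rw [hE']
        simp; field_simp; ring)
  have hs : HasStrictFDerivAt Ψ (e : 𝕜 × 𝕜 →L[𝕜] 𝕜 × 𝕜) 0 :=
    HasStrictFDerivAt.prodMk (hasStrictFDerivAt_fst) hE.hasStrictFDerivAt
  let H := hs.toOpenPartialHomeomorph Ψ
  have hHs : (0:𝕜×𝕜) ∈ H.source := hs.mem_toOpenPartialHomeomorph_source
  have hH : AnalyticAt 𝕜 H.symm (H 0) :=
    H.analyticAt_symm' hHs hΨ hs.hasFDerivAt.fderiv
  have hH00 : H 0 = 0 := hΨ0
  rw [hH00] at hH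
  have hHsymm0 : H.symm 0 = 0 := by
    have := H.left_inv hHs
    rwa [hH00] at this
  refine ⟨fun u => (H.symm (u, 0)).2, ?_, ?_, ?_⟩
  · have : AnalyticAt 𝕜 (fun u : 𝕜 => H.symm (u, 0)) 0 :=
      AnalyticAt.fun_comp (g := H.symm) (f := fun u : 𝕜 => (u, (0:𝕜))) hH
        (AnalyticAt.prod analyticAt_id analyticAt_const)
    exact AnalyticAt.fun_comp (g := Prod.snd) analyticAt_snd this
  · change (H.symm 0).2 = 0
    rw [hHsymm0]; rfl
  · have ht : ∀ᶠ z in 𝓝 (0:𝕜×𝕜), z ∈ H.target := by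
      apply H.open_target.mem_nhds
      rw [← hH00]; exact H.map_source hHs
    filter_upwards [tendsto_u0.eventually ht] with u hu
    have h1 : Ψ (H.symm (u, 0)) = (u, 0) := H.right_inv hu
    have h2 := congrArg Prod.fst h1
    have h3 := congrArg Prod.snd h1
    simp only [Ψ] at h2 h3
    have h4 : (u, (H.symm (u, 0)).2) = H.symm (u, 0) := by
      ext
      · simp [h2]
      · rfl
    rw [h4, h3]

theorem tschirnhaus [CharZero 𝕜] {d : ℕ} {A : 𝕜 × 𝕜 → 𝕜} (hA : AnalyticAt 𝕜 A 0) (hO : Ord (d+1) A) :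
    ∃ β : 𝕜 → 𝕜, AnalyticAt 𝕜 β 0 ∧ β 0 = 0 ∧ ∃ a B, Expn (d+1) a B (A ∘ shear β) ∧
      (∀ i, a i 0 = 0) ∧ B 0 ≠ 0 ∧ ∀ᶠ u in 𝓝 (0:𝕜), a d u = 0 := by
  obtain ⟨a, B, hex, ha0, hB0⟩ := reg_of_ord _ hA hO
  obtain ⟨B', hB', hB'0, hF⟩ := D_iter_expn d hex
  have hFan := D_iter_an hA d
  obtain ⟨β, hβ, hβ0, hz⟩ := ift hFan (by
      rw [hF.self_of_nhds]; simp [ha0]) (by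
      have : Expn 1 (fun _ u => d.factorial * a d u) B' (D^[d] A) :=
        ⟨fun _ => analyticAt_const.mul (hex.1 d), hB', by simpa using hF⟩
      obtain ⟨B2, h1, h2⟩ := D_expn this
      rw [h2.2.2.self_of_nhds]
      simp [h1, hB'0, hB0, Nat.factorial_ne_zero])
  have hs0 : shear β 0 = 0 := by simp [shear, hβ0]
  have hA' : AnalyticAt 𝕜 (A ∘ shear β) 0 := by
    apply AnalyticAt.comp
    · rwa [hs0]
    · exact an_shear hβ
  have hO' : Ord (d+1) (A ∘ shear β) := by
    obtain ⟨g, h1, h2, h3⟩ := hO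
    exact ⟨g, h1, h2, by simpa [shear, hβ0] using h3⟩
  obtain ⟨a', B1, hex', ha0', hB0'⟩ := reg_of_ord _ hA' hO'
  refine ⟨β, hβ, hβ0, a', B1, hex', ha0', hB0', ?_⟩
  obtain ⟨B2, hB2, -, hF2⟩ := D_iter_expn d hex'
  filter_upwards [tendsto_u0.eventually hF2, tendsto_u0.eventually (D_iter_shear hA hβ hβ0 d), hz] with u h1 h2 h3
  rw [h2] at h1
  simp only [shear, Function.comp_apply, zero_add, h3, zero_mul, add_zero] at h1
  have : (d.factorial : 𝕜) ≠ 0 := by exact_mod_cast Nat.factorial_ne_zero d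
  simpa [this] using h1.symm

end
end CellProof

open Filter Topology

namespace CellProof
section
variable {𝕜 : Type*} [NontriviallyNormedField 𝕜] [CompleteSpace 𝕜] [IsUltrametricDist 𝕜]
set_option linter.unusedSectionVars false

theorem eq_of_fst_mul {f g : 𝕜 × 𝕜 → 𝕜} (hf : AnalyticAt 𝕜 f 0) (hg : AnalyticAt 𝕜 g 0)
    (h : ∀ᶠ w in 𝓝 (0:𝕜×𝕜), w.1 * f w = w.1 * g w) : ∀ᶠ w in 𝓝 (0:𝕜×𝕜), f w = g w := by
  filter_upwards [h.eventually_nhds, hf.eventually_analyticAt, hg.eventually_analyticAt] with w h1 h2 h3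
  by_cases hw : w.1 = 0
  · obtain ⟨u, v⟩ := w
    simp only at hw
    subst hw
    have hc : Continuous (fun u : 𝕜 => (u, v)) := by fun_prop
    have ht : Tendsto (fun u : 𝕜 => (u, v)) (𝓝 0) (𝓝 (0, v)) := hc.tendsto 0
    have := eq_of_mul_pow (f := fun u => f (u, v)) (g := fun u => g (u, v))
      (ContinuousAt.comp (g := f) (f := fun u : 𝕜 => (u, v)) h2.continuousAt hc.continuousAt)
      (ContinuousAt.comp (g := g) (f := fun u : 𝕜 => (u, v)) h3.continuousAt hc.continuousAt) 1
      (by simpa using ht.eventually h1)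
    exact this.self_of_nhds
  · exact mul_left_cancel₀ hw h1.self_of_nhds

theorem eq_of_snd_mul {f g : 𝕜 × 𝕜 → 𝕜} (hf : AnalyticAt 𝕜 f 0) (hg : AnalyticAt 𝕜 g 0)
    (h : ∀ᶠ w in 𝓝 (0:𝕜×𝕜), w.2 * f w = w.2 * g w) : ∀ᶠ w in 𝓝 (0:𝕜×𝕜), f w = g w := by
  have := eq_of_fst_mul (analyticAt_swap hf) (analyticAt_swap hg) (tendsto_swap0.eventually h)
  exact tendsto_swap0.eventually this

theorem zero_or_zero {f g : 𝕜 → 𝕜} (hf : AnalyticAt 𝕜 f 0) (hg : AnalyticAt 𝕜 g 0)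
    (h : ∀ᶠ v in 𝓝 (0:𝕜), f v * g v = 0) : (∀ᶠ v in 𝓝 (0:𝕜), f v = 0) ∨ ∀ᶠ v in 𝓝 (0:𝕜), g v = 0 := by
  rcases hf.eventually_eq_zero_or_eventually_ne_zero with h1 | h1
  · exact Or.inl h1
  · right
    apply eq_of_punct hg.continuousAt continuousAt_const
    filter_upwards [h1, h.filter_mono nhdsWithin_le_nhds] with v a b
    simpa [a] using b

/-- monomial times unit -/
def MU (A : 𝕜 × 𝕜 → 𝕜) : Prop := ∃ (i j : ℕ) (U : 𝕜 × 𝕜 → 𝕜), AnalyticAt 𝕜 U 0 ∧ U 0 ≠ 0 ∧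
  ∀ᶠ w in 𝓝 (0:𝕜×𝕜), A w = w.1 ^ i * w.2 ^ j * U w

theorem MU_swap {A : 𝕜 × 𝕜 → 𝕜} (h : MU A) : MU (fun w => A (w.2, w.1)) := by
  obtain ⟨i, j, U, h1, h2, h3⟩ := h
  refine ⟨j, i, _, analyticAt_swap h1, h2, ?_⟩
  filter_upwards [tendsto_swap0.eventually h3] with w hw
  rw [hw]; ring

theorem MU_mul_left {A B : 𝕜 × 𝕜 → 𝕜} (h : ∀ᶠ w in 𝓝 (0:𝕜×𝕜), A w = w.1 * B w) (hB : MU B) : MU A := by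
  obtain ⟨i, j, U, h1, h2, h3⟩ := hB
  refine ⟨i+1, j, U, h1, h2, ?_⟩
  filter_upwards [h, h3] with w a b
  rw [a, b]; ring

theorem factor (n : ℕ) : ∀ {A B U : 𝕜 × 𝕜 → 𝕜} (i j : ℕ), i + j = n → AnalyticAt 𝕜 A 0 → AnalyticAt 𝕜 B 0 →
    AnalyticAt 𝕜 U 0 → U 0 ≠ 0 → (∀ᶠ w in 𝓝 (0:𝕜×𝕜), A w * B w = w.1 ^ i * w.2 ^ j * U w) → MU A := by
  induction n with
  | zero =>
    intro A B U i j hij hA hB hU hU0 h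
    have hi : i = 0 := by omega
    have hj : j = 0 := by omega
    subst hi hj
    refine ⟨0, 0, A, hA, ?_, by simp⟩
    have := h.self_of_nhds
    simp only [pow_zero, one_mul] at this
    intro h0
    rw [h0, zero_mul] at this
    exact hU0 this.symm
  | succ n ih =>
    have main : ∀ {A B U : 𝕜 × 𝕜 → 𝕜} (i j : ℕ), i + 1 + j = n + 1 → AnalyticAt 𝕜 A 0 → AnalyticAt 𝕜 B 0 →
      AnalyticAt 𝕜 U 0 → U 0 ≠ 0 → (∀ᶠ w in 𝓝 (0:𝕜×𝕜), A w * B w = w.1 ^ (i+1) * w.2 ^ j * U w) → MU A := by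
      intro A B U i j hij hA hB hU hU0 h
      have h0 : ∀ᶠ v in 𝓝 (0:𝕜), A (0, v) * B (0, v) = 0 := by
        filter_upwards [tendsto_0v.eventually h] with v hv
        rw [hv]; simp
      have hR : AnalyticAt 𝕜 (fun w : 𝕜 × 𝕜 => w.1 ^ i * w.2 ^ j * U w) 0 :=
        ((analyticAt_fst.pow i).mul (analyticAt_snd.pow j)).mul hU
      rcases zero_or_zero (an_0v hA) (an_0v hB) h0 with h1 | h1
      · obtain ⟨A1, hA1, e⟩ := div_fst hA
        have e' : ∀ᶠ w in 𝓝 (0:𝕜×𝕜), A w = w.1 * A1 w := by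
          filter_upwards [e, (continuous_snd.tendsto (0 : 𝕜 × 𝕜)).eventually h1] with w a b
          rw [a, b, zero_add]
        refine MU_mul_left e' (ih (B := B) (U := U) i j (by omega) hA1 hB hU hU0 ?_)
        apply eq_of_fst_mul (hA1.mul hB) hR
        filter_upwards [e', h] with w a b
        simp only [Pi.mul_apply]
        rw [← mul_assoc, ← a, b]; ring
      · obtain ⟨B1, hB1, e⟩ := div_fst hB
        refine ih (A := A) (B := B1) (U := U) i j (by omega) hA hB1 hU hU0 ?_
        apply eq_of_fst_mul (hA.mul hB1) hR
        filter_upwards [e, (continuous_snd.tendsto (0 : 𝕜 × 𝕜)).eventually h1, h] with w a b c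
        rw [a, b] at c
        simp only [Pi.mul_apply]
        linear_combination c
    intro A B U i j hij hA hB hU hU0 h
    cases i with
    | succ i => exact main i j hij hA hB hU hU0 h
    | zero =>
      cases j with
      | zero => omega
      | succ j =>
        refine MU_swap (A := fun w => A (w.2, w.1)) (main (B := fun w => B (w.2, w.1)) (U := fun w => U (w.2, w.1)) j 0 (by omega) (analyticAt_swap hA) (analyticAt_swap hB)
          (analyticAt_swap hU) hU0 ?_)
        filter_upwards [tendsto_swap0.eventually h] with w hw
        rw [hw]; ring

/-! ### charts -/

variable {Z : Type*} [TopologicalSpace Z]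

/-- eventually along the ultrafilter, near the point -/
def nl (𝒰 : Ultrafilter Z) : Filter Z := (𝒰 : Filter Z).bind 𝓝

theorem ev_nl {𝒰 : Ultrafilter Z} {P : Z → Prop} :
    (∀ᶠ z in nl 𝒰, P z) ↔ ∀ᶠ z in (𝒰 : Filter Z), ∀ᶠ z' in 𝓝 z, P z' := Filter.eventually_bind

theorem ev_of_nl {𝒰 : Ultrafilter Z} {P : Z → Prop} (h : ∀ᶠ z in nl 𝒰, P z) : ∀ᶠ z in (𝒰 : Filter Z), P z :=
  (ev_nl.mp h).mono fun _ hz => hz.self_of_nhds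

theorem nl_idem {𝒰 : Ultrafilter Z} {P : Z → Prop} (h : ∀ᶠ z in nl 𝒰, P z) :
    ∀ᶠ z in nl 𝒰, ∀ᶠ z' in 𝓝 z, P z' :=
  ev_nl.mpr ((ev_nl.mp h).mono fun _ hz => hz.eventually_nhds)

theorem tendsto_nl {𝒰 : Ultrafilter Z} {X : Type*} [TopologicalSpace X] {q : Z → X} {a : X}
    (hc : ∀ᶠ z in nl 𝒰, ContinuousAt q z) (ht : Tendsto q 𝒰 (𝓝 a)) : Tendsto q (nl 𝒰) (𝓝 a) := by
  intro s hs
  change ∀ᶠ z in nl 𝒰, q z ∈ s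
  rw [ev_nl]
  filter_upwards [ev_of_nl hc, ht.eventually (eventually_eventually_nhds.mpr hs)] with z h1 h2
  exact h1.eventually h2

theorem ne_nl {𝒰 : Ultrafilter Z} {q : Z → 𝕜}
    (hc : ∀ᶠ z in nl 𝒰, ContinuousAt q z) (ht : ∀ᶠ z in (𝒰 : Filter Z), q z ≠ 0) : ∀ᶠ z in nl 𝒰, q z ≠ 0 := by
  rw [ev_nl]
  filter_upwards [ev_of_nl hc, ht] with z h1 h2
  exact h1.eventually_ne h2

/-- charts -/
def IsChart (𝒰 : Ultrafilter Z) (q₀ q : Z → 𝕜 × 𝕜) : Prop :=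
  (∀ᶠ z in nl 𝒰, ContinuousAt q z) ∧ Tendsto q 𝒰 (𝓝 0) ∧
    ∃ Φ : 𝕜 × 𝕜 → 𝕜 × 𝕜, AnalyticAt 𝕜 Φ 0 ∧ Φ 0 = 0 ∧ ∀ᶠ z in (𝒰 : Filter Z), q₀ z = Φ (q z)

/-- the ultrafilter is not contained in an analytic arc -/
def NotArc (𝒰 : Ultrafilter Z) (q₀ : Z → 𝕜 × 𝕜) : Prop :=
  ∀ (c : 𝕜 → 𝕜 × 𝕜) (τ : Z → 𝕜), AnalyticAt 𝕜 c 0 → c 0 = 0 → Tendsto τ 𝒰 (𝓝 0) →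
    ¬ ∀ᶠ z in (𝒰 : Filter Z), q₀ z = c (τ z)

/-- analytic germ of maps -/
def IsRef (Φ : 𝕜 × 𝕜 → 𝕜 × 𝕜) : Prop := AnalyticAt 𝕜 Φ 0 ∧ Φ 0 = 0

theorem IsRef.tendsto {Φ : 𝕜 × 𝕜 → 𝕜 × 𝕜} (h : IsRef Φ) : Tendsto Φ (𝓝 0) (𝓝 0) := by
  have := h.1.continuousAt.tendsto
  rwa [h.2] at this

theorem IsRef.comp {Φ Ψ : 𝕜 × 𝕜 → 𝕜 × 𝕜} (h : IsRef Φ) (h' : IsRef Ψ) : IsRef (Φ ∘ Ψ) := by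
  refine ⟨AnalyticAt.comp ?_ h'.1, by simp [h.2, h'.2]⟩
  rw [h'.2]; exact h.1

theorem IsRef.an_comp {Φ : 𝕜 × 𝕜 → 𝕜 × 𝕜} (h : IsRef Φ) {A : 𝕜 × 𝕜 → 𝕜} (hA : AnalyticAt 𝕜 A 0) :
    AnalyticAt 𝕜 (fun w => A (Φ w)) 0 := by
  refine AnalyticAt.fun_comp ?_ h.1
  rw [h.2]; exact hA

section charts
variable {𝒰 : Ultrafilter Z} {q₀ : Z → 𝕜 × 𝕜} {q q' : Z → 𝕜 × 𝕜}

theorem IsChart.tendsto (h : IsChart 𝒰 q₀ q) : Tendsto q (nl 𝒰) (𝓝 0) := tendsto_nl h.1 h.2.1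

theorem IsChart.cfst (h : IsChart 𝒰 q₀ q) : ∀ᶠ z in nl 𝒰, ContinuousAt (fun z => (q z).1) z :=
  h.1.mono fun _ hz => hz.fst
theorem IsChart.csnd (h : IsChart 𝒰 q₀ q) : ∀ᶠ z in nl 𝒰, ContinuousAt (fun z => (q z).2) z :=
  h.1.mono fun _ hz => hz.snd

theorem IsChart.tfst (h : IsChart 𝒰 q₀ q) : Tendsto (fun z => (q z).1) 𝒰 (𝓝 0) :=
  (continuous_fst.tendsto (0:𝕜×𝕜)).comp h.2.1
theorem IsChart.tsnd (h : IsChart 𝒰 q₀ q) : Tendsto (fun z => (q z).2) 𝒰 (𝓝 0) :=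
  (continuous_snd.tendsto (0:𝕜×𝕜)).comp h.2.1

theorem IsChart.ne_fst (hN : NotArc 𝒰 q₀) (h : IsChart 𝒰 q₀ q) : ∀ᶠ z in nl 𝒰, (q z).1 ≠ 0 := by
  refine ne_nl h.cfst ?_
  by_contra hcon
  rw [Ultrafilter.eventually_not, not_not] at hcon
  obtain ⟨hc, ht, Φ, h1, h2, h3⟩ := h
  refine hN (fun τ => Φ (0, τ)) (fun z => (q z).2) ?_ h2 ((continuous_snd.tendsto (0:𝕜×𝕜)).comp ht) ?_
  · exact AnalyticAt.fun_comp (g := Φ) (f := fun v : 𝕜 => ((0:𝕜), v)) h1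
      (AnalyticAt.prod analyticAt_const analyticAt_id)
  · filter_upwards [h3, hcon] with z a b
    rw [a, ← b]

theorem IsChart.ref (h : IsChart 𝒰 q₀ q) {Φ : 𝕜 × 𝕜 → 𝕜 × 𝕜} (hΦ : IsRef Φ)
    (e : ∀ᶠ z in nl 𝒰, q z = Φ (q' z)) (hc : ∀ᶠ z in nl 𝒰, ContinuousAt q' z)
    (ht : Tendsto q' 𝒰 (𝓝 0)) : IsChart 𝒰 q₀ q' := by
  obtain ⟨-, -, Ψ, h1, h2, h3⟩ := h
  refine ⟨hc, ht, Ψ ∘ Φ, (IsRef.comp ⟨h1, h2⟩ hΦ).1, (IsRef.comp ⟨h1, h2⟩ hΦ).2, ?_⟩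
  filter_upwards [h3, ev_of_nl e] with z a b
  rw [a, b]; rfl

theorem isRef_swap : IsRef (fun w : 𝕜 × 𝕜 => (w.2, w.1)) :=
  ⟨AnalyticAt.prod analyticAt_snd analyticAt_fst, rfl⟩

theorem IsChart.swap (h : IsChart 𝒰 q₀ q) : IsChart 𝒰 q₀ (fun z => ((q z).2, (q z).1)) := by
  refine h.ref isRef_swap (by simp) ?_ ?_
  · filter_upwards [h.1] with z hz using hz.snd.prodMk hz.fst
  · exact tendsto_swap0.comp h.2.1

theorem IsChart.ne_snd (hN : NotArc 𝒰 q₀) (h : IsChart 𝒰 q₀ q) : ∀ᶠ z in nl 𝒰, (q z).2 ≠ 0 :=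
  h.swap.ne_fst hN

theorem isRef_shear {β : 𝕜 → 𝕜} (hβ : AnalyticAt 𝕜 β 0) (hβ0 : β 0 = 0) : IsRef (shear β) :=
  ⟨an_shear hβ, by simp [shear, hβ0]⟩

theorem IsChart.shear (h : IsChart 𝒰 q₀ q) {β : 𝕜 → 𝕜} (hβ : AnalyticAt 𝕜 β 0) (hβ0 : β 0 = 0) :
    ∃ q', IsChart 𝒰 q₀ q' ∧ ∀ᶠ z in nl 𝒰, q z = shear β (q' z) := by
  have e : ∀ᶠ z in nl 𝒰, q z = CellProof.shear β (CellProof.shear (fun u => - β u) (q z)) := by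
    simp [CellProof.shear]
  refine ⟨fun z => CellProof.shear (fun u => - β u) (q z), h.ref (isRef_shear hβ hβ0) e ?_ ?_, e⟩
  · have := (isRef_shear hβ.neg (by simpa using hβ0)).1
    filter_upwards [h.1, h.tendsto.eventually this.eventually_analyticAt] with z a b
    exact ContinuousAt.comp b.continuousAt a
  · exact (isRef_shear hβ.neg (by simpa using hβ0)).tendsto.comp h.2.1

/-- blow-up charts -/
def bu (c : 𝕜) (w : 𝕜 × 𝕜) : 𝕜 × 𝕜 := (w.1, w.1 * (w.2 + c))
/-- blow-up charts -/
def bv (w : 𝕜 × 𝕜) : 𝕜 × 𝕜 := (w.1 * w.2, w.2)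

theorem isRef_bu (c : 𝕜) : IsRef (bu c) :=
  ⟨AnalyticAt.prod analyticAt_fst (analyticAt_fst.mul (analyticAt_snd.add analyticAt_const)), by simp [bu]⟩
theorem isRef_bv : IsRef (bv (𝕜 := 𝕜)) :=
  ⟨AnalyticAt.prod (analyticAt_fst.mul analyticAt_snd) analyticAt_snd, by simp [bv]⟩

theorem ultra_lim [ProperSpace 𝕜] (𝒰 : Ultrafilter Z) (f : Z → 𝕜) (h : ∀ᶠ z in (𝒰 : Filter Z), ‖f z‖ ≤ 1) :
    ∃ c, Tendsto f 𝒰 (𝓝 c) := by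
  obtain ⟨c, -, hc⟩ := (isCompact_closedBall (0:𝕜) 1).ultrafilter_le_nhds (𝒰.map f) (by
    rw [le_principal_iff]
    change ∀ᶠ z in (𝒰 : Filter Z), f z ∈ Metric.closedBall (0:𝕜) 1
    simpa using h)
  exact ⟨c, hc⟩

theorem IsChart.blow [ProperSpace 𝕜] (hN : NotArc 𝒰 q₀) (h : IsChart 𝒰 q₀ q) :
    (∃ c q', IsChart 𝒰 q₀ q' ∧ ∀ᶠ z in nl 𝒰, q z = bu c (q' z)) ∨
    (∃ q', IsChart 𝒰 q₀ q' ∧ ∀ᶠ z in nl 𝒰, q z = bv (q' z)) := by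
  have n1 := h.ne_fst hN
  have n2 := h.ne_snd hN
  have c1 : ∀ c, Tendsto (fun z => (q z).2 / (q z).1) 𝒰 (𝓝 c) →
      (∃ c q', IsChart 𝒰 q₀ q' ∧ ∀ᶠ z in nl 𝒰, q z = bu c (q' z)) := by
    intro c hc
    have e : ∀ᶠ z in nl 𝒰, q z = bu c ((q z).1, (q z).2 / (q z).1 - c) := by
      filter_upwards [n1] with z hz
      ext
      · rfl
      · simp [bu]; field_simp
    refine ⟨c, fun z => ((q z).1, (q z).2 / (q z).1 - c), h.ref (isRef_bu c) e ?_ ?_, e⟩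
    · filter_upwards [h.1, n1] with z a b
      exact a.fst.prodMk ((a.snd.div a.fst b).sub continuousAt_const)
    · have := h.tfst.prodMk_nhds (hc.sub_const c)
      rw [sub_self] at this
      exact this
  by_cases hb : ∀ᶠ z in (𝒰 : Filter Z), ‖(q z).2 / (q z).1‖ ≤ 1
  · obtain ⟨c, hc⟩ := ultra_lim 𝒰 _ hb
    exact Or.inl (c1 c hc)
  · rw [← Ultrafilter.eventually_not] at hb
    have hb2 : ∀ᶠ z in (𝒰 : Filter Z), ‖(q z).1 / (q z).2‖ ≤ 1 := by
      filter_upwards [hb] with z hz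
      rw [not_le] at hz
      rw [← inv_div, norm_inv]
      exact inv_le_one_of_one_le₀ hz.le
    obtain ⟨b, hb⟩ := ultra_lim 𝒰 _ hb2
    by_cases hb0 : b = 0
    · right
      subst hb0
      have e : ∀ᶠ z in nl 𝒰, q z = bv ((q z).1 / (q z).2, (q z).2) := by
        filter_upwards [n2] with z hz
        ext
        · simp [bv]; field_simp
        · rfl
      refine ⟨fun z => ((q z).1 / (q z).2, (q z).2), h.ref isRef_bv e ?_ ?_, e⟩
      · filter_upwards [h.1, n2] with z a b
        exact (a.fst.div a.snd b).prodMk a.snd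
      · exact hb.prodMk_nhds h.tsnd
    · left
      apply c1 b⁻¹
      refine (hb.inv₀ hb0).congr ?_
      intro z
      rw [inv_div]

/-- A can be resolved -/
def Res (𝒰 : Ultrafilter Z) (q₀ q : Z → 𝕜 × 𝕜) (A : 𝕜 × 𝕜 → 𝕜) : Prop :=
  ∃ q' Φ, IsChart 𝒰 q₀ q' ∧ IsRef Φ ∧ (∀ᶠ z in nl 𝒰, q z = Φ (q' z)) ∧ MU (fun w => A (Φ w))

theorem Res.pull {Φ : 𝕜 × 𝕜 → 𝕜 × 𝕜} {A : 𝕜 × 𝕜 → 𝕜} (hΦ : IsRef Φ)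
    (e : ∀ᶠ z in nl 𝒰, q z = Φ (q' z)) (h : Res 𝒰 q₀ q' (fun w => A (Φ w))) : Res 𝒰 q₀ q A := by
  obtain ⟨q'', Ψ, h1, h2, h3, h4⟩ := h
  refine ⟨q'', Φ ∘ Ψ, h1, hΦ.comp h2, ?_, h4⟩
  filter_upwards [e, h3] with z a b
  rw [a, b]; rfl

theorem MU.congr {A B : 𝕜 × 𝕜 → 𝕜} (e : ∀ᶠ w in 𝓝 (0:𝕜×𝕜), A w = B w) (h : MU B) : MU A := by
  obtain ⟨i, j, U, h1, h2, h3⟩ := h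
  refine ⟨i, j, U, h1, h2, ?_⟩
  filter_upwards [e, h3] with w a b
  rw [a, b]

theorem Res.congr {A B : 𝕜 × 𝕜 → 𝕜} (e : ∀ᶠ w in 𝓝 (0:𝕜×𝕜), A w = B w)
    (h : Res 𝒰 q₀ q B) : Res 𝒰 q₀ q A := by
  obtain ⟨q'', Ψ, h1, h2, h3, h4⟩ := h
  exact ⟨q'', Ψ, h1, h2, h3, h4.congr (h2.tendsto.eventually e)⟩

theorem Res.of_MU {A : 𝕜 × 𝕜 → 𝕜} (h : IsChart 𝒰 q₀ q) (hA : MU A) : Res 𝒰 q₀ q A :=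
  ⟨q, id, h, ⟨analyticAt_id, rfl⟩, by simp, hA⟩

end charts
end
end CellProof

open Filter Topology

namespace CellProof
section
variable {𝕜 : Type*} [NontriviallyNormedField 𝕜] [CompleteSpace 𝕜] [IsUltrametricDist 𝕜]
set_option linter.unusedSectionVars false

theorem ord_poly {A : 𝕜 × 𝕜 → 𝕜} (Q : Polynomial 𝕜) (hQ : Q ≠ 0) (c : 𝕜)
    (h : ∀ᶠ v in 𝓝 (0:𝕜), A (0, v) = Q.eval (v + c)) : Ord (Q.rootMultiplicity c) A := by
  obtain ⟨R, h1, h2⟩ := Polynomial.exists_eq_pow_rootMultiplicity_mul_and_not_dvd Q hQ c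
  refine ⟨fun v => R.eval (v + c), ?_, ?_, ?_⟩
  · have h3 : AnalyticAt 𝕜 (fun v : 𝕜 => v + c) 0 := analyticAt_id.add analyticAt_const
    have := h3.aeval_polynomial R
    simpa using this
  · simp only [zero_add]
    rwa [Polynomial.dvd_iff_isRoot] at h2
  · filter_upwards [h] with v hv
    rw [hv]
    conv_lhs => rw [h1]
    simp

theorem ord_unit {d : ℕ} {A G : 𝕜 × 𝕜 → 𝕜} (hA : Ord d A) (hG : AnalyticAt 𝕜 G 0) (hG0 : G 0 ≠ 0) :
    Ord d (fun w => G w * A w) := by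
  obtain ⟨g, h1, h2, h3⟩ := hA
  refine ⟨fun v => G (0, v) * g v, (an_0v hG).mul h1, mul_ne_zero hG0 h2, ?_⟩
  filter_upwards [h3] with v hv
  rw [hv]; ring

theorem div_one {b : 𝕜 → 𝕜} (hb : AnalyticAt 𝕜 b 0) (hb0 : b 0 = 0) :
    ∃ b', AnalyticAt 𝕜 b' 0 ∧ ∀ᶠ u in 𝓝 (0:𝕜), b u = u * b' u := by
  obtain ⟨B, hB, h⟩ := div_snd (A := fun w : 𝕜 × 𝕜 => b w.2)
    (AnalyticAt.fun_comp (g := b) hb analyticAt_snd)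
  refine ⟨_, an_0v hB, ?_⟩
  filter_upwards [tendsto_0v.eventually h] with u hu
  simpa [hb0] using hu

theorem findE {a : ℕ → 𝕜 → 𝕜} (ha : ∀ i, AnalyticAt 𝕜 (a i) 0) (d : ℕ) :
    ∃ e ≤ d, ∃ b : ℕ → 𝕜 → 𝕜, (∀ i, AnalyticAt 𝕜 (b i) 0) ∧
      (∀ i < d, ∀ᶠ u in 𝓝 (0:𝕜), u ^ i * a i u = u ^ e * b i u) ∧ (e < d → ∃ i < d, b i 0 ≠ 0) := by
  classical
  let H : ℕ → Prop := fun e => ∃ b : ℕ → 𝕜 → 𝕜, (∀ i, AnalyticAt 𝕜 (b i) 0) ∧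
      (∀ i < d, ∀ᶠ u in 𝓝 (0:𝕜), u ^ i * a i u = u ^ e * b i u)
  have h0 : H 0 := ⟨fun i u => u ^ i * a i u, fun i => (analyticAt_id.pow i).mul (ha i), by simp⟩
  have hsp := Nat.findGreatest_spec (P := H) (Nat.zero_le d) h0
  have hle := Nat.findGreatest_le (P := H) d
  obtain ⟨b, hb, hb2⟩ := hsp
  refine ⟨Nat.findGreatest H d, hle, b, hb, hb2, ?_⟩
  intro hlt
  by_contra! hcon
  have : H (Nat.findGreatest H d + 1) := by
    have : ∀ i, ∃ b', AnalyticAt 𝕜 b' 0 ∧ (i < d → ∀ᶠ u in 𝓝 (0:𝕜), b i u = u * b' u) := by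
      intro i
      by_cases hi : i < d
      · obtain ⟨b', h1, h2⟩ := div_one (hb i) (hcon i hi)
        exact ⟨b', h1, fun _ => h2⟩
      · exact ⟨0, analyticAt_const, fun h => absurd h hi⟩
    choose b' h1 h2 using this
    refine ⟨b', h1, fun i hi => ?_⟩
    filter_upwards [hb2 i hi, h2 i hi] with u x y
    rw [x, y]; ring
  exact Nat.findGreatest_is_greatest (Nat.lt_succ_self _) hlt this

theorem an_pow_mul {a : 𝕜 → 𝕜} (ha : AnalyticAt 𝕜 a 0) (n : ℕ) :
    AnalyticAt 𝕜 (fun u : 𝕜 => u ^ n * a u) 0 := (analyticAt_id.pow n).mul ha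

theorem ord_pow_mul {a : 𝕜 → 𝕜} (ha : AnalyticAt 𝕜 a 0) (n : ℕ) :
    analyticOrderAt (fun u : 𝕜 => u ^ n * a u) 0 = n + analyticOrderAt a 0 := by
  have h1 : AnalyticAt 𝕜 (fun u : 𝕜 => u ^ n) 0 := analyticAt_id.pow n
  have h2 : analyticOrderAt (fun u : 𝕜 => u ^ n) 0 = n := by
    rw [h1.analyticOrderAt_eq_natCast]
    exact ⟨fun _ => 1, analyticAt_const, one_ne_zero, by simp⟩
  have h3 := analyticOrderAt_mul h1 ha
  rw [h2] at h3
  exact h3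

theorem rootMult_le (Q : Polynomial 𝕜) (c : 𝕜) : Q.rootMultiplicity c ≤ Q.natDegree := by
  classical
  rw [← Polynomial.count_roots]
  exact (Multiset.count_le_card _ _).trans (Polynomial.card_roots' Q)

theorem an_uv {a : 𝕜 → 𝕜} (ha : AnalyticAt 𝕜 a 0) :
    AnalyticAt 𝕜 (fun w : 𝕜 × 𝕜 => a (w.1 * w.2)) 0 := by
  refine AnalyticAt.fun_comp (g := a) (f := fun w : 𝕜 × 𝕜 => w.1 * w.2) ?_ (analyticAt_fst.mul analyticAt_snd)
  simpa using ha

theorem tendsto_uv : Tendsto (fun w : 𝕜 × 𝕜 => w.1 * w.2) (𝓝 0) (𝓝 0) :=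
  (by fun_prop : Continuous (fun w : 𝕜 × 𝕜 => w.1 * w.2)).tendsto' 0 0 (by simp)

variable {Z : Type*} [TopologicalSpace Z]

/-- main inductive statement -/
def PP (𝒰 : Ultrafilter Z) (q₀ : Z → 𝕜 × 𝕜) (d : ℕ) : Prop :=
  ∀ q, IsChart 𝒰 q₀ q → ∀ (k l : ℕ) (A : 𝕜 × 𝕜 → 𝕜), AnalyticAt 𝕜 A 0 → Ord d A →
    Res 𝒰 q₀ q (fun w => w.1 ^ k * w.2 ^ l * A w)

/-- main inductive statement, weaker form -/
def H0 (𝒰 : Ultrafilter Z) (q₀ : Z → 𝕜 × 𝕜) (d : ℕ) : Prop :=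
  ∀ q, IsChart 𝒰 q₀ q → ∀ (k : ℕ) (A : 𝕜 × 𝕜 → 𝕜), AnalyticAt 𝕜 A 0 → Ord d A →
    Res 𝒰 q₀ q (fun w => w.1 ^ k * A w)

theorem PP.h0 {𝒰 : Ultrafilter Z} {q₀ : Z → 𝕜 × 𝕜} {d : ℕ} (h : PP 𝒰 q₀ d) : H0 𝒰 q₀ d := by
  intro q hq k A hA hO
  simpa using h q hq k 0 A hA hO

theorem finish_c {𝒰 : Ultrafilter Z} {q₀ q : Z → 𝕜 × 𝕜} {d : ℕ} (h : H0 𝒰 q₀ d) (hq : IsChart 𝒰 q₀ q)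
    {c : 𝕜} (hc : c ≠ 0) (k l : ℕ) {A : 𝕜 × 𝕜 → 𝕜} (hA : AnalyticAt 𝕜 A 0) (hO : Ord d A) :
    Res 𝒰 q₀ q (fun w => w.1 ^ k * (w.2 + c) ^ l * A w) := by
  have hG : AnalyticAt 𝕜 (fun w : 𝕜 × 𝕜 => (w.2 + c) ^ l) 0 := (analyticAt_snd.add analyticAt_const).pow l
  have := h q hq k (fun w => (w.2 + c) ^ l * A w) (hG.mul hA) (ord_unit hO hG (by simp [hc]))
  refine this.congr ?_
  filter_upwards with w
  ring

theorem prep [CharZero 𝕜] [ProperSpace 𝕜] {𝒰 : Ultrafilter Z} {q₀ : Z → 𝕜 × 𝕜} (hN : NotArc 𝒰 q₀)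
    {d : ℕ} (hd : 0 < d) (IH : ∀ r < d, PP 𝒰 q₀ r) (m : ℕ) : ∀ q, IsChart 𝒰 q₀ q →
    ∀ (k l : ℕ) (a : ℕ → 𝕜 → 𝕜) (B A : 𝕜 × 𝕜 → 𝕜), Expn d a B A → (∀ i < d, a i 0 = 0) → B 0 ≠ 0 →
    (∃ i < d, analyticOrderAt (a i) 0 = m) → (((∀ᶠ u in 𝓝 (0:𝕜), a (d-1) u = 0) ∧ l = 0) ∨ H0 𝒰 q₀ d) →
    Res 𝒰 q₀ q (fun w => w.1 ^ k * w.2 ^ l * A w) := by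
  induction m using Nat.strong_induction_on with
  | _ m ihm =>
  intro q hq k l a B A hex ha0 hB0 hord hprep
  obtain ⟨ha, hB, hE⟩ := hex
  obtain ⟨e, hed, b, hb, hab, hbe⟩ := findE ha d
  have hbge : ∀ i < d, e ≤ i → b i 0 = 0 := by
    intro i hi hei
    have : ∀ᶠ u in 𝓝 (0:𝕜), b i u = u ^ (i - e) * a i u := by
      apply eq_of_mul_pow (hb i).continuousAt (an_pow_mul (ha i) (i - e)).continuousAt e
      filter_upwards [hab i hi] with u hu
      have : u ^ i = u ^ e * u ^ (i - e) := by rw [← pow_add]; congr 1; omega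
      rw [← hu, this]; ring
    rw [this.self_of_nhds, ha0 i hi, mul_zero]
  rcases hq.blow hN with ⟨c, q', hq', hqq'⟩ | ⟨q', hq', hqq'⟩
  · let A₁ : 𝕜 × 𝕜 → 𝕜 := fun w => ∑ i ∈ Finset.range d, b i w.1 * (w.2 + c) ^ i
      + w.1 ^ (d - e) * (w.2 + c) ^ d * B (bu c w)
    have hA₁ : AnalyticAt 𝕜 A₁ 0 := by
      refine AnalyticAt.add (Finset.analyticAt_fun_sum _ fun i _ => ?_) ?_
      · exact (an_fst (hb i)).mul ((analyticAt_snd.add analyticAt_const).pow i)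
      · exact ((analyticAt_fst.pow _).mul ((analyticAt_snd.add analyticAt_const).pow d)).mul
          ((isRef_bu c).an_comp hB)
    have hAA : ∀ᶠ w in 𝓝 (0:𝕜×𝕜), A (bu c w) = w.1 ^ e * A₁ w := by
      have hall : ∀ᶠ w : 𝕜 × 𝕜 in 𝓝 0, ∀ i ∈ Finset.range d, w.1 ^ i * a i w.1 = w.1 ^ e * b i w.1 := by
        rw [Filter.eventually_all_finset]
        intro i hi
        exact (continuous_fst.tendsto (0:𝕜×𝕜)).eventually (hab i (Finset.mem_range.mp hi))
      filter_upwards [(isRef_bu c).tendsto.eventually hE, hall] with w h1 h2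
      rw [h1]
      simp only [A₁, mul_add, Finset.mul_sum]
      congr 1
      · refine Finset.sum_congr rfl fun i hi => ?_
        have := h2 i hi
        simp only [bu]
        rw [mul_pow]
        linear_combination (w.2 + c) ^ i * this
      · have : w.1 ^ d = w.1 ^ e * w.1 ^ (d - e) := by rw [← pow_add]; congr 1; omega
        simp only [bu]
        rw [mul_pow, this]; ring
    suffices hS : Res 𝒰 q₀ q' (fun w => w.1 ^ (k + l + e) * (w.2 + c) ^ l * A₁ w) by
      refine Res.pull (isRef_bu c) hqq' (hS.congr ?_)
      filter_upwards [hAA] with w hw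
      rw [hw]; simp only [bu]; rw [mul_pow]; ring
    let co : ℕ → 𝕜 := fun i => if i < d then b i 0 else if i = d then 0 ^ (d - e) * B 0 else 0
    let Q : Polynomial 𝕜 := ∑ i ∈ Finset.range (d+1), Polynomial.C (co i) * Polynomial.X ^ i
    have hQc : ∀ i ≤ d, Q.coeff i = co i := by
      intro i hi
      simp only [Q, Polynomial.finsetSum_coeff, Polynomial.coeff_C_mul_X_pow]
      rw [Finset.sum_eq_single i]
      · simp
      · intro j _ hj; simp [hj.symm]
      · intro h; exact absurd (Finset.mem_range.mpr (by omega)) h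
    have hQd : Q.natDegree ≤ d := by
      refine Polynomial.natDegree_sum_le_of_forall_le _ _ fun i hi => ?_
      refine (Polynomial.natDegree_C_mul_X_pow_le _ _).trans ?_
      have := Finset.mem_range.mp hi
      omega
    have hcod : co d = 0 ^ (d - e) * B 0 := by simp [co]
    have hcoi : ∀ i < d, co i = b i 0 := by intro i hi; simp [co, hi]
    have hQ0 : Q ≠ 0 := by
      intro h
      by_cases hlt : e < d
      · obtain ⟨i, hi, hbi⟩ := hbe hlt
        apply hbi
        rw [← hcoi i hi, ← hQc i hi.le, h, Polynomial.coeff_zero]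
      · have : e = d := by omega
        apply hB0
        have h1 := hQc d le_rfl
        rw [h, hcod, this] at h1
        simpa using h1.symm
    have hO : Ord (Q.rootMultiplicity c) A₁ := by
      apply ord_poly Q hQ0 c
      filter_upwards with v
      simp only [A₁, Q, Polynomial.eval_finsetSum, Polynomial.eval_mul, Polynomial.eval_C,
        Polynomial.eval_pow, Polynomial.eval_X]
      rw [Finset.sum_range_succ, hcod]
      congr 1
      · refine Finset.sum_congr rfl fun i hi => ?_
        rw [hcoi i (Finset.mem_range.mp hi)]
      · have : bu c (0, v) = 0 := by simp [bu]
        rw [this]; ring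
    have hrle : Q.rootMultiplicity c ≤ Q.natDegree := rootMult_le Q c
    rcases lt_or_ge (Q.rootMultiplicity c) d with hr | hr
    · by_cases hc : c = 0
      · subst hc
        simpa using IH _ hr q' hq' (k + l + e) l A₁ hA₁ hO
      · exact finish_c (IH _ hr).h0 hq' hc _ _ hA₁ hO
    · have hrd : Q.rootMultiplicity c = d := by omega
      rw [hrd] at hO
      have hed' : e = d := by
        by_contra hne
        have h1 : Q.coeff d = 0 := by
          rw [hQc d le_rfl, hcod, zero_pow (by omega), zero_mul]
        have h2 : Q.natDegree ≠ d := by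
          intro h
          apply hQ0
          rw [← Polynomial.leadingCoeff_eq_zero, Polynomial.leadingCoeff, h, h1]
        omega
      subst hed'
      obtain ⟨R, hR⟩ : (Polynomial.X - Polynomial.C c) ^ e ∣ Q := by
        rw [← Polynomial.le_rootMultiplicity_iff hQ0, hrd]
      have hR0 : R.natDegree = 0 := by
        have hm : ((Polynomial.X - Polynomial.C c) ^ e).Monic := (Polynomial.monic_X_sub_C c).pow e
        have hRne : R ≠ 0 := by rintro rfl; simp at hR; exact hQ0 hR
        have := hm.natDegree_mul' hRne
        rw [← hR, Polynomial.natDegree_pow, Polynomial.natDegree_X_sub_C] at this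
        omega
      obtain ⟨ρ, rfl⟩ := Polynomial.natDegree_eq_zero.mp hR0
      have hρ : ρ ≠ 0 := by rintro rfl; simp at hR; exact hQ0 hR
      by_cases hc : c = 0
      · subst hc
        have hbi0 : ∀ i < e, b i 0 = 0 := by
          intro i hi
          rw [← hcoi i hi, ← hQc i hi.le, hR]
          simp [Polynomial.coeff_X_pow, hi.ne]
        obtain ⟨i0, hi0, hm⟩ := hord
        have hordb : (i0 : ℕ∞) + m = e + analyticOrderAt (b i0) 0 := by
          have h1 : analyticOrderAt (fun u => u ^ i0 * a i0 u) 0 = analyticOrderAt (fun u => u ^ e * b i0 u) 0 :=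
            analyticOrderAt_congr (hab i0 hi0)
          rw [ord_pow_mul (ha i0), ord_pow_mul (hb i0), hm] at h1
          exact h1
        obtain ⟨m', hm'⟩ : ∃ m' : ℕ, analyticOrderAt (b i0) 0 = m' := by
          have : analyticOrderAt (b i0) 0 ≠ ⊤ := by
            intro h
            rw [h] at hordb
            simp at hordb
          exact ⟨_, (ENat.natCast_toNat this).symm⟩
        rw [hm'] at hordb
        norm_cast at hordb
        have hr := ihm m' (by omega) q' hq' (k + l + e) l b (fun w => B (bu 0 w)) A₁
          ⟨hb, (isRef_bu 0).an_comp hB, by filter_upwards with w; simp [A₁]⟩ hbi0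
          (by rw [(isRef_bu 0).2]; exact hB0) ⟨i0, hi0, hm'⟩ (by
            rcases hprep with ⟨h1, h2⟩ | h1
            · left
              refine ⟨?_, h2⟩
              apply eq_of_mul_pow (hb _).continuousAt continuousAt_const e
              filter_upwards [hab (e - 1) (by omega), h1] with u x y
              rw [← x, y]; simp
            · exact Or.inr h1)
        simpa using hr
      · rcases hprep with ⟨h1, h2⟩ | h1
        · exfalso
          have hz : b (e - 1) 0 = 0 := by
            have : ∀ᶠ u in 𝓝 (0:𝕜), b (e-1) u = 0 := by
              apply eq_of_mul_pow (hb _).continuousAt continuousAt_const e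
              filter_upwards [hab (e - 1) (by omega), h1] with u x y
              rw [← x, y]; simp
            exact this.self_of_nhds
          rw [← hcoi (e-1) (by omega), ← hQc (e-1) (by omega), hR, Polynomial.coeff_mul_C,
            sub_eq_add_neg, ← Polynomial.C_neg, Polynomial.coeff_X_add_C_pow] at hz
          have h5 : e - (e - 1) = 1 := by omega
          rw [h5, Nat.choose_symm_of_eq_add (by omega : e = (e-1) + 1), Nat.choose_one_right] at hz
          have : (e : 𝕜) ≠ 0 := by exact_mod_cast hd.ne'
          simp [hc, hρ, this] at hz
        · exact finish_c h1 hq' hc _ _ hA₁ hO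
  · let T : ℕ → 𝕜 × 𝕜 → 𝕜 := fun i w => if i < e then w.1 ^ (e - i) * b i (w.1 * w.2)
      else w.2 ^ (i - e) * a i (w.1 * w.2)
    let A₁ : 𝕜 × 𝕜 → 𝕜 := fun w => ∑ i ∈ Finset.range d, T i w + w.2 ^ (d - e) * B (bv w)
    have hA₁ : AnalyticAt 𝕜 A₁ 0 := by
      refine AnalyticAt.add (Finset.analyticAt_fun_sum _ fun i _ => ?_) ?_
      · simp only [T]
        split_ifs
        · exact (analyticAt_fst.pow _).mul (an_uv (hb i))
        · exact (analyticAt_snd.pow _).mul (an_uv (ha i))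
      · exact (analyticAt_snd.pow _).mul (isRef_bv.an_comp hB)
    have hAA : ∀ᶠ w in 𝓝 (0:𝕜×𝕜), A (bv w) = w.2 ^ e * A₁ w := by
      have hall : ∀ᶠ w : 𝕜 × 𝕜 in 𝓝 0, ∀ i ∈ Finset.range d, i < e →
          a i (w.1 * w.2) = (w.1 * w.2) ^ (e - i) * b i (w.1 * w.2) := by
        rw [Filter.eventually_all_finset]
        intro i hi
        by_cases hie : i < e
        · have : ∀ᶠ u in 𝓝 (0:𝕜), a i u = u ^ (e - i) * b i u := by
            apply eq_of_mul_pow (ha i).continuousAt (an_pow_mul (hb i) (e - i)).continuousAt i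
            filter_upwards [hab i (Finset.mem_range.mp hi)] with u hu
            have : u ^ e = u ^ i * u ^ (e - i) := by rw [← pow_add]; congr 1; omega
            rw [hu, this]; ring
          exact (tendsto_uv.eventually this).mono fun w hw _ => hw
        · exact Eventually.of_forall fun w h => absurd h hie
      filter_upwards [isRef_bv.tendsto.eventually hE, hall] with w h1 h2
      rw [h1]
      simp only [A₁, mul_add, Finset.mul_sum]
      congr 1
      · refine Finset.sum_congr rfl fun i hi => ?_
        simp only [T, bv]
        split_ifs with hie
        · rw [h2 i hi hie]
          have : w.2 ^ e = w.2 ^ (e - i) * w.2 ^ i := by rw [← pow_add]; congr 1; omega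
          rw [this]; ring
        · have : w.2 ^ i = w.2 ^ e * w.2 ^ (i - e) := by rw [← pow_add]; congr 1; omega
          rw [this]; ring
      · have : w.2 ^ d = w.2 ^ e * w.2 ^ (d - e) := by rw [← pow_add]; congr 1; omega
        simp only [bv]
        rw [this]; ring
    rcases lt_or_eq_of_le hed with hlt | heq
    · suffices hS : Res 𝒰 q₀ (fun z => ((q' z).2, (q' z).1))
          (fun w => w.1 ^ (k + l + e) * w.2 ^ k * A₁ (w.2, w.1)) by
        refine Res.pull isRef_bv hqq' (Res.pull isRef_swap (q' := fun z => ((q' z).2, (q' z).1)) (by simp) (hS.congr ?_))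
        filter_upwards [tendsto_swap0.eventually hAA] with w hw
        rw [hw]; simp only [bv]; ring
      let Q : Polynomial 𝕜 := ∑ i ∈ Finset.range e, Polynomial.C (b i 0) * Polynomial.X ^ (e - i)
      have hQd : Q.natDegree ≤ e := by
        refine Polynomial.natDegree_sum_le_of_forall_le _ _ fun i hi => ?_
        exact (Polynomial.natDegree_C_mul_X_pow_le _ _).trans (by omega)
      have hQ0 : Q ≠ 0 := by
        intro h
        obtain ⟨i, hi, hbi⟩ := hbe hlt
        have hie : i < e := by
          by_contra hcon
          exact hbi (hbge i hi (by omega))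
        have : Q.coeff (e - i) = b i 0 := by
          simp only [Q, Polynomial.finsetSum_coeff, Polynomial.coeff_C_mul_X_pow]
          rw [Finset.sum_eq_single i]
          · simp
          · intro j hj hji
            have := Finset.mem_range.mp hj
            rw [if_neg (by omega)]
          · intro h; exact absurd (Finset.mem_range.mpr hie) h
        rw [h] at this
        exact hbi (by simpa using this.symm)
      have hO : Ord (Q.rootMultiplicity 0) (fun w => A₁ (w.2, w.1)) := by
        apply ord_poly Q hQ0 0
        filter_upwards with v
        simp only [A₁, Q, Polynomial.eval_finsetSum, Polynomial.eval_mul, Polynomial.eval_C,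
          Polynomial.eval_pow, Polynomial.eval_X]
        rw [zero_pow (by omega), zero_mul, add_zero, add_zero]
        rw [← Finset.sum_subset (Finset.range_mono hed)]
        · refine Finset.sum_congr rfl fun i hi => ?_
          have := Finset.mem_range.mp hi
          simp [T, this]; ring
        · intro i hi hie
          have h1 := Finset.mem_range.mp hi
          have h2 : ¬ i < e := fun h => hie (Finset.mem_range.mpr h)
          simp [T, h2, ha0 i h1]
      have hr : Q.rootMultiplicity 0 < d := by
        have hrle : Q.rootMultiplicity 0 ≤ Q.natDegree := rootMult_le Q 0
        omega
      exact IH _ hr _ hq'.swap _ _ _ (analyticAt_swap hA₁) hO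
    · subst heq
      refine Res.pull isRef_bv hqq' (Res.of_MU hq' ⟨k, k + l + e, A₁, hA₁, ?_, ?_⟩)
      · have : A₁ 0 = B 0 := by
          simp only [A₁]
          rw [Finset.sum_eq_zero, isRef_bv.2]
          · simp
          · intro i hi
            have := Finset.mem_range.mp hi
            simp only [T, this, if_true]
            rw [Prod.fst_zero, zero_pow (by omega), zero_mul]
        rw [this]; exact hB0
      · filter_upwards [hAA] with w hw
        rw [hw]; simp only [bv]; ring

end
end CellProof

open Filter Topology

namespace CellProof
section
variable {𝕜 : Type*} [NontriviallyNormedField 𝕜] [CompleteSpace 𝕜] [IsUltrametricDist 𝕜]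
variable {Z : Type*} [TopologicalSpace Z]
variable {𝒰 : Ultrafilter Z} {q₀ : Z → 𝕜 × 𝕜} {q q' : Z → 𝕜 × 𝕜}
set_option linter.unusedSectionVars false

theorem prep' [CharZero 𝕜] [ProperSpace 𝕜] (hN : NotArc 𝒰 q₀)
    {d : ℕ} (hd : 0 < d) (IH : ∀ r < d, PP 𝒰 q₀ r) (hq : IsChart 𝒰 q₀ q)
    (k l : ℕ) (a : ℕ → 𝕜 → 𝕜) (B A : 𝕜 × 𝕜 → 𝕜) (hex : Expn d a B A) (ha0 : ∀ i < d, a i 0 = 0) (hB0 : B 0 ≠ 0)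
    (hprep : ((∀ᶠ u in 𝓝 (0:𝕜), a (d-1) u = 0) ∧ l = 0) ∨ H0 𝒰 q₀ d) :
    Res 𝒰 q₀ q (fun w => w.1 ^ k * w.2 ^ l * A w) := by
  by_cases h : ∃ i < d, analyticOrderAt (a i) 0 ≠ ⊤
  · obtain ⟨i, hi, h⟩ := h
    exact prep hN hd IH _ q hq k l a B A hex ha0 hB0 ⟨i, hi, (ENat.natCast_toNat h).symm⟩ hprep
  · push Not at h
    refine Res.of_MU hq ⟨k, l + d, B, hex.2.1, hB0, ?_⟩
    have hall : ∀ᶠ w : 𝕜 × 𝕜 in 𝓝 0, ∀ i ∈ Finset.range d, a i w.1 = 0 := by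
      rw [Filter.eventually_all_finset]
      intro i hi
      exact (continuous_fst.tendsto (0:𝕜×𝕜)).eventually (analyticOrderAt_eq_top.mp (h i (Finset.mem_range.mp hi)))
    filter_upwards [hex.2.2, hall] with w h1 h2
    rw [h1, Finset.sum_eq_zero]
    · ring
    · intro i hi; rw [h2 i hi, zero_mul]

theorem PP_all [CharZero 𝕜] [ProperSpace 𝕜] (hN : NotArc 𝒰 q₀) (d : ℕ) : PP 𝒰 q₀ d := by
  induction d using Nat.strong_induction_on with
  | _ d IH =>
  rcases Nat.eq_zero_or_pos d with rfl | hd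
  · intro q hq k l A hA ⟨g, hg, hg0, h⟩
    refine Res.of_MU hq ⟨k, l, A, hA, ?_, by simp⟩
    have := h.self_of_nhds
    simp only [pow_zero, one_mul] at this
    change A (0, 0) ≠ 0
    rwa [this]
  · have h0 : H0 𝒰 q₀ d := by
      intro q hq k A hA hO
      obtain ⟨n, rfl⟩ : ∃ n, d = n + 1 := ⟨d - 1, by omega⟩
      obtain ⟨β, hβ, hβ0, a, B, hex, ha0, hB0, hz⟩ := tschirnhaus hA hO
      obtain ⟨q', hq', e⟩ := hq.shear hβ hβ0
      refine Res.pull (isRef_shear hβ hβ0) e ?_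
      have := prep' hN hd IH hq' k 0 a B _ hex (fun i _ => ha0 i) hB0 (Or.inl ⟨hz, rfl⟩)
      simpa [shear] using this
    intro q hq k l A hA hO
    obtain ⟨a, B, hex, ha0, hB0⟩ := reg_of_ord d hA hO
    exact prep' hN hd IH hq k l a B _ hex (fun i _ => ha0 i) hB0 (Or.inr h0)

theorem res_all [CharZero 𝕜] [ProperSpace 𝕜] (hN : NotArc 𝒰 q₀) (hq : IsChart 𝒰 q₀ q)
    {A : 𝕜 × 𝕜 → 𝕜} (hA : AnalyticAt 𝕜 A 0) (hne : ¬ ∀ᶠ w in 𝓝 (0 : 𝕜 × 𝕜), A w = 0) : Res 𝒰 q₀ q A := by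
  obtain ⟨k, A', h1, h2, h3⟩ := nonzero_factor hA hne
  obtain ⟨n, g, hg1, hg2, hg3⟩ := (an_0v h1).exists_eventuallyEq_pow_smul_nonzero_iff.mpr h3
  have := PP_all hN n q hq k 0 A' h1 ⟨g, hg1, hg2, by simpa using hg3⟩
  refine this.congr ?_
  filter_upwards [h2] with w hw
  rw [hw]; ring

/-! ### normal forms -/

/-- analytic in the chart -/
def An (𝒰 : Ultrafilter Z) (q : Z → 𝕜 × 𝕜) (g : Z → 𝕜) : Prop :=
  ∃ G : 𝕜 × 𝕜 → 𝕜, AnalyticAt 𝕜 G 0 ∧ ∀ᶠ z in nl 𝒰, g z = G (q z)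

/-- monomial times unit in the chart -/
def NF1 (𝒰 : Ultrafilter Z) (q : Z → 𝕜 × 𝕜) (g : Z → 𝕜) : Prop :=
  ∃ (i j : ℤ) (U : 𝕜 × 𝕜 → 𝕜), AnalyticAt 𝕜 U 0 ∧ U 0 ≠ 0 ∧
    ∀ᶠ z in nl 𝒰, g z = (q z).1 ^ i * (q z).2 ^ j * U (q z)

/-- normal form in the chart -/
def NF (𝒰 : Ultrafilter Z) (q : Z → 𝕜 × 𝕜) (g : Z → 𝕜) : Prop :=
  (∀ᶠ z in nl 𝒰, g z = 0) ∨ NF1 𝒰 q g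

/-- good refinement -/
def GR (𝒰 : Ultrafilter Z) (q₀ q q' : Z → 𝕜 × 𝕜) : Prop :=
  IsChart 𝒰 q₀ q' ∧ (∀ g, NF1 𝒰 q g → NF1 𝒰 q' g) ∧ (∀ g, An 𝒰 q g → An 𝒰 q' g)

theorem GR.nf (h : GR 𝒰 q₀ q q') {g} (hg : NF 𝒰 q g) : NF 𝒰 q' g :=
  hg.imp id (h.2.1 g)

theorem GR.refl (h : IsChart 𝒰 q₀ q) : GR 𝒰 q₀ q q := ⟨h, fun _ => id, fun _ => id⟩

theorem GR.trans {q''} (h : GR 𝒰 q₀ q q') (h' : GR 𝒰 q₀ q' q'') : GR 𝒰 q₀ q q'' :=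
  ⟨h'.1, fun g hg => h'.2.1 g (h.2.1 g hg), fun g hg => h'.2.2 g (h.2.2 g hg)⟩

theorem An.congr {g h : Z → 𝕜} (hg : An 𝒰 q g) (e : ∀ᶠ z in nl 𝒰, h z = g z) : An 𝒰 q h := by
  obtain ⟨G, h1, h2⟩ := hg
  exact ⟨G, h1, by filter_upwards [h2, e] with z a b; rw [b, a]⟩

theorem NF1.congr {g h : Z → 𝕜} (hg : NF1 𝒰 q g) (e : ∀ᶠ z in nl 𝒰, h z = g z) : NF1 𝒰 q h := by
  obtain ⟨i, j, G, h1, h0, h2⟩ := hg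
  exact ⟨i, j, G, h1, h0, by filter_upwards [h2, e] with z a b; rw [b, a]⟩

theorem NF.congr {g h : Z → 𝕜} (hg : NF 𝒰 q g) (e : ∀ᶠ z in nl 𝒰, h z = g z) : NF 𝒰 q h := by
  rcases hg with hg | hg
  · left
    filter_upwards [hg, e] with z a b
    rw [b, a]
  · exact Or.inr (hg.congr e)

theorem An.add {g h : Z → 𝕜} (hg : An 𝒰 q g) (hh : An 𝒰 q h) : An 𝒰 q (fun z => g z + h z) := by
  obtain ⟨G, h1, h2⟩ := hg
  obtain ⟨H, h3, h4⟩ := hh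
  exact ⟨fun w => G w + H w, h1.add h3, by filter_upwards [h2, h4] with z a b; rw [b, a]⟩

theorem An.mul {g h : Z → 𝕜} (hg : An 𝒰 q g) (hh : An 𝒰 q h) : An 𝒰 q (fun z => g z * h z) := by
  obtain ⟨G, h1, h2⟩ := hg
  obtain ⟨H, h3, h4⟩ := hh
  exact ⟨fun w => G w * H w, h1.mul h3, by filter_upwards [h2, h4] with z a b; rw [b, a]⟩

theorem An.const (c : 𝕜) : An 𝒰 q (fun _ => c) := ⟨fun _ => c, analyticAt_const, by simp⟩

theorem An.fst : An 𝒰 q (fun z => (q z).1) := ⟨fun w => w.1, analyticAt_fst, by simp⟩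
theorem An.snd : An 𝒰 q (fun z => (q z).2) := ⟨fun w => w.2, analyticAt_snd, by simp⟩

theorem An.pow {g : Z → 𝕜} (hg : An 𝒰 q g) (n : ℕ) : An 𝒰 q (fun z => g z ^ n) := by
  obtain ⟨G, h1, h2⟩ := hg
  exact ⟨fun w => G w ^ n, h1.pow n, by filter_upwards [h2] with z a; rw [a]⟩

theorem NF1.mul (hN : NotArc 𝒰 q₀) (hq : IsChart 𝒰 q₀ q) {g h : Z → 𝕜}
    (hg : NF1 𝒰 q g) (hh : NF1 𝒰 q h) : NF1 𝒰 q (fun z => g z * h z) := by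
  obtain ⟨i, j, G, h1, h0, h2⟩ := hg
  obtain ⟨i', j', G', h1', h0', h2'⟩ := hh
  refine ⟨i + i', j + j', fun w => G w * G' w, h1.mul h1', mul_ne_zero h0 h0', ?_⟩
  filter_upwards [h2, h2', hq.ne_fst hN, hq.ne_snd hN] with z a b c d
  rw [a, b, zpow_add₀ c, zpow_add₀ d]; ring

theorem NF1.inv {g : Z → 𝕜} (hg : NF1 𝒰 q g) : NF1 𝒰 q (fun z => (g z)⁻¹) := by
  obtain ⟨i, j, G, h1, h0, h2⟩ := hg
  refine ⟨-i, -j, fun w => (G w)⁻¹, h1.inv h0, inv_ne_zero h0, ?_⟩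
  filter_upwards [h2] with z a
  rw [a, zpow_neg, zpow_neg, mul_inv, mul_inv]

theorem NF1.one : NF1 𝒰 q (fun _ => 1) :=
  ⟨0, 0, fun _ => 1, analyticAt_const, one_ne_zero, by simp⟩

theorem NF1.pow (hN : NotArc 𝒰 q₀) (hq : IsChart 𝒰 q₀ q) {g : Z → 𝕜}
    (hg : NF1 𝒰 q g) (n : ℕ) : NF1 𝒰 q (fun z => g z ^ n) := by
  induction n with
  | zero => simpa using NF1.one
  | succ n ih => simpa only [pow_succ] using NF1.mul hN hq ih hg

theorem NF1.zpow (hN : NotArc 𝒰 q₀) (hq : IsChart 𝒰 q₀ q) {g : Z → 𝕜}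
    (hg : NF1 𝒰 q g) (n : ℤ) : NF1 𝒰 q (fun z => g z ^ n) := by
  cases n with
  | ofNat n => simpa using hg.pow hN hq n
  | negSucc n => simpa only [zpow_negSucc] using (hg.pow hN hq (n+1)).inv

theorem NF1.fst : NF1 𝒰 q (fun z => (q z).1) :=
  ⟨1, 0, fun _ => 1, analyticAt_const, one_ne_zero, by simp⟩
theorem NF1.snd : NF1 𝒰 q (fun z => (q z).2) :=
  ⟨0, 1, fun _ => 1, analyticAt_const, one_ne_zero, by simp⟩

theorem NF1.of_unit {U : 𝕜 × 𝕜 → 𝕜} (hU : AnalyticAt 𝕜 U 0) (hU0 : U 0 ≠ 0) : NF1 𝒰 q (fun z => U (q z)) :=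
  ⟨0, 0, U, hU, hU0, by simp⟩

theorem NF1.of_MU {A : 𝕜 × 𝕜 → 𝕜} (hq' : IsChart 𝒰 q₀ q') (hA : MU A) : NF1 𝒰 q' (fun z => A (q' z)) := by
  obtain ⟨i, j, U, h1, h2, h3⟩ := hA
  refine ⟨i, j, U, h1, h2, ?_⟩
  filter_upwards [hq'.tendsto.eventually h3] with z hz
  simpa using hz

theorem GR.of_ref (hN : NotArc 𝒰 q₀) (hq' : IsChart 𝒰 q₀ q') {Φ : 𝕜 × 𝕜 → 𝕜 × 𝕜} (hΦ : IsRef Φ)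
    (e : ∀ᶠ z in nl 𝒰, q z = Φ (q' z)) (h1 : NF1 𝒰 q' (fun z => (q z).1)) (h2 : NF1 𝒰 q' (fun z => (q z).2)) :
    GR 𝒰 q₀ q q' := by
  refine ⟨hq', ?_, ?_⟩
  · rintro g ⟨i, j, U, hU, hU0, hg⟩
    have h3 : NF1 𝒰 q' (fun z => U (Φ (q' z))) :=
      NF1.of_unit (hΦ.an_comp hU) (by simpa [hΦ.2] using hU0)
    refine (((h1.zpow hN hq' i).mul hN hq' (h2.zpow hN hq' j)).mul hN hq' h3).congr ?_
    filter_upwards [hg, e] with z a b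
    rw [a, ← b]
  · rintro g ⟨G, hG, hg⟩
    refine ⟨_, hΦ.an_comp hG, ?_⟩
    filter_upwards [hg, e] with z a b
    rw [a, b]

theorem nf_of_an [CharZero 𝕜] [ProperSpace 𝕜] (hN : NotArc 𝒰 q₀) (hq : IsChart 𝒰 q₀ q) {g : Z → 𝕜}
    (hg : An 𝒰 q g) : ∃ q', GR 𝒰 q₀ q q' ∧ NF 𝒰 q' g := by
  obtain ⟨G, hG, hgG⟩ := hg
  by_cases hz : ∀ᶠ w in 𝓝 (0:𝕜×𝕜), G w = 0
  · refine ⟨q, GR.refl hq, Or.inl ?_⟩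
    filter_upwards [hgG, hq.tendsto.eventually hz] with z a b
    rw [a, b]
  · have hFan : AnalyticAt 𝕜 (fun w : 𝕜 × 𝕜 => w.1 * (w.2 * G w)) 0 :=
      analyticAt_fst.mul (analyticAt_snd.mul hG)
    have hF : ¬ ∀ᶠ w in 𝓝 (0:𝕜×𝕜), w.1 * (w.2 * G w) = 0 := by
      intro h
      apply hz
      apply eq_of_snd_mul hG analyticAt_const
      have := eq_of_fst_mul (f := fun w : 𝕜 × 𝕜 => w.2 * G w) (g := fun _ => 0) (analyticAt_snd.mul hG) analyticAt_const
        (by simpa using h)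
      simpa using this
    obtain ⟨q', Φ, hq', hΦ, e, i, j, U, hU, hU0, hMU⟩ := res_all hN hq hFan hF
    have aG := hΦ.an_comp hG
    have a1 : AnalyticAt 𝕜 (fun w => (Φ w).1) 0 := hΦ.an_comp analyticAt_fst
    have a2 : AnalyticAt 𝕜 (fun w => (Φ w).2) 0 := hΦ.an_comp analyticAt_snd
    have m1 : MU (fun w => (Φ w).1) := factor _ (B := fun w => (Φ w).2 * G (Φ w)) i j rfl a1 (a2.mul aG) hU hU0 hMU
    have m2 : MU (fun w => (Φ w).2) := factor _ (B := fun w => (Φ w).1 * G (Φ w)) i j rfl a2 (a1.mul aG) hU hU0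
      (hMU.mono fun w hw => by rw [← hw]; ring)
    have m3 : MU (fun w => G (Φ w)) := factor _ (B := fun w => (Φ w).1 * (Φ w).2) i j rfl aG (a1.mul a2) hU hU0
      (hMU.mono fun w hw => by rw [← hw]; ring)
    refine ⟨q', GR.of_ref hN hq' hΦ e ?_ ?_, Or.inr ?_⟩
    · exact (NF1.of_MU hq' m1).congr (e.mono fun z hz => by rw [hz])
    · exact (NF1.of_MU hq' m2).congr (e.mono fun z hz => by rw [hz])
    · refine (NF1.of_MU hq' m3).congr ?_
      filter_upwards [e, hgG] with z a b
      rw [b, a]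

theorem GR_bu (hN : NotArc 𝒰 q₀) (hq' : IsChart 𝒰 q₀ q') {c : 𝕜} (e : ∀ᶠ z in nl 𝒰, q z = bu c (q' z)) :
    GR 𝒰 q₀ q q' := by
  refine GR.of_ref hN hq' (isRef_bu c) e ?_ ?_
  · exact NF1.fst.congr (e.mono fun z hz => by rw [hz]; rfl)
  · by_cases hc : c = 0
    · subst hc
      refine (NF1.fst.mul hN hq' NF1.snd).congr (e.mono fun z hz => by rw [hz]; simp [bu])
    · refine (NF1.fst.mul hN hq' (NF1.of_unit (U := fun w => w.2 + c) (analyticAt_snd.add analyticAt_const)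
        (by simpa using hc))).congr (e.mono fun z hz => by rw [hz]; simp [bu])

theorem GR_bv (hN : NotArc 𝒰 q₀) (hq' : IsChart 𝒰 q₀ q') (e : ∀ᶠ z in nl 𝒰, q z = bv (q' z)) :
    GR 𝒰 q₀ q q' := by
  refine GR.of_ref hN hq' isRef_bv e ?_ ?_
  · exact (NF1.fst.mul hN hq' NF1.snd).congr (e.mono fun z hz => by rw [hz]; rfl)
  · exact NF1.snd.congr (e.mono fun z hz => by rw [hz]; rfl)

theorem GR_swap (hN : NotArc 𝒰 q₀) (hq : IsChart 𝒰 q₀ q) : GR 𝒰 q₀ q (fun z => ((q z).2, (q z).1)) := by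
  refine GR.of_ref hN hq.swap isRef_swap (by simp) ?_ ?_
  · exact NF1.snd (q := fun z => ((q z).2, (q z).1))
  · exact NF1.fst (q := fun z => ((q z).2, (q z).1))

/-- sign-definite monomials -/
def Def1 (𝒰 : Ultrafilter Z) (q : Z → 𝕜 × 𝕜) (g : Z → 𝕜) : Prop :=
  An 𝒰 q g ∨ ((∀ᶠ z in nl 𝒰, g z ≠ 0) ∧ Tendsto (fun z => (g z)⁻¹) (nl 𝒰) (𝓝 0))

theorem def_pos {a b : ℕ} {U : 𝕜 × 𝕜 → 𝕜} (hU : AnalyticAt 𝕜 U 0) {g : Z → 𝕜}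
    (hg : ∀ᶠ z in nl 𝒰, g z = (q z).1 ^ a * (q z).2 ^ b * U (q z)) : Def1 𝒰 q g :=
  Or.inl ⟨fun w => w.1 ^ a * w.2 ^ b * U w, ((analyticAt_fst.pow a).mul (analyticAt_snd.pow b)).mul hU, hg⟩

theorem def_neg (hN : NotArc 𝒰 q₀) (hq : IsChart 𝒰 q₀ q) {a b : ℕ} {U : 𝕜 × 𝕜 → 𝕜}
    (hU : AnalyticAt 𝕜 U 0) (hU0 : U 0 ≠ 0) {g : Z → 𝕜}
    (hg : ∀ᶠ z in nl 𝒰, g z = ((q z).1 ^ a * (q z).2 ^ b)⁻¹ * U (q z)) : Def1 𝒰 q g := by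
  by_cases h : a = 0 ∧ b = 0
  · refine Or.inl ⟨U, hU, ?_⟩
    filter_upwards [hg] with z hz
    rw [hz, h.1, h.2]; simp
  · right
    have hne : ∀ᶠ z in nl 𝒰, U (q z) ≠ 0 := hq.tendsto.eventually (hU.continuousAt.eventually_ne hU0)
    refine ⟨?_, ?_⟩
    · filter_upwards [hg, hne, hq.ne_fst hN, hq.ne_snd hN] with z h1 h2 h3 h4
      rw [h1]
      exact mul_ne_zero (inv_ne_zero (mul_ne_zero (pow_ne_zero _ h3) (pow_ne_zero _ h4))) h2
    · have hc : AnalyticAt 𝕜 (fun w : 𝕜 × 𝕜 => w.1 ^ a * w.2 ^ b * (U w)⁻¹) 0 :=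
        ((analyticAt_fst.pow a).mul (analyticAt_snd.pow b)).mul (hU.inv hU0)
      have ht := hc.continuousAt.tendsto.comp hq.tendsto
      have h0 : (0:𝕜 × 𝕜).1 ^ a * (0:𝕜 × 𝕜).2 ^ b * (U 0)⁻¹ = 0 := by
        rw [not_and_or] at h
        rcases h with h | h <;> simp [h]
      rw [h0] at ht
      refine ht.congr' ?_
      filter_upwards [hg] with z hz
      rw [hz]; simp only [mul_inv, inv_inv, Function.comp_apply]

theorem def_mixed [CharZero 𝕜] [ProperSpace 𝕜] (hN : NotArc 𝒰 q₀) (n : ℕ) : ∀ {q : Z → 𝕜 × 𝕜}, IsChart 𝒰 q₀ q →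
    ∀ {a b : ℕ}, a + b = n → ∀ {U : 𝕜 × 𝕜 → 𝕜}, AnalyticAt 𝕜 U 0 → U 0 ≠ 0 → ∀ {g : Z → 𝕜},
    (∀ᶠ z in nl 𝒰, g z = (q z).1 ^ a * ((q z).2 ^ b)⁻¹ * U (q z)) → ∃ q', GR 𝒰 q₀ q q' ∧ Def1 𝒰 q' g := by
  induction n using Nat.strong_induction_on with
  | _ n ih =>
  intro q hq a b hab U hU hU0 g hg
  by_cases ha : a = 0
  · refine ⟨q, GR.refl hq, def_neg hN hq (a := 0) (b := b) hU hU0 ?_⟩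
    filter_upwards [hg] with z hz
    rw [hz, ha]; simp
  by_cases hb : b = 0
  · refine ⟨q, GR.refl hq, def_pos (a := a) (b := 0) hU ?_⟩
    filter_upwards [hg] with z hz
    rw [hz, hb]; simp
  rcases hq.blow hN with ⟨c, q', hq', e⟩ | ⟨q', hq', e⟩
  · have hgr := GR_bu hN hq' e
    have hU' := (isRef_bu c).an_comp hU
    have hU0' : U (bu c 0) ≠ 0 := by rwa [(isRef_bu c).2]
    by_cases hc : c = 0
    · subst hc
      rcases le_or_gt a b with hle | hlt
      · refine ⟨q', hgr, def_neg hN hq' (a := b - a) (b := b) hU' hU0' ?_⟩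
        filter_upwards [hg, e, hq'.ne_fst hN, hq'.ne_snd hN] with z h1 h2 h3 h4
        rw [h1, h2]
        have : (q' z).1 ^ b = (q' z).1 ^ a * (q' z).1 ^ (b - a) := by rw [← pow_add]; congr 1; omega
        simp only [bu, add_zero]
        rw [mul_pow, this]
        field_simp
      · have : ∀ᶠ z in nl 𝒰, g z = (q' z).1 ^ (a - b) * ((q' z).2 ^ b)⁻¹ * U (bu 0 (q' z)) := by
          filter_upwards [hg, e, hq'.ne_fst hN, hq'.ne_snd hN] with z h1 h2 h3 h4
          rw [h1, h2]
          have : (q' z).1 ^ a = (q' z).1 ^ b * (q' z).1 ^ (a - b) := by rw [← pow_add]; congr 1; omega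
          simp only [bu, add_zero]
          rw [mul_pow, this]
          field_simp
        obtain ⟨q'', h1, h2⟩ := ih (a - b + b) (by omega) hq' rfl hU' hU0' this
        exact ⟨q'', hgr.trans h1, h2⟩
    · have hG : AnalyticAt 𝕜 (fun w : 𝕜 × 𝕜 => (w.2 + c) ^ b) 0 := (analyticAt_snd.add analyticAt_const).pow b
      have hG0 : ((0:𝕜 × 𝕜).2 + c) ^ b ≠ 0 := by simp [hc]
      have hG2 := (hG.inv hG0).mul hU'
      have hG20 := mul_ne_zero (inv_ne_zero hG0) hU0'
      refine ⟨q', hgr, ?_⟩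
      rcases le_or_gt a b with hle | hlt
      · refine def_neg hN hq' (a := b - a) (b := 0) hG2 hG20 ?_
        filter_upwards [hg, e, hq'.ne_fst hN] with z h1 h2 h3
        rw [h1, h2]
        have : (q' z).1 ^ b = (q' z).1 ^ a * (q' z).1 ^ (b - a) := by rw [← pow_add]; congr 1; omega
        simp only [bu, Pi.mul_apply, Pi.inv_apply]
        rw [mul_pow, this]
        simp only [mul_inv, pow_zero, mul_one]
        field_simp
      · refine def_pos (a := a - b) (b := 0) hG2 ?_
        filter_upwards [hg, e, hq'.ne_fst hN] with z h1 h2 h3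
        rw [h1, h2]
        have : (q' z).1 ^ a = (q' z).1 ^ b * (q' z).1 ^ (a - b) := by rw [← pow_add]; congr 1; omega
        simp only [bu, Pi.mul_apply, Pi.inv_apply]
        rw [mul_pow, this]
        simp only [mul_inv, pow_zero, mul_one]
        field_simp
  · have hgr := GR_bv hN hq' e
    have hU' := isRef_bv.an_comp hU
    have hU0' : U (bv 0) ≠ 0 := by rwa [isRef_bv.2]
    rcases le_or_gt b a with hle | hlt
    · refine ⟨q', hgr, def_pos (a := a) (b := a - b) hU' ?_⟩
      filter_upwards [hg, e, hq'.ne_fst hN, hq'.ne_snd hN] with z h1 h2 h3 h4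
      rw [h1, h2]
      have : (q' z).2 ^ a = (q' z).2 ^ b * (q' z).2 ^ (a - b) := by rw [← pow_add]; congr 1; omega
      simp only [bv]
      rw [mul_pow, this]
      field_simp
    · have : ∀ᶠ z in nl 𝒰, g z = (q' z).1 ^ a * ((q' z).2 ^ (b - a))⁻¹ * U (bv (q' z)) := by
        filter_upwards [hg, e, hq'.ne_fst hN, hq'.ne_snd hN] with z h1 h2 h3 h4
        rw [h1, h2]
        have : (q' z).2 ^ b = (q' z).2 ^ a * (q' z).2 ^ (b - a) := by rw [← pow_add]; congr 1; omega
        simp only [bv]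
        rw [mul_pow, this]
        field_simp
      obtain ⟨q'', h1, h2⟩ := ih (a + (b - a)) (by omega) hq' rfl hU' hU0' this
      exact ⟨q'', hgr.trans h1, h2⟩

theorem Def1.gr {g : Z → 𝕜} (h : GR 𝒰 q₀ q q') (hg : Def1 𝒰 q g) : Def1 𝒰 q' g :=
  hg.imp (h.2.2 g) id

theorem def_of_nf [CharZero 𝕜] [ProperSpace 𝕜] (hN : NotArc 𝒰 q₀) (hq : IsChart 𝒰 q₀ q) {g : Z → 𝕜}
    (hg : NF 𝒰 q g) : ∃ q', GR 𝒰 q₀ q q' ∧ Def1 𝒰 q' g := by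
  rcases hg with hg | ⟨i, j, U, hU, hU0, hg⟩
  · exact ⟨q, GR.refl hq, Or.inl ((An.const 0).congr hg)⟩
  · rcases i.eq_nat_or_neg with ⟨a, rfl | rfl⟩ <;> rcases j.eq_nat_or_neg with ⟨b, rfl | rfl⟩
    · exact ⟨q, GR.refl hq, def_pos (a := a) (b := b) hU (by simpa using hg)⟩
    · refine def_mixed hN _ hq (a := a) (b := b) rfl hU hU0 (by simpa using hg)
    · obtain ⟨q', h1, h2⟩ := def_mixed hN _ hq.swap (a := b) (b := a) rfl (analyticAt_swap hU) hU0 (g := g)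
        (by filter_upwards [hg] with z hz; rw [hz]; simp only [zpow_neg, zpow_natCast]; ring)
      exact ⟨q', (GR_swap hN hq).trans h1, h2⟩
    · exact ⟨q, GR.refl hq, def_neg hN hq (a := a) (b := b) hU hU0 (by
        filter_upwards [hg] with z hz; rw [hz]; simp only [zpow_neg, zpow_natCast, mul_inv])⟩

end
end CellProof

open Filter Topology

namespace CellProof
section
variable {𝕜 : Type*} [NontriviallyNormedField 𝕜] [CompleteSpace 𝕜] [IsUltrametricDist 𝕜]
variable {Z : Type*} [TopologicalSpace Z]
variable {𝒰 : Ultrafilter Z} {q₀ : Z → 𝕜 × 𝕜} {q q' : Z → 𝕜 × 𝕜}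
set_option linter.unusedSectionVars false

/-- meromorphic with monomial denominator -/
def Mer (𝒰 : Ultrafilter Z) (q : Z → 𝕜 × 𝕜) (g : Z → 𝕜) : Prop :=
  ∃ M : ℕ, An 𝒰 q (fun z => ((q z).1 * (q z).2) ^ M * g z)

theorem Mer.of_an {g : Z → 𝕜} (h : An 𝒰 q g) : Mer 𝒰 q g := ⟨0, h.congr (by simp)⟩

theorem Mer.up {g : Z → 𝕜} {M : ℕ} (h : An 𝒰 q (fun z => ((q z).1 * (q z).2) ^ M * g z)) (N : ℕ) :
    An 𝒰 q (fun z => ((q z).1 * (q z).2) ^ (N + M) * g z) :=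
  (((An.fst.mul An.snd).pow N).mul h).congr (Eventually.of_forall fun z => by ring)

theorem Mer.add {g h : Z → 𝕜} (hg : Mer 𝒰 q g) (hh : Mer 𝒰 q h) : Mer 𝒰 q (fun z => g z + h z) := by
  obtain ⟨M, h1⟩ := hg
  obtain ⟨N, h2⟩ := hh
  exact ⟨N + M, ((Mer.up h1 N).add (Mer.up h2 M)).congr (Eventually.of_forall fun z => by ring)⟩

theorem Mer.mul {g h : Z → 𝕜} (hg : Mer 𝒰 q g) (hh : Mer 𝒰 q h) : Mer 𝒰 q (fun z => g z * h z) := by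
  obtain ⟨M, h1⟩ := hg
  obtain ⟨N, h2⟩ := hh
  exact ⟨N + M, (h1.mul h2).congr (Eventually.of_forall fun z => by ring)⟩

theorem Mer.of_nf (hN : NotArc 𝒰 q₀) (hq : IsChart 𝒰 q₀ q) {g : Z → 𝕜} (hg : NF 𝒰 q g) : Mer 𝒰 q g := by
  rcases hg with hg | ⟨i, j, U, hU, hU0, hg⟩
  · exact Mer.of_an ((An.const 0).congr hg)
  · refine ⟨i.natAbs + j.natAbs, ?_⟩
    refine ⟨fun w => w.1 ^ (i.natAbs + j.natAbs + i).toNat * w.2 ^ (i.natAbs + j.natAbs + j).toNat * U w,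
      ((analyticAt_fst.pow _).mul (analyticAt_snd.pow _)).mul hU, ?_⟩
    filter_upwards [hg, hq.ne_fst hN, hq.ne_snd hN] with z h1 h2 h3
    rw [h1, ← zpow_natCast (q z).1, ← zpow_natCast (q z).2, ← zpow_natCast _ (i.natAbs + j.natAbs),
      Int.toNat_of_nonneg (by omega), Int.toNat_of_nonneg (by omega), zpow_add₀ h2 _ i, zpow_add₀ h3 _ j, mul_zpow]
    push_cast
    ring

theorem Mer.nf [CharZero 𝕜] [ProperSpace 𝕜] (hN : NotArc 𝒰 q₀) (hq : IsChart 𝒰 q₀ q) {g : Z → 𝕜}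
    (hg : Mer 𝒰 q g) : ∃ q', GR 𝒰 q₀ q q' ∧ NF 𝒰 q' g := by
  obtain ⟨M, h⟩ := hg
  obtain ⟨q', h1, h2⟩ := nf_of_an hN hq h
  refine ⟨q', h1, ?_⟩
  rcases h2 with h2 | h2
  · left
    filter_upwards [h2, hq.ne_fst hN, hq.ne_snd hN] with z a b c
    simpa [b, c] using a
  · right
    have h3 : NF1 𝒰 q' (fun z => (((q z).1 * (q z).2) ^ M)⁻¹) :=
      (h1.2.1 _ ((NF1.fst.mul hN hq NF1.snd).pow hN hq M)).inv
    refine (h3.mul hN h1.1 h2).congr ?_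
    filter_upwards [hq.ne_fst hN, hq.ne_snd hN] with z b c
    field_simp

theorem Mer.gr (hN : NotArc 𝒰 q₀) (hq : IsChart 𝒰 q₀ q) (hg' : GR 𝒰 q₀ q q') {g : Z → 𝕜}
    (hg : Mer 𝒰 q g) : Mer 𝒰 q' g := by
  obtain ⟨M, h⟩ := hg
  have h3 : NF1 𝒰 q' (fun z => (((q z).1 * (q z).2) ^ M)⁻¹) :=
    (hg'.2.1 _ ((NF1.fst.mul hN hq NF1.snd).pow hN hq M)).inv
  obtain ⟨K, hK⟩ := (Mer.of_nf hN hg'.1 (Or.inr h3)).mul (Mer.of_an (hg'.2.2 _ h))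
  refine ⟨K, hK.congr ?_⟩
  filter_upwards [hq.ne_fst hN, hq.ne_snd hN] with z b c
  field_simp

theorem Mer.poly (hN : NotArc 𝒰 q₀) (hq : IsChart 𝒰 q₀ q) {m : ℕ} {h : Fin m → Z → 𝕜}
    (hh : ∀ i, NF 𝒰 q (h i)) (P : MvPolynomial (Fin m) 𝕜) :
    Mer 𝒰 q (fun z => MvPolynomial.eval (fun i => h i z) P) := by
  induction P using MvPolynomial.induction_on with
  | C a => simpa using Mer.of_an (An.const a)
  | add P Q hP hQ => simpa using hP.add hQ
  | mul_X P i hP => simpa using hP.mul (Mer.of_nf hN hq (hh i))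

/-- chain of refinements -/
theorem chain {ι : Type*} [Fintype ι] (hq : IsChart 𝒰 q₀ q) (R : ι → (Z → 𝕜 × 𝕜) → Prop)
    (hR : ∀ i q q', GR 𝒰 q₀ q q' → R i q → R i q')
    (hE : ∀ i q', GR 𝒰 q₀ q q' → ∃ q'', GR 𝒰 q₀ q' q'' ∧ R i q'') :
    ∃ q', GR 𝒰 q₀ q q' ∧ ∀ i, R i q' := by
  classical
  suffices ∀ s : Finset ι, ∃ q', GR 𝒰 q₀ q q' ∧ ∀ i ∈ s, R i q' by
    obtain ⟨q', h1, h2⟩ := this Finset.univ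
    exact ⟨q', h1, fun i => h2 i (Finset.mem_univ i)⟩
  intro s
  induction s using Finset.induction_on with
  | empty => exact ⟨q, GR.refl hq, by simp⟩
  | insert a s _ ih =>
    obtain ⟨q', h1, h2⟩ := ih
    obtain ⟨q'', h3, h4⟩ := hE a q' h1
    refine ⟨q'', h1.trans h3, ?_⟩
    intro i hi
    rcases Finset.mem_insert.mp hi with rfl | hi
    · exact h4
    · exact hR i _ _ h3 (h2 i hi)
end

section
open PadicSub
variable {p : ℕ} [Fact p.Prime]

theorem ranal_analytic {m : ℕ} (a : (Fin m → ℕ) → ℚ_[p]) (ha : IsRestrictedCoeffs p a) (x₀ : Fin m → ℚ_[p]) :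
    AnalyticAt ℚ_[p] (ranalFn p a) x₀ := by
  by_cases h : ∀ j, ‖x₀ j‖ ≤ 1
  · refine (analyticAt_restricted a ha x₀ h).congr ?_
    have : ∀ᶠ x in 𝓝 x₀, ∀ j, ‖x j‖ ≤ 1 := by
      rw [Filter.eventually_all]
      intro j
      have h2 : Metric.closedBall (0:ℚ_[p]) 1 ∈ 𝓝 (x₀ j) :=
        (IsUltrametricDist.isOpen_closedBall (0:ℚ_[p]) one_ne_zero).mem_nhds (by simpa using h j)
      filter_upwards [(continuous_apply j).continuousAt.eventually h2] with x hx
      simpa using hx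
    filter_upwards [this] with x hx
    simp [ranalFn, hx]
  · refine (analyticAt_const (v := (0:ℚ_[p]))).congr ?_
    push Not at h
    obtain ⟨j, hj⟩ := h
    have : ∀ᶠ x in 𝓝 x₀, 1 < ‖x j‖ :=
      ((continuous_apply j).norm.continuousAt (x := x₀)).eventually (lt_mem_nhds hj)
    filter_upwards [this] with x hx
    rw [ranalFn, if_neg]
    push Not
    exact ⟨j, hx⟩

theorem ranal_out {m : ℕ} (a : (Fin m → ℕ) → ℚ_[p]) {x : Fin m → ℚ_[p]} {j : Fin m} (hj : 1 < ‖x j‖) :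
    ranalFn p a x = 0 := by
  rw [ranalFn, if_neg]
  push Not
  exact ⟨j, hj⟩

theorem one_lt_of_inv {x : ℚ_[p]} (h0 : x ≠ 0) (h : x⁻¹ ∈ Metric.ball (0:ℚ_[p]) 1) : 1 < ‖x‖ := by
  rw [mem_ball_zero_iff, norm_inv] at h
  exact (inv_lt_one₀ (norm_pos_iff.mpr h0)).mp h

variable {Z : Type*} [TopologicalSpace Z]
variable {𝒰 : Ultrafilter Z} {q₀ : Z → ℚ_[p] × ℚ_[p]}

theorem dfun_nf (hN : NotArc 𝒰 q₀) {m : ℕ} {f : (Fin m → ℚ_[p]) → ℚ_[p]} (hf : IsDFunction p f) :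
    ∀ {q : Z → ℚ_[p] × ℚ_[p]} (_ : IsChart 𝒰 q₀ q) (h : Fin m → Z → ℚ_[p]) (_ : ∀ i, NF 𝒰 q (h i)),
      ∃ q', GR 𝒰 q₀ q q' ∧ NF 𝒰 q' (fun z => f (fun i => h i z)) := by
  induction hf with
  | @ranal m a ha =>
    intro q hq h hh
    obtain ⟨q', h1, h2⟩ := chain hq (fun i q => Def1 𝒰 q (h i)) (fun i q q' hg hd => hd.gr hg)
      (fun i q' hg => def_of_nf hN hg.1 (hg.nf (hh i)))
    by_cases hall : ∀ i, An 𝒰 q' (h i)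
    · choose G hG hGe using hall
      have hA : An 𝒰 q' (fun z => ranalFn p a (fun i => h i z)) := by
        refine ⟨fun w => ranalFn p a (fun i => G i w),
          AnalyticAt.fun_comp (g := ranalFn p a) (f := fun w i => G i w) (ranal_analytic a ha _)
            (analyticAt_pi_iff.mpr hG), ?_⟩
        filter_upwards [Filter.eventually_all.mpr hGe] with z hz
        simp only [hz]
      obtain ⟨q'', h3, h4⟩ := nf_of_an hN h1.1 hA
      exact ⟨q'', h1.trans h3, h4⟩
    · push Not at hall
      obtain ⟨i, hi⟩ := hall
      obtain ⟨h3, h4⟩ := (h2 i).resolve_left hi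
      refine ⟨q', h1, Or.inl ?_⟩
      filter_upwards [h3, h4.eventually (Metric.ball_mem_nhds 0 one_pos)] with z b c
      exact ranal_out a (j := i) (one_lt_of_inv b c)
  | @poly m P =>
    intro q hq h hh
    exact (Mer.poly hN hq hh P).nf hN hq
  | inv =>
    intro q hq h hh
    refine ⟨q, GR.refl hq, ?_⟩
    rcases hh 0 with h0 | h0
    · left
      filter_upwards [h0] with z hz
      simp [hz]
    · exact Or.inr h0.inv
  | @comp m n f g hf hg ihf ihg =>
    intro q hq h hh
    obtain ⟨q', h1, h2⟩ := chain hq (fun i q => NF 𝒰 q (fun z => g i (fun i => h i z)))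
      (fun i q q' hg hd => hg.nf hd)
      (fun i q' hgr => ihg i hgr.1 h (fun j => hgr.nf (hh j)))
    obtain ⟨q'', h3, h4⟩ := ihf h1.1 (fun i z => g i (fun i => h i z)) h2
    exact ⟨q'', h1.trans h3, h4⟩

end
end CellProof

open Filter Topology

namespace CellProof
section
open PadicSub
variable {p : ℕ} [Fact p.Prime]

theorem pset_ne {n : ℕ} {x : ℚ_[p]} (h : x ∈ Pset p n) : x ≠ 0 := by
  obtain ⟨y, hy, rfl⟩ := h
  exact pow_ne_zero _ hy

theorem pset_mul {n : ℕ} {x y : ℚ_[p]} (hx : x ∈ Pset p n) (hy : y ∈ Pset p n) : x * y ∈ Pset p n := by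
  obtain ⟨a, ha, rfl⟩ := hx
  obtain ⟨b, hb, rfl⟩ := hy
  exact ⟨a * b, mul_ne_zero ha hb, mul_pow _ _ _⟩

theorem pset_inv {n : ℕ} {x : ℚ_[p]} (hx : x ∈ Pset p n) : x⁻¹ ∈ Pset p n := by
  obtain ⟨a, ha, rfl⟩ := hx
  exact ⟨a⁻¹, inv_ne_zero ha, inv_pow _ _⟩

theorem pset_one (n : ℕ) : (1:ℚ_[p]) ∈ Pset p n := ⟨1, one_ne_zero, one_pow n⟩

theorem pset_zpow {n : ℕ} {x : ℚ_[p]} (hx : x ∈ Pset p n) (k : ℤ) : x ^ k ∈ Pset p n := by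
  obtain ⟨a, ha, rfl⟩ := hx
  exact ⟨a ^ k, zpow_ne_zero _ ha, by rw [← zpow_natCast, ← zpow_natCast, zpow_comm]⟩

theorem pset_dvd {m n : ℕ} (h : m ∣ n) {x : ℚ_[p]} (hx : x ∈ Pset p n) : x ∈ Pset p m := by
  obtain ⟨a, ha, rfl⟩ := hx
  obtain ⟨k, rfl⟩ := h
  exact ⟨a ^ k, pow_ne_zero _ ha, by rw [← pow_mul, mul_comm]⟩

theorem pow_strict (n : ℕ) : HasStrictDerivAt (fun x : ℚ_[p] => x ^ n) (n : ℚ_[p]) 1 := by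
  simpa using hasStrictDerivAt_pow n (1:ℚ_[p])

theorem pset_nhds {n : ℕ} (hn : 0 < n) : Pset p n ∈ 𝓝 (1:ℚ_[p]) := by
  have h := (pow_strict (p := p) n).map_nhds_eq (by exact_mod_cast hn.ne')
  simp only [one_pow] at h
  rw [← h, Filter.mem_map]
  filter_upwards [isOpen_ne.mem_nhds (one_ne_zero (α := ℚ_[p]))] with x hx
  exact ⟨x, hx, rfl⟩

/-- eventually stable property under multiplication by `N`-th powers -/
def Inv (Q : ℚ_[p] → Prop) : Prop :=
  ∃ N : ℕ, 0 < N ∧ ∀ᶠ x : ℚ_[p] × ℚ_[p] in 𝓝[≠] 0 ×ˢ 𝓝[≠] 0, x.2 / x.1 ∈ Pset p N → Q x.1 → Q x.2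

theorem Inv.all {ι : Type*} [Fintype ι] {Q : ι → ℚ_[p] → Prop} (h : ∀ i, Inv (Q i)) : Inv (fun τ => ∀ i, Q i τ) := by
  choose N hN h using h
  refine ⟨∏ i, N i, Finset.prod_pos fun i _ => hN i, ?_⟩
  filter_upwards [Filter.eventually_all.mpr h] with x hx h1 h2 i
  exact hx i (pset_dvd (Finset.dvd_prod_of_mem N (Finset.mem_univ i)) h1) (h2 i)

theorem Inv.ex {ι : Type*} [Fintype ι] {Q : ι → ℚ_[p] → Prop} (h : ∀ i, Inv (Q i)) : Inv (fun τ => ∃ i, Q i τ) := by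
  choose N hN h using h
  refine ⟨∏ i, N i, Finset.prod_pos fun i _ => hN i, ?_⟩
  filter_upwards [Filter.eventually_all.mpr h] with x hx h1 ⟨i, h2⟩
  exact ⟨i, hx i (pset_dvd (Finset.dvd_prod_of_mem N (Finset.mem_univ i)) h1) h2⟩

theorem mero_cases {h : ℚ_[p] → ℚ_[p]} (hh : MeromorphicAt h 0) :
    (∀ᶠ z in 𝓝[≠] (0:ℚ_[p]), h z = 0) ∨ ∃ (k : ℤ) (G : ℚ_[p] → ℚ_[p]), AnalyticAt ℚ_[p] G 0 ∧ G 0 ≠ 0 ∧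
      ∀ᶠ z in 𝓝[≠] (0:ℚ_[p]), h z = z ^ k * G z := by
  by_cases ht : meromorphicOrderAt h 0 = ⊤
  · exact Or.inl (meromorphicOrderAt_eq_top_iff.mp ht)
  · obtain ⟨G, h1, h2, h3⟩ := (meromorphicOrderAt_ne_top_iff hh).mp ht
    refine Or.inr ⟨(meromorphicOrderAt h 0).untop₀, G, h1, h2, h3.mono fun z hz => ?_⟩
    simpa using hz

theorem mero_ne (G : ℚ_[p] → ℚ_[p]) (hG : AnalyticAt ℚ_[p] G 0) (h0 : G 0 ≠ 0) :
    ∀ᶠ z in 𝓝[≠] (0:ℚ_[p]), z ≠ 0 ∧ G z ≠ 0 := by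
  filter_upwards [self_mem_nhdsWithin, (hG.continuousAt.eventually_ne h0).filter_mono nhdsWithin_le_nhds] with z h1 h2
  exact ⟨h1, h2⟩

theorem ratio_pset {G : ℚ_[p] → ℚ_[p]} (hG : ContinuousAt G 0) (h0 : G 0 ≠ 0) {N : ℕ} (hN : 0 < N) :
    ∀ᶠ x : ℚ_[p] × ℚ_[p] in 𝓝 0 ×ˢ 𝓝 0, G x.2 / G x.1 ∈ Pset p N := by
  have : Tendsto (fun x : ℚ_[p] × ℚ_[p] => G x.2 / G x.1) (𝓝 0 ×ˢ 𝓝 0) (𝓝 (G 0 / G 0)) :=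
    (hG.tendsto.comp tendsto_snd).div (hG.tendsto.comp tendsto_fst) h0
  rw [div_self h0] at this
  exact this.eventually (pset_nhds hN)

theorem Inv.zero {h : ℚ_[p] → ℚ_[p]} (hh : MeromorphicAt h 0) : Inv (fun τ => h τ = 0) := by
  refine ⟨1, one_pos, ?_⟩
  rcases mero_cases hh with h1 | ⟨k, G, hG, hG0, h1⟩
  · filter_upwards [h1.prod_inr (𝓝[≠] (0:ℚ_[p]))] with x hx _ _
    exact hx
  · filter_upwards [(h1.and (mero_ne G hG hG0)).prod_inl (𝓝[≠] (0:ℚ_[p]))] with x hx _ h2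
    rw [hx.1] at h2
    exact absurd h2 (mul_ne_zero (zpow_ne_zero _ hx.2.1) hx.2.2)

theorem Inv.pset {h : ℚ_[p] → ℚ_[p]} (hh : MeromorphicAt h 0) {n : ℕ} (hn : 0 < n) : Inv (fun τ => h τ ∈ Pset p n) := by
  refine ⟨n, hn, ?_⟩
  rcases mero_cases hh with h1 | ⟨k, G, hG, hG0, h1⟩
  · filter_upwards [h1.prod_inl (𝓝[≠] (0:ℚ_[p]))] with x hx _ h2
    exact absurd hx (pset_ne h2)
  · filter_upwards [(h1.and (mero_ne G hG hG0)).prod_mk (h1.and (mero_ne G hG hG0)),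
      (ratio_pset hG.continuousAt hG0 hn).filter_mono (Filter.prod_mono nhdsWithin_le_nhds nhdsWithin_le_nhds)]
        with x hx h3 h4 h5
    obtain ⟨⟨h6, h7, h8⟩, h9, h10, h11⟩ := hx
    have := pset_mul h5 (pset_mul (pset_zpow h4 k) h3)
    rw [h6] at this
    rw [h9]
    convert this using 1
    rw [div_zpow]
    field_simp

theorem dfun_mero {m : ℕ} {f : (Fin m → ℚ_[p]) → ℚ_[p]} (hf : IsDFunction p f) :
    ∀ (h : Fin m → ℚ_[p] → ℚ_[p]) (_ : ∀ i, MeromorphicAt (h i) 0), MeromorphicAt (fun τ => f (fun i => h i τ)) 0 := by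
  induction hf with
  | @ranal m a ha =>
    intro h hh
    have key : ∀ i, (∃ G : ℚ_[p] → ℚ_[p], AnalyticAt ℚ_[p] G 0 ∧ ∀ᶠ z in 𝓝[≠] (0:ℚ_[p]), h i z = G z) ∨
        ∀ᶠ z in 𝓝[≠] (0:ℚ_[p]), 1 < ‖h i z‖ := by
      intro i
      rcases mero_cases (hh i) with h1 | ⟨k, G, hG, hG0, h1⟩
      · exact Or.inl ⟨fun _ => 0, analyticAt_const, h1⟩
      · rcases lt_or_ge k 0 with hk | hk
        · right
          obtain ⟨n, rfl⟩ : ∃ n : ℕ, k = -((n:ℤ) + 1) := ⟨(-k - 1).toNat, by omega⟩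
          have ht : Tendsto (fun z : ℚ_[p] => z ^ (n + 1) * (G z)⁻¹) (𝓝 0) (𝓝 0) := by
            have := ((continuous_pow (n+1)).tendsto (0:ℚ_[p])).mul (hG.continuousAt.tendsto.inv₀ hG0)
            simpa using this
          filter_upwards [h1, mero_ne G hG hG0,
            (ht.eventually (Metric.ball_mem_nhds 0 one_pos)).filter_mono nhdsWithin_le_nhds] with z a b c
          have hne : h i z ≠ 0 := by rw [a]; exact mul_ne_zero (zpow_ne_zero _ b.1) b.2
          refine one_lt_of_inv hne ?_
          rw [a, mul_inv, zpow_neg, inv_inv]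
          exact_mod_cast c
        · left
          obtain ⟨n, rfl⟩ := Int.eq_ofNat_of_zero_le hk
          exact ⟨fun z => z ^ n * G z, (analyticAt_id.pow n).mul hG, by simpa using h1⟩
    by_cases hall : ∃ i, ∀ᶠ z in 𝓝[≠] (0:ℚ_[p]), 1 < ‖h i z‖
    · obtain ⟨i, hi⟩ := hall
      refine (MeromorphicAt.const (0:ℚ_[p]) 0).congr ?_
      filter_upwards [hi] with z hz
      exact (ranal_out a (j := i) hz).symm
    · push Not at hall
      choose G hG hGe using fun i => (key i).resolve_right (by simpa using hall i)
      have := (AnalyticAt.fun_comp (g := ranalFn p a) (f := fun w i => G i w) (ranal_analytic a ha _)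
            (analyticAt_pi_iff.mpr hG)).meromorphicAt
      refine this.congr ?_
      filter_upwards [Filter.eventually_all.mpr hGe] with z hz
      simp only [hz]
  | @poly m P =>
    intro h hh
    induction P using MvPolynomial.induction_on with
    | C a => simp
    | add P Q hP hQ => simp only [map_add]; exact hP.add hQ
    | mul_X P i hP => simp only [map_mul, MvPolynomial.eval_X]; exact hP.mul (hh i)
  | inv =>
    intro h hh
    exact (hh 0).inv
  | @comp m n f g hf hg ihf ihg =>
    intro h hh
    exact ihf (fun i τ => g i (fun i => h i τ)) (fun i => ihg i h hh)

theorem sub_inv {m : ℕ} {Γ : Set (Fin m → ℚ_[p])} (hΓ : IsSubanalytic p Γ) (h : Fin m → ℚ_[p] → ℚ_[p])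
    (hh : ∀ i, MeromorphicAt (h i) 0) : Inv (fun τ => (fun i => h i τ) ∈ Γ) := by
  obtain ⟨r, s, F, hF, rfl⟩ := hΓ
  have : Inv (fun τ => ∃ i, ∀ j, (fun l => h l τ) ∈ F i j) := by
    refine Inv.ex fun i => Inv.all fun j => ?_
    rcases hF i j with ⟨f, hf, e⟩ | ⟨f, n, hf, hn, e⟩
    · rw [e]; exact Inv.zero (dfun_mero hf h hh)
    · rw [e]; exact Inv.pset (dfun_mero hf h hh) hn
  simpa using this

/-- a root of a unit germ -/
theorem root_germ {U : ℚ_[p] → ℚ_[p]} (hU : AnalyticAt ℚ_[p] U 0) (h0 : U 0 ≠ 0) {k : ℕ} (hk : 0 < k) :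
    ∃ r : ℚ_[p] → ℚ_[p], ContinuousAt r 0 ∧ r 0 = 1 ∧ (∀ᶠ τ in 𝓝 (0:ℚ_[p]), U τ = U 0 * r τ ^ k) ∧
      map (fun τ => τ * r τ) (𝓝 0) = 𝓝 0 := by
  have hs := pow_strict (p := p) k
  have hk' : (k : ℚ_[p]) ≠ 0 := by exact_mod_cast hk.ne'
  have hL := hs.to_localInverse hk'
  have hR := hs.eventually_right_inverse hk'
  have hI : hs.localInverse _ _ _ hk' ((1:ℚ_[p]) ^ k) = 1 := HasStrictFDerivAt.localInverse_apply_image ..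
  set L := hs.localInverse _ _ _ hk' with hLdef
  simp only [one_pow] at hL hR hI
  have hV : HasStrictDerivAt (fun τ => U τ / U 0) (deriv U 0 / U 0) 0 := hU.hasStrictDerivAt.div_const _
  have hV0 : (fun τ => U τ / U 0) 0 = 1 := div_self h0
  have hr : HasStrictDerivAt (fun τ => L (U τ / U 0)) ((k:ℚ_[p])⁻¹ * (deriv U 0 / U 0)) 0 := by
    refine HasStrictDerivAt.comp (h₂ := L) (h := fun τ => U τ / U 0) 0 ?_ hV
    change HasStrictDerivAt L _ (U 0 / U 0)
    rw [div_self h0]; exact hL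
  have hr0 : L (U 0 / U 0) = 1 := by rw [div_self h0]; exact hI
  refine ⟨fun τ => L (U τ / U 0), hr.hasDerivAt.continuousAt, hr0, ?_, ?_⟩
  · have ht : Tendsto (fun τ => U τ / U 0) (𝓝 0) (𝓝 1) := by
      have := hV.hasDerivAt.continuousAt.tendsto
      rwa [div_self h0] at this
    filter_upwards [ht.eventually hR] with τ hτ
    rw [hτ]; field_simp
  · have := (hasStrictDerivAt_id (0:ℚ_[p])).mul hr
    have h2 := this.map_nhds_eq (by simp [hr0])
    simpa [Pi.mul_def] using h2

theorem norm_near {x y : ℚ_[p]} (h : x ∈ Metric.ball y ‖y‖) : ‖x‖ = ‖y‖ := by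
  have h' : ‖x - y‖ < ‖y‖ := by simpa [dist_eq_norm] using h
  have := IsUltrametricDist.norm_add_eq_max_of_norm_ne_norm h'.ne
  rwa [sub_add_cancel, max_eq_right h'.le] at this

theorem norm_germ {Y : ℚ_[p] → ℚ_[p]} (hY : MeromorphicAt Y 0) : ∃ b : ℤ,
    ∀ᶠ x : ℚ_[p] × ℚ_[p] in 𝓝[≠] 0 ×ˢ 𝓝[≠] 0, ‖Y x.2‖ = ‖Y x.1‖ * ‖x.2 / x.1‖ ^ b := by
  rcases mero_cases hY with h1 | ⟨b, G, hG, hG0, h1⟩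
  · refine ⟨0, ?_⟩
    filter_upwards [h1.prod_mk h1] with x hx
    rw [hx.1, hx.2]; simp
  · refine ⟨b, ?_⟩
    have hn : ∀ᶠ z in 𝓝[≠] (0:ℚ_[p]), ‖G z‖ = ‖G 0‖ := by
      have h2 := hG.continuousAt.eventually (Metric.ball_mem_nhds (G 0) (norm_pos_iff.mpr hG0))
      filter_upwards [h2.filter_mono nhdsWithin_le_nhds] with z hz
      exact norm_near hz
    have h3 := (h1.and hn).and (self_mem_nhdsWithin (a := (0:ℚ_[p])) (s := {0}ᶜ))
    filter_upwards [h3.prod_mk h3] with x hx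
    obtain ⟨⟨⟨h4, h5⟩, h6⟩, ⟨h7, h8⟩, h9⟩ := hx
    rw [h4, h7, norm_mul, norm_mul, h5, h8, norm_div, norm_zpow, norm_zpow, div_zpow]
    have : ‖x.1‖ ^ b ≠ 0 := zpow_ne_zero _ (norm_ne_zero_iff.mpr h6)
    field_simp

theorem arc_step {S Y : ℚ_[p] → ℚ_[p]} (hS : AnalyticAt ℚ_[p] S 0) (hS0 : S 0 = 0)
    (hSne : ¬ ∀ᶠ τ in 𝓝 (0:ℚ_[p]), S τ = 0) (hY : MeromorphicAt Y 0) {Q : ℚ_[p] → Prop} (hQ : Inv Q) :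
    ∃ (M : ℕ) (a : ℤ) (ε : ℝ), 0 < M ∧ 0 < ε ∧ ∀ᶠ τ in 𝓝[≠] (0:ℚ_[p]), Q τ → ∀ t', ‖t'‖ < ε →
      t' / S τ ∈ Pset p M → ∃ τ', S τ' = t' ∧ Q τ' ∧ ‖Y τ'‖ = ‖Y τ‖ * ‖t' ^ a * S τ ^ (-a)‖ ^ ((M : ℝ)⁻¹) := by
  obtain ⟨k, U, hU, hU0, hSU⟩ := (AnalyticAt.exists_eventuallyEq_pow_smul_nonzero_iff hS).mpr hSne
  have hk : 0 < k := by
    rcases Nat.eq_zero_or_pos k with rfl | hk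
    · have := hSU.self_of_nhds
      simp [hS0] at this
      exact absurd this.symm hU0
    · exact hk
  obtain ⟨r, hrc, hr0, hrU, hmap⟩ := root_germ hU hU0 hk
  obtain ⟨N, hN, hQ⟩ := hQ
  obtain ⟨b, hb⟩ := norm_germ hY
  have hrr := (ratio_pset hrc (by rw [hr0]; exact one_ne_zero) hN).filter_mono
    (Filter.prod_mono (nhdsWithin_le_nhds (s := {0}ᶜ)) (nhdsWithin_le_nhds (s := {0}ᶜ)))
  obtain ⟨W₁, hW₁, hpair⟩ := Filter.eventually_prod_self_iff'.mp ((hQ.and hb).and hrr)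
  have hone : ∀ᶠ τ in 𝓝[≠] (0:ℚ_[p]), S τ = U 0 * (τ * r τ) ^ k ∧ r τ ≠ 0 ∧ ‖r τ‖ = 1 := by
    have h2 := hrc.eventually (Metric.ball_mem_nhds (r 0) one_pos)
    filter_upwards [hSU.filter_mono nhdsWithin_le_nhds, hrU.filter_mono nhdsWithin_le_nhds,
      h2.filter_mono nhdsWithin_le_nhds] with τ h1 h2 h3
    have h4 : ‖r τ‖ = 1 := by
      rw [hr0] at h3
      have := norm_near (x := r τ) (y := 1) (by simpa using h3)
      simpa using this
    refine ⟨?_, ?_, h4⟩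
    · rw [h1, h2]; simp; ring
    · intro h; rw [h] at h4; simp at h4
  have hW : W₁ ∩ {τ | S τ = U 0 * (τ * r τ) ^ k ∧ r τ ≠ 0 ∧ ‖r τ‖ = 1} ∩ {0}ᶜ ∈ 𝓝[≠] (0:ℚ_[p]) :=
    inter_mem (inter_mem hW₁ hone) self_mem_nhdsWithin
  set W := W₁ ∩ {τ | S τ = U 0 * (τ * r τ) ^ k ∧ r τ ≠ 0 ∧ ‖r τ‖ = 1} ∩ {0}ᶜ with hWdef
  have hW0 : insert 0 W ∈ 𝓝 (0:ℚ_[p]) := insert_mem_nhds_iff.mpr hW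
  have him : (fun τ => τ * r τ) '' (insert 0 W) ∈ 𝓝 (0:ℚ_[p]) := by
    rw [← hmap]; exact image_mem_map hW0
  obtain ⟨ρ, hρ, hball⟩ := Metric.mem_nhds_iff.mp him
  refine ⟨k * N, b * N, ‖U 0‖ * ρ ^ k, by positivity, mul_pos (norm_pos_iff.mpr hU0) (pow_pos hρ k), ?_⟩
  filter_upwards [hW] with τ hτ hQτ t' ht' htM
  obtain ⟨⟨hτ1, hτS, hτr, hτn⟩, hτ0⟩ := hτ
  have hτ0 : τ ≠ 0 := hτ0
  obtain ⟨w, hw, hwt⟩ := htM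
  have hSτ : S τ ≠ 0 := by
    rw [hτS]; exact mul_ne_zero hU0 (pow_ne_zero _ (mul_ne_zero hτ0 hτr))
  have ht'e : t' = U 0 * (τ * r τ * w ^ N) ^ k := by
    have : t' = w ^ (k * N) * S τ := by rw [hwt]; field_simp
    rw [this, hτS]; ring
  have hθ : ‖τ * r τ * w ^ N‖ < ρ := by
    rw [ht'e, norm_mul, norm_pow] at ht'
    exact lt_of_pow_lt_pow_left₀ k hρ.le (lt_of_mul_lt_mul_left ht' (norm_nonneg _))
  obtain ⟨τ', hτ', hθ'⟩ := hball (mem_ball_zero_iff.mpr hθ)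
  have hθne : τ * r τ * w ^ N ≠ 0 := mul_ne_zero (mul_ne_zero hτ0 hτr) (pow_ne_zero _ hw)
  simp only at hθ'
  have hτ'W : τ' ∈ W := by
    rcases hτ' with rfl | h
    · rw [zero_mul] at hθ'; exact absurd hθ'.symm hθne
    · exact h
  obtain ⟨⟨hτ'1, hτ'S, hτ'r, hτ'n⟩, hτ'0⟩ := hτ'W
  have hτ'0 : τ' ≠ 0 := hτ'0
  have hSt : S τ' = t' := by rw [hτ'S, hθ', ht'e]
  obtain ⟨⟨hQ1, hn1⟩, hr1⟩ := hpair τ hτ1 τ' hτ'1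
  obtain ⟨-, hr2⟩ := hpair τ' hτ'1 τ hτ1
  simp only at hQ1 hn1 hr1 hr2
  have hrat : τ' / τ = w ^ N * (r τ / r τ') := by
    field_simp
    rw [hθ']; ring
  refine ⟨τ', hSt, hQ1 ?_ hQτ, ?_⟩
  · rw [hrat]; exact pset_mul ⟨w, hw, rfl⟩ hr2
  · rw [hn1]
    congr 1
    have e1 : ‖τ' / τ‖ = ‖w‖ ^ N := by
      rw [hrat, norm_mul, norm_div, hτn, hτ'n]; simp
    have e2 : t' ^ (b * N : ℤ) * S τ ^ (-(b * N : ℤ)) = (w ^ b) ^ (k * N * N) := by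
      rw [zpow_neg, ← div_eq_mul_inv, ← div_zpow, ← hwt, ← zpow_natCast, ← zpow_natCast, ← zpow_mul, ← zpow_mul]
      congr 1
      push_cast; ring
    rw [e1, e2, norm_pow, norm_zpow]
    have hwp : 0 < ‖w‖ := norm_pos_iff.mpr hw
    rw [pow_mul', ← pow_mul, mul_comm N (k * N), pow_mul', Real.pow_rpow_inv_natCast (by positivity) (by positivity)]
    rw [← zpow_natCast, ← zpow_natCast, ← zpow_mul, ← zpow_mul, mul_comm]

end
end CellProof

open Filter Topology

namespace CellProof
section
open PadicSub
variable {p : ℕ} [Fact p.Prime]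

theorem nf_local {Z : Type*} [TopologicalSpace Z] {𝒰 : Ultrafilter Z} {q₀ q : Z → ℚ_[p] × ℚ_[p]}
    (hN : NotArc 𝒰 q₀) (hq : IsChart 𝒰 q₀ q) {g : Z → ℚ_[p]} (hg : NF 𝒰 q g) :
    ∀ᶠ z in (𝒰 : Filter Z), (∀ᶠ z' in 𝓝 z, g z' = 0) ∨ (ContinuousAt g z ∧ g z ≠ 0) := by
  rcases hg with hg | ⟨i, j, U, hU, hU0, hg⟩
  · exact (ev_nl.mp hg).mono fun z hz => Or.inl hz
  · filter_upwards [ev_nl.mp hg, ev_of_nl hq.1, ev_of_nl (hq.ne_fst hN), ev_of_nl (hq.ne_snd hN),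
      hq.2.1.eventually hU.eventually_analyticAt, hq.2.1.eventually (hU.continuousAt.eventually_ne hU0)]
        with z h1 h2 h3 h4 h5 h6
    right
    constructor
    · refine ContinuousAt.congr ?_ (h1.mono fun z hz => hz.symm)
      exact ((h2.fst.zpow₀ i (Or.inl h3)).mul (h2.snd.zpow₀ j (Or.inl h4))).mul
        (ContinuousAt.comp (g := U) (f := q) h5.continuousAt h2)
    · rw [h1.self_of_nhds]
      exact mul_ne_zero (mul_ne_zero (zpow_ne_zero _ h3) (zpow_ne_zero _ h4)) h6

theorem pset_open {Z : Type*} [TopologicalSpace Z] {g : Z → ℚ_[p]} {z : Z} {n : ℕ} (hn : 0 < n)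
    (hc : ContinuousAt g z) (hg : g z ∈ Pset p n) : ∀ᶠ z' in 𝓝 z, g z' ∈ Pset p n := by
  have h0 := pset_ne hg
  have : Tendsto (fun z' => g z' / g z) (𝓝 z) (𝓝 (g z / g z)) := hc.tendsto.div_const _
  rw [div_self h0] at this
  filter_upwards [this.eventually (pset_nhds hn)] with z' hz'
  have := pset_mul hz' hg
  rwa [div_mul_cancel₀ _ h0] at this

abbrev Z2 (p : ℕ) [Fact p.Prime] := Fin 2 → ℚ_[p]

theorem not_notArc {Γ : Set (Z2 p)} (hΓ : IsSubanalytic p Γ)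
    (hfun : ∀ z ∈ Γ, ∀ z' ∈ Γ, z 0 = z' 0 → z 1 = z' 1) {𝒰 : Ultrafilter (Z2 p)} (h𝒰 : ∀ᶠ z in (𝒰 : Filter (Z2 p)), z ∈ Γ)
    {q₀ : Z2 p → ℚ_[p] × ℚ_[p]} (hq₀ : IsChart 𝒰 q₀ q₀) (hM : ∀ i : Fin 2, Mer 𝒰 q₀ (fun z => z i)) :
    ¬ NotArc 𝒰 q₀ := by
  intro hN
  obtain ⟨r, s, F, hF, rfl⟩ := hΓ
  obtain ⟨q₁, hg₁, h₁⟩ := chain hq₀ (fun (i : Fin 2) q => NF 𝒰 q (fun z : Z2 p => z i)) (fun i q q' hg hd => hg.nf hd)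
    (fun i q' hg => ((hM i).gr hN hq₀ hg).nf hN hg.1)
  have hF' : ∀ ij : Fin r × Fin s, ∃ f, IsDFunction p f ∧ (F ij.1 ij.2 = {x | f x = 0} ∨
      ∃ n, 0 < n ∧ F ij.1 ij.2 = {x | f x ∈ Pset p n}) := by
    rintro ⟨i, j⟩
    rcases hF i j with ⟨f, hf, e⟩ | ⟨f, n, hf, hn, e⟩
    · exact ⟨f, hf, Or.inl e⟩
    · exact ⟨f, hf, Or.inr ⟨n, hn, e⟩⟩
  choose f hf hFf using hF'
  obtain ⟨q₂, hg₂, h₂⟩ := chain hg₁.1 (fun ij q => NF 𝒰 q (fun z : Z2 p => f ij (fun i => z i)))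
    (fun i q q' hg hd => hg.nf hd)
    (fun ij q' hg => dfun_nf hN (hf ij) hg.1 (fun i z => z i) (fun i => hg.nf (h₁ i)))
  have hloc : ∀ᶠ z in (𝒰 : Filter (Z2 p)), ∀ ij : Fin r × Fin s, z ∈ F ij.1 ij.2 → F ij.1 ij.2 ∈ 𝓝 z := by
    rw [Filter.eventually_all]
    intro ij
    filter_upwards [nf_local hN hg₂.1 (h₂ ij)] with z hz hzF
    rcases hFf ij with e | ⟨n, hn, e⟩
    · rw [e] at hzF ⊢
      rcases hz with hz | hz
      · exact hz
      · exact absurd hzF hz.2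
    · rw [e] at hzF ⊢
      rcases hz with hz | hz
      · exact absurd hz.self_of_nhds (pset_ne hzF)
      · exact pset_open hn hz.1 hzF
  obtain ⟨z, hz1, hz2⟩ := (hloc.and h𝒰).exists
  obtain ⟨i, hi⟩ := Set.mem_iUnion.mp hz2
  have hnhd : (⋃ i, ⋂ j, F i j) ∈ 𝓝 z := by
    refine mem_of_superset ?_ (Set.subset_iUnion _ i)
    rw [Filter.iInter_mem]
    intro j
    exact hz1 (i, j) (Set.mem_iInter.mp hi j)
  have hcont : Tendsto (fun y : ℚ_[p] => Function.update z 1 y) (𝓝 (z 1)) (𝓝 z) := by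
    have : Continuous (fun y : ℚ_[p] => Function.update z 1 y) := continuous_const.update 1 continuous_id
    have h := this.tendsto (z 1)
    rwa [Function.update_eq_self] at h
  have h3 := (hcont.eventually hnhd).filter_mono (nhdsWithin_le_nhds (s := {z 1}ᶜ))
  obtain ⟨y, hy1, hy2⟩ := (h3.and self_mem_nhdsWithin).exists
  have := hfun _ hz2 _ hy1 (by simp)
  simp at this
  exact hy2 this.symm

theorem arc_exists {Γ : Set (Z2 p)} (hΓ : IsSubanalytic p Γ)
    (hfun : ∀ z ∈ Γ, ∀ z' ∈ Γ, z 0 = z' 0 → z 1 = z' 1) {𝒰 : Ultrafilter (Z2 p)} (h𝒰 : ∀ᶠ z in (𝒰 : Filter (Z2 p)), z ∈ Γ)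
    {t₀ : ℚ_[p]} (ht : Tendsto (fun z : Z2 p => z 0) 𝒰 (𝓝 t₀)) :
    ∃ (S Y : ℚ_[p] → ℚ_[p]) (τ : Z2 p → ℚ_[p]), AnalyticAt ℚ_[p] S 0 ∧ S 0 = 0 ∧ MeromorphicAt Y 0 ∧
      Tendsto τ 𝒰 (𝓝 0) ∧ ∀ᶠ z in (𝒰 : Filter (Z2 p)), z 0 = t₀ + S (τ z) ∧ z 1 = Y (τ z) := by
  have ht0 : Tendsto (fun z : Z2 p => z 0 - t₀) 𝒰 (𝓝 0) := by simpa using ht.sub_const t₀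
  have an1 : ∀ {c : ℚ_[p] → ℚ_[p] × ℚ_[p]}, AnalyticAt ℚ_[p] c 0 → AnalyticAt ℚ_[p] (fun τ => (c τ).1) 0 :=
    fun {c} hc => AnalyticAt.fun_comp (g := Prod.fst) (f := c) analyticAt_fst hc
  have an2 : ∀ {c : ℚ_[p] → ℚ_[p] × ℚ_[p]}, AnalyticAt ℚ_[p] c 0 → AnalyticAt ℚ_[p] (fun τ => (c τ).2) 0 :=
    fun {c} hc => AnalyticAt.fun_comp (g := Prod.snd) (f := c) analyticAt_snd hc
  by_cases hb : ∃ R : ℝ, ∀ᶠ z in (𝒰 : Filter (Z2 p)), ‖z 1‖ ≤ R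
  · obtain ⟨R, hR⟩ := hb
    obtain ⟨y₀, -, hy₀⟩ := (isCompact_closedBall (0:ℚ_[p]) R).ultrafilter_le_nhds (𝒰.map (fun z : Z2 p => z 1))
      (by rw [le_principal_iff]; exact hR.mono fun z hz => by simpa using hz)
    have hy : Tendsto (fun z : Z2 p => z 1 - y₀) 𝒰 (𝓝 0) := by
      have h : Tendsto (fun z : Z2 p => z 1) 𝒰 (𝓝 y₀) := hy₀
      simpa using h.sub_const y₀
    have hch : IsChart 𝒰 (fun z : Z2 p => (z 0 - t₀, z 1 - y₀)) (fun z : Z2 p => (z 0 - t₀, z 1 - y₀)) := by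
      refine ⟨Eventually.of_forall fun z => by fun_prop, ht0.prodMk_nhds hy, id, analyticAt_id, rfl, by simp⟩
    have := not_notArc hΓ hfun h𝒰 hch (by
      intro i
      fin_cases i
      · refine Mer.of_an ((An.fst.add (An.const t₀)).congr ?_)
        simp
      · refine Mer.of_an ((An.snd.add (An.const y₀)).congr ?_)
        simp)
    unfold NotArc at this
    push Not at this
    obtain ⟨c, τ, h1, h2, h3, h4⟩ := this
    refine ⟨fun x => (c x).1, fun x => (c x).2 + y₀, τ, an1 h1, by simp [h2],
      ((an2 h1).add analyticAt_const).meromorphicAt, h3, ?_⟩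
    filter_upwards [h4] with z hz
    rw [← hz]; simp
  · push Not at hb
    have hy : Tendsto (fun z : Z2 p => (z 1)⁻¹) 𝒰 (𝓝 0) := by
      refine Filter.tendsto_inv₀_cobounded.comp ?_
      rw [← tendsto_norm_atTop_iff_cobounded, tendsto_atTop]
      intro R
      filter_upwards [hb R] with z hz
      exact hz.le
    have hne : ∀ᶠ z in (𝒰 : Filter (Z2 p)), z 1 ≠ 0 := by
      filter_upwards [hb 0] with z hz h0
      simp [h0] at hz
    have hne' : ∀ᶠ z in nl 𝒰, z 1 ≠ 0 := ne_nl (q := fun z : Z2 p => z 1) (Eventually.of_forall fun z => (continuous_apply (1 : Fin 2)).continuousAt) hne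
    have hch : IsChart 𝒰 (fun z : Z2 p => (z 0 - t₀, (z 1)⁻¹)) (fun z : Z2 p => (z 0 - t₀, (z 1)⁻¹)) := by
      refine ⟨hne'.mono fun z hz => ?_, ht0.prodMk_nhds hy, id, analyticAt_id, rfl, by simp⟩
      exact ContinuousAt.prodMk (((continuous_apply (0 : Fin 2)).sub continuous_const).continuousAt) (ContinuousAt.inv₀ ((continuous_apply (1 : Fin 2)).continuousAt) hz)
    have := not_notArc hΓ hfun h𝒰 hch (by
      intro i
      fin_cases i
      · refine Mer.of_an ((An.fst.add (An.const t₀)).congr ?_)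
        simp
      · refine ⟨1, An.fst.congr ?_⟩
        filter_upwards [hne'] with z hz
        simp [hz])
    unfold NotArc at this
    push Not at this
    obtain ⟨c, τ, h1, h2, h3, h4⟩ := this
    refine ⟨fun x => (c x).1, (fun x => (c x).2)⁻¹, τ, an1 h1, by simp [h2], (an2 h1).meromorphicAt.inv, h3, ?_⟩
    filter_upwards [h4] with z hz
    simp [← hz]

def Good (X : Set ℚ_[p]) (f : ℚ_[p] → ℚ_[p]) (t₀ : ℚ_[p]) (N : ℕ) (ε : ℝ) (t : ℚ_[p]) : Prop :=
  ∃ a : ℤ, ∀ t', ‖t' - t₀‖ < ε → (t' - t₀) / (t - t₀) ∈ Pset p N →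
    t' ∈ X ∧ ‖f t'‖ = ‖f t‖ * ‖(t' - t₀) ^ a * (t - t₀) ^ (-a)‖ ^ ((N : ℝ)⁻¹)

theorem Good.mono {X : Set ℚ_[p]} {f : ℚ_[p] → ℚ_[p]} {t₀ : ℚ_[p]} {M N : ℕ} {ε ε' : ℝ} {t : ℚ_[p]}
    (hN : 0 < N) (hMN : M ∣ N) (hε : ε' ≤ ε) (h : Good X f t₀ M ε t) : Good X f t₀ N ε' t := by
  obtain ⟨a, h⟩ := h
  obtain ⟨K, rfl⟩ := hMN
  have hK : 0 < K := Nat.pos_of_mul_pos_left hN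
  refine ⟨a * K, fun t' h1 h2 => ?_⟩
  obtain ⟨h3, h4⟩ := h t' (h1.trans_le hε) (pset_dvd (Dvd.intro _ rfl) h2)
  refine ⟨h3, h4.trans ?_⟩
  congr 1
  have e : (t' - t₀) ^ (a * K : ℤ) * (t - t₀) ^ (-(a * K : ℤ)) = ((t' - t₀) ^ a * (t - t₀) ^ (-a)) ^ K := by
    rw [mul_pow, ← zpow_natCast _ K, ← zpow_natCast _ K, ← zpow_mul, ← zpow_mul, neg_mul]
  rw [e, norm_pow]
  push_cast
  rw [mul_inv, mul_comm (M:ℝ)⁻¹, Real.rpow_mul (by positivity), Real.pow_rpow_inv_natCast (by positivity) hK.ne']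

theorem local_good {X : Set ℚ_[p]} {f : ℚ_[p] → ℚ_[p]} (hf : IsSubanalyticFnOn1 p X f) (t₀ : ℚ_[p]) :
    ∃ (N : ℕ) (ε : ℝ), 0 < N ∧ 0 < ε ∧ ∀ t ∈ X, t ≠ t₀ → ‖t - t₀‖ < ε → Good X f t₀ N ε t := by
  by_contra hcon
  push Not at hcon
  have hk : ∀ k : ℕ, ∃ t ∈ X, t ≠ t₀ ∧ ‖t - t₀‖ < 1 / ((k:ℝ) + 1) ∧ ¬ Good X f t₀ (k.factorial) (1 / ((k:ℝ) + 1)) t :=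
    fun k => hcon _ _ k.factorial_pos (by positivity)
  choose t htX htne htlt hbad using hk
  let ζ : ℕ → Z2 p := fun k => ![t k, f (t k)]
  let 𝒰 : Ultrafilter (Z2 p) := (hyperfilter ℕ).map ζ
  have hat : (hyperfilter ℕ : Filter ℕ) ≤ atTop := by
    rw [← Nat.cofinite_eq_atTop]; exact hyperfilter_le_cofinite
  have hlim : Tendsto t (hyperfilter ℕ : Filter ℕ) (𝓝 t₀) := by
    refine Tendsto.mono_left ?_ hat
    rw [tendsto_iff_norm_sub_tendsto_zero]
    exact squeeze_zero (fun _ => norm_nonneg _) (fun k => (htlt k).le) tendsto_one_div_add_atTop_nhds_zero_nat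
  have hfun : ∀ z ∈ {z : Z2 p | z 0 ∈ X ∧ f (z 0) = z 1}, ∀ z' ∈ {z : Z2 p | z 0 ∈ X ∧ f (z 0) = z 1},
      z 0 = z' 0 → z 1 = z' 1 := by
    intro z hz z' hz' h
    rw [← hz.2, ← hz'.2, h]
  obtain ⟨S, Y, τ, hS, hS0, hY, hτ, he⟩ := arc_exists (𝒰 := 𝒰) hf hfun
    (show ∀ᶠ k in (hyperfilter ℕ : Filter ℕ), _ from Eventually.of_forall fun k => ⟨htX k, rfl⟩) (t₀ := t₀) hlim
  have hτ' : Tendsto (fun k => τ (ζ k)) (hyperfilter ℕ : Filter ℕ) (𝓝 0) := hτ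
  have he' : ∀ᶠ k in (hyperfilter ℕ : Filter ℕ), t k = t₀ + S (τ (ζ k)) ∧ f (t k) = Y (τ (ζ k)) := he
  have hSne : ¬ ∀ᶠ x in 𝓝 (0:ℚ_[p]), S x = 0 := by
    intro h
    obtain ⟨k, h1, h2⟩ := (he'.and (hτ'.eventually h)).exists
    exact htne k (by rw [h1.1, h2, add_zero])
  have hτne : Tendsto (fun k => τ (ζ k)) (hyperfilter ℕ : Filter ℕ) (𝓝[≠] 0) := by
    refine tendsto_nhdsWithin_iff.mpr ⟨hτ', he'.mono fun k hk h0 => htne k ?_⟩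
    have h0 : τ (ζ k) = 0 := h0
    rw [hk.1, h0, hS0, add_zero]
  have hQ := sub_inv hf ![fun x => t₀ + S x, Y] (by
    intro i
    fin_cases i
    · exact (analyticAt_const.add hS).meromorphicAt
    · exact hY)
  obtain ⟨M, a, ε, hM, hε, hstep⟩ := arc_step hS hS0 hSne hY hQ
  have hlarge : ∀ᶠ k : ℕ in (hyperfilter ℕ : Filter ℕ), M ≤ k ∧ 1 / ((k:ℝ) + 1) ≤ ε :=
    ((eventually_ge_atTop M).and
      ((tendsto_one_div_add_atTop_nhds_zero_nat (𝕜 := ℝ)).eventually (ge_mem_nhds hε))).filter_mono hat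
  obtain ⟨k, h1, h2, h4, h5⟩ := (he'.and ((hτne.eventually hstep).and hlarge)).exists
  refine hbad k (Good.mono k.factorial_pos (Nat.dvd_factorial hM h4) h5 ⟨a, fun t' ht' hP => ?_⟩)
  have hSt : S (τ (ζ k)) = t k - t₀ := by rw [h1.1]; ring
  obtain ⟨τ', e1, e2, e3⟩ := h2 (by simpa [← h1.1, ← h1.2] using htX k) (t' - t₀) ht' (by rwa [hSt])
  have e4 : t₀ + S τ' = t' := by rw [e1]; ring
  simp [e4] at e2
  refine ⟨e2.1, ?_⟩
  rw [e2.2, e3, h1.2, hSt]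

end
end CellProof

open Filter Topology

namespace CellProof
section
open PadicSub
variable {p : ℕ} [Fact p.Prime]

/-- Finitely many cosets of `Pset p n`. -/
theorem coset_fin {n : ℕ} (hn : 0 < n) : ∃ C : Finset ℚ_[p], ∀ x : ℚ_[p], x ≠ 0 → ∃ c ∈ C, x / c ∈ Pset p n := by
  have hp1 : (1:ℝ) < p := by exact_mod_cast (Fact.out : p.Prime).one_lt
  have hp0 : (p:ℚ_[p]) ≠ 0 := by exact_mod_cast (Fact.out : p.Prime).ne_zero
  have hK : IsCompact {x : ℚ_[p] | 1 ≤ ‖x‖ ∧ ‖x‖ ≤ (p:ℝ) ^ n} := by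
    refine (isCompact_closedBall (0:ℚ_[p]) ((p:ℝ) ^ n)).of_isClosed_subset
      ((isClosed_le continuous_const continuous_norm).inter (isClosed_le continuous_norm continuous_const)) ?_
    intro x hx
    simpa using hx.2
  obtain ⟨C, -, hC⟩ := hK.elim_nhds_subcover (fun c => {x | x / c ∈ Pset p n}) (by
    intro c hc
    have hc0 : c ≠ 0 := by
      rintro rfl
      have := hc.1
      norm_num at this
    refine pset_open (g := fun x => x / c) hn (continuous_id.div_const c).continuousAt ?_
    rw [div_self hc0]; exact pset_one n)
  refine ⟨C, fun x hx => ?_⟩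
  have hpn : (1:ℝ) < (p:ℝ) ^ n := one_lt_pow₀ hp1 hn.ne'
  obtain ⟨k, hk1, hk2⟩ := exists_mem_Ico_zpow (norm_pos_iff.mpr hx) hpn
  have hnorm : ‖x * ((p:ℚ_[p]) ^ k) ^ n‖ = ‖x‖ / ((p:ℝ) ^ n) ^ k := by
    rw [norm_mul, norm_pow, norm_zpow, Padic.norm_p, inv_zpow, inv_pow, div_eq_mul_inv]
    congr 2
    rw [← zpow_natCast, ← zpow_natCast, zpow_comm]
  have hpos : (0:ℝ) < ((p:ℝ) ^ n) ^ k := by positivity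
  have hy : x * ((p:ℚ_[p]) ^ k) ^ n ∈ {x : ℚ_[p] | 1 ≤ ‖x‖ ∧ ‖x‖ ≤ (p:ℝ) ^ n} := by
    constructor
    · rw [hnorm, le_div_iff₀ hpos, one_mul]; exact hk1
    · rw [hnorm, div_le_iff₀ hpos]
      rw [zpow_add_one₀ (by positivity), mul_comm] at hk2
      exact hk2.le
  obtain ⟨c, hc, h⟩ := Set.mem_iUnion₂.mp (hC hy)
  refine ⟨c, hc, ?_⟩
  have h : x * ((p:ℚ_[p]) ^ k) ^ n / c ∈ Pset p n := h
  have hq : ((p:ℚ_[p]) ^ k) ^ n ∈ Pset p n := ⟨_, zpow_ne_zero _ hp0, rfl⟩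
  have := pset_mul h (pset_inv hq)
  have e : x * ((p:ℚ_[p]) ^ k) ^ n / c * (((p:ℚ_[p]) ^ k) ^ n)⁻¹ = x / c := by
    have := pset_ne hq
    field_simp
  rwa [e] at this

/-- A cell on which the norm of `f` has the required form. -/
def Piece (f : ℚ_[p] → ℚ_[p]) (A : Set ℚ_[p]) : Prop :=
  ∃ (γ μ : ℚ_[p]) (n : ℕ), IsCell1 p A γ μ n ∧ ∃ (δ : ℚ_[p]) (a : ℤ), (μ = 0 → a = 0) ∧
    ∀ t ∈ A, ‖f t‖ = ‖δ‖ * ‖(t - γ) ^ a * μ ^ (-a)‖ ^ ((n : ℝ)⁻¹)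

/-- A set with a finite partition into pieces. -/
def Dec (f : ℚ_[p] → ℚ_[p]) (X : Set ℚ_[p]) : Prop :=
  ∃ F : Set (Set ℚ_[p]), F.Finite ∧ F.PairwiseDisjoint id ∧ (∀ A ∈ F, Piece f A) ∧ ⋃₀ F = X

theorem Dec.empty (f : ℚ_[p] → ℚ_[p]) : Dec f ∅ := ⟨∅, Set.finite_empty, by simp, by simp, by simp⟩

theorem Dec.union {f : ℚ_[p] → ℚ_[p]} {X Y : Set ℚ_[p]} (hX : Dec f X) (hY : Dec f Y) (h : Disjoint X Y) :
    Dec f (X ∪ Y) := by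
  obtain ⟨F, h1, h2, h3, rfl⟩ := hX
  obtain ⟨G, g1, g2, g3, rfl⟩ := hY
  refine ⟨F ∪ G, h1.union g1, ?_, ?_, Set.sUnion_union F G⟩
  · rw [Set.pairwiseDisjoint_union]
    refine ⟨h2, g2, fun A hA B hB _ => ?_⟩
    exact h.mono (Set.subset_sUnion_of_mem hA) (Set.subset_sUnion_of_mem hB)
  · rintro A (hA | hA)
    · exact h3 A hA
    · exact g3 A hA

theorem Dec.of_piece {f : ℚ_[p] → ℚ_[p]} {X : Set ℚ_[p]} (h : Piece f X) : Dec f X :=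
  ⟨{X}, Set.finite_singleton X, by simp, by simpa using h, by simp⟩

theorem piece_singleton (f : ℚ_[p] → ℚ_[p]) (t₀ : ℚ_[p]) : Piece f {t₀} := by
  refine ⟨t₀, 0, 1, ⟨one_pos, ⟨t₀, rfl⟩, 1, 1, false, false, one_ne_zero, one_ne_zero, ?_⟩, f t₀, 0, fun _ => rfl, ?_⟩
  · ext t
    simp only [sqRel, cosetP, Set.mem_singleton_iff, Set.mem_ofPred_eq, zero_mul]
    constructor
    · rintro rfl
      simp
      exact ⟨1, pset_one 1⟩
    · rintro ⟨-, -, y, -, h⟩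
      exact sub_eq_zero.mp h
  · rintro t rfl
    simp

theorem local_dec {X : Set ℚ_[p]} {f : ℚ_[p] → ℚ_[p]} (hf : IsSubanalyticFnOn1 p X f) (t₀ : ℚ_[p]) :
    ∃ r : ℝ, 0 < r ∧ Dec f (X ∩ Metric.ball t₀ r) := by
  obtain ⟨N, ε, hN, hε, hg⟩ := local_good hf t₀
  obtain ⟨β, hβ0, hβ⟩ := NormedField.exists_norm_lt ℚ_[p] hε
  refine ⟨‖β‖, hβ0, ?_⟩
  have hβne : β ≠ 0 := norm_pos_iff.mp hβ0
  obtain ⟨C, hC⟩ := coset_fin (p := p) hN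
  let S : ℚ_[p] → Set ℚ_[p] := fun c => {t | t ∈ X ∧ t ≠ t₀ ∧ ‖t - t₀‖ < ‖β‖ ∧ (t - t₀) / c ∈ Pset p N}
  have hpunct : Dec f {t | t ∈ X ∧ t ≠ t₀ ∧ ‖t - t₀‖ < ‖β‖} := by
    refine ⟨{A | A.Nonempty ∧ A ∈ S '' (C : Set ℚ_[p])}, (C.finite_toSet.image S).subset fun A hA => hA.2, ?_, ?_, ?_⟩
    · rintro A ⟨-, c, -, rfl⟩ B ⟨-, d, -, rfl⟩ hne
      rw [Function.onFun, Set.disjoint_left]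
      rintro t ⟨h1, h2, h3, h4⟩ ⟨-, -, -, h5⟩
      apply hne
      have h0 : t - t₀ ≠ 0 := sub_ne_zero.mpr h2
      have hc0 : c ≠ 0 := by rintro rfl; exact pset_ne h4 (by simp)
      have hd0 : d ≠ 0 := by rintro rfl; exact pset_ne h5 (by simp)
      have hcd : c / d ∈ Pset p N := by
        have := pset_mul h5 (pset_inv h4)
        have e : (t - t₀) / d * ((t - t₀) / c)⁻¹ = c / d := by field_simp
        rwa [e] at this
      ext s
      refine and_congr_right fun _ => and_congr_right fun _ => and_congr_right fun _ => ⟨fun h => ?_, fun h => ?_⟩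
      · have := pset_mul h hcd
        rwa [div_mul_div_cancel₀ hc0] at this
      · have := pset_mul h (pset_inv hcd)
        rwa [inv_div, div_mul_div_cancel₀ hd0] at this
    · rintro A ⟨⟨t, ht⟩, c, -, rfl⟩
      obtain ⟨h1, h2, h3, h4⟩ := ht
      have h0 : t - t₀ ≠ 0 := sub_ne_zero.mpr h2
      have hc0 : c ≠ 0 := by rintro rfl; exact pset_ne h4 (by simp)
      obtain ⟨a, ha⟩ := hg t h1 h2 (h3.trans hβ)
      have key : ∀ s, (s - t₀) / c ∈ Pset p N ↔ (s - t₀) / (t - t₀) ∈ Pset p N := by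
        intro s
        constructor
        · intro h
          have := pset_mul h (pset_inv h4)
          rwa [inv_div, div_mul_div_cancel₀ hc0] at this
        · intro h
          have := pset_mul h h4
          rwa [div_mul_div_cancel₀ h0] at this
      refine ⟨t₀, t - t₀, N, ⟨hN, ⟨t, h1, h2, h3, h4⟩, 1, β, false, true, one_ne_zero, hβne, ?_⟩, f t, a,
        fun h => absurd h h0, ?_⟩
      · ext s
        constructor
        · rintro ⟨-, -, k3, k4⟩
          refine ⟨fun h => absurd h (by simp), fun _ => k3, _, (key s).mp k4, ?_⟩
          rw [mul_div_cancel₀ _ h0]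
        · rintro ⟨-, k3, y, hy, hs⟩
          have k3 : ‖s - t₀‖ < ‖β‖ := k3 rfl
          have hq : (s - t₀) / (t - t₀) ∈ Pset p N := by rwa [hs, mul_div_cancel_left₀ _ h0]
          refine ⟨(ha s (k3.trans hβ) hq).1, ?_, k3, (key s).mpr hq⟩
          rintro rfl
          exact pset_ne hq (by simp)
      · rintro s ⟨-, -, k3, k4⟩
        exact (ha s (k3.trans hβ) ((key s).mp k4)).2
    · ext t
      constructor
      · rintro ⟨A, ⟨-, c, -, rfl⟩, h1, h2, h3, -⟩
        exact ⟨h1, h2, h3⟩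
      · rintro ⟨h1, h2, h3⟩
        obtain ⟨c, hc, h4⟩ := hC (t - t₀) (sub_ne_zero.mpr h2)
        exact ⟨S c, ⟨⟨t, h1, h2, h3, h4⟩, c, hc, rfl⟩, h1, h2, h3, h4⟩
  by_cases h0 : t₀ ∈ X
  · have := (Dec.of_piece (piece_singleton f t₀)).union hpunct (by simp)
    convert this using 1
    ext t
    simp only [Set.mem_inter_iff, Metric.mem_ball, dist_eq_norm, Set.mem_union, Set.mem_singleton_iff, Set.mem_ofPred_eq]
    by_cases ht : t = t₀
    · subst ht; simpa [h0] using hβne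
    · simp [ht]
  · convert hpunct using 1
    ext t
    simp only [Set.mem_inter_iff, Metric.mem_ball, dist_eq_norm, Set.mem_ofPred_eq]
    constructor
    · rintro ⟨h1, h2⟩
      exact ⟨h1, by rintro rfl; exact h0 h1, h2⟩
    · rintro ⟨h1, -, h2⟩
      exact ⟨h1, h2⟩

theorem global_dec {X : Set ℚ_[p]} (hX : X ⊆ {x | ‖x‖ ≤ 1}) {f : ℚ_[p] → ℚ_[p]} (hf : IsSubanalyticFnOn1 p X f) :
    Dec f X := by
  classical
  choose r hr hD using fun t₀ => local_dec hf t₀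
  have hfin : ∀ T : Finset ℚ_[p], Dec f (X ∩ ⋃ t ∈ T, Metric.ball t (r t)) := by
    intro T
    induction T using Finset.induction_on_min_value r with
    | empty => simpa using Dec.empty f
    | insert t T ht hmin ih =>
      rw [Finset.set_biUnion_insert]
      by_cases h : ∃ s ∈ T, ¬ Disjoint (Metric.ball t (r t)) (Metric.ball s (r s))
      · obtain ⟨s, hs, hd⟩ := h
        rw [Set.not_disjoint_iff] at hd
        obtain ⟨x, hx1, hx2⟩ := hd
        have hsub : Metric.ball t (r t) ⊆ ⋃ t ∈ T, Metric.ball t (r t) := by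
          refine Set.Subset.trans ?_ (Set.subset_biUnion_of_mem (u := fun t => Metric.ball t (r t)) hs)
          rw [IsUltrametricDist.ball_eq_of_mem hx1, IsUltrametricDist.ball_eq_of_mem hx2]
          exact Metric.ball_subset_ball (hmin s hs)
        rwa [Set.union_eq_self_of_subset_left hsub]
      · push Not at h
        rw [Set.inter_union_distrib_left]
        refine (hD t).union ih ?_
        refine Disjoint.mono Set.inter_subset_right Set.inter_subset_right ?_
        rw [Set.disjoint_iUnion₂_right]
        exact h
  obtain ⟨T, -, hT⟩ := (isCompact_closedBall (0:ℚ_[p]) 1).elim_nhds_subcover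
    (fun t => Metric.ball t (r t)) (fun t _ => Metric.ball_mem_nhds t (hr t))
  have := hfin T
  rwa [Set.inter_eq_left.mpr] at this
  exact fun x hx => hT (by simpa using hX hx)

theorem final {X : Set ℚ_[p]} (hX : X ⊆ {x | ‖x‖ ≤ 1}) {f : ℚ_[p] → ℚ_[p]} (hf : IsSubanalyticFnOn1 p X f) :
    ∃ (k : ℕ) (A : Fin k → Set ℚ_[p]) (γ μ : Fin k → ℚ_[p]) (n : Fin k → ℕ),
      (∀ i j, i ≠ j → Disjoint (A i) (A j)) ∧ (⋃ i, A i) = X ∧ (∀ i, IsCell1 p (A i) (γ i) (μ i) (n i)) ∧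
      ∀ i, ∃ (δ : ℚ_[p]) (a : ℤ), (μ i = 0 → a = 0) ∧
        ∀ t ∈ A i, ‖f t‖ = ‖δ‖ * ‖(t - γ i) ^ a * μ i ^ (-a)‖ ^ ((n i : ℝ)⁻¹) := by
  obtain ⟨F, hF, h1, h2, h3⟩ := global_dec hX hf
  obtain ⟨k, A, hA, hr⟩ := hF.fin_param
  have hm : ∀ i, A i ∈ F := fun i => by rw [← hr]; exact ⟨i, rfl⟩
  choose γ μ n hc hδ using fun i => h2 (A i) (hm i)
  refine ⟨k, A, γ, μ, n, fun i j hij => h1 (hm i) (hm j) (hA.ne hij), ?_, hc, hδ⟩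
  rw [← h3, ← hr, Set.sUnion_range]

end
end CellProof


open PadicSub in
/-- Lemma 2.6 of the paper (one-variable cell decomposition).  For a subanalytic set
`X ⊆ ℤ_p` and a subanalytic function `f : X → ℚ_p` there is a finite partition of `X` into
cells such that on each cell `A` with center `γ` and coset `μ P_n`,
`|f(t)| = |δ| · |(t - γ)^a μ^{-a}|^{1/n}` for some `δ ∈ ℚ_p` and integer `a` (with the
conventions `a = 0` and `0^0 = 1` when `μ = 0`). -/
theorem cell_decomposition_dim_one
    (p : ℕ) [Fact p.Prime] (X : Set ℚ_[p]) (hXZp : X ⊆ {x : ℚ_[p] | ‖x‖ ≤ 1})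
    (hX : IsSubanalytic1 p X) (f : ℚ_[p] → ℚ_[p]) (hf : IsSubanalyticFnOn1 p X f) :
    ∃ (k : ℕ) (A : Fin k → Set ℚ_[p]) (γ μ : Fin k → ℚ_[p]) (n : Fin k → ℕ),
      (∀ i j, i ≠ j → Disjoint (A i) (A j)) ∧
      (⋃ i, A i) = X ∧
      (∀ i, IsCell1 p (A i) (γ i) (μ i) (n i)) ∧
      ∀ i, ∃ (δ : ℚ_[p]) (a : ℤ), (μ i = 0 → a = 0) ∧
        ∀ t ∈ A i, ‖f t‖ = ‖δ‖ * ‖(t - γ i) ^ a * μ i ^ (-a)‖ ^ ((n i : ℝ)⁻¹) := by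
  exact CellProof.final hXZp hf
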